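/- arXiv:1002.2786 — 2 statements merged into one kernel-verified Lean document; each statement's English description precedes it below -/
import Mathlib

section
/- There is no algorithm (partial recursive function on codes) that, on input of a code of a finite presentation P = (m, R) whose presented group is non-abelian, halts and outputs two indices i, j < m such that the images in the presented group of the i-th and j-th free generators do not commute. -/
/-- A word in `m` generators. -/
abbrev Word (m : ℕ) : Type := List (Fin m × Bool)

/-- A finite presentation: a number of generators together with a finite list of relator words. -/
abbrev FinPres : Type := Σ m : ℕ, List (Word m)

/-- The set of relators of a finite presentation, as elements of the free group. -/
def FinPres.rels (P : FinPres) : Set (FreeGroup (Fin P.1)) :=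
  {x | ∃ r ∈ P.2, x = FreeGroup.mk r}

/-- The group presented by a finite presentation. -/
abbrev FinPres.Grp (P : FinPres) : Type := PresentedGroup P.rels

/-- The projection from the free group onto the presented group. -/
def FinPres.proj (P : FinPres) : FreeGroup (Fin P.1) →* P.Grp :=
  PresentedGroup.mk P.rels

/-- The `n`-th recursively enumerable set: the domain of the `n`-th partial recursive
function under the canonical numbering. -/
def W (n : ℕ) : Set ℕ := {x | ((Denumerable.ofNat Nat.Partrec.Code n).eval x).Dom}

/-- The set of orders of nontrivial torsion elements of a group. -/
def TorOrd (G : Type*) [Group G] : Set ℕ := {n | 2 ≤ n ∧ ∃ g : G, orderOf g = n}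

/-- A family of pairs of embeddings into a group `G` becomes simultaneously conjugate in a
group containing `G`. -/
theorem exists_conj_extension {G I : Type} [Group G] [Finite I] {P : I → Type}
    [∀ i, Group (P i)] (f g : ∀ i, P i →* G) (hf : ∀ i, Function.Injective (f i))
    (hg : ∀ i, Function.Injective (g i)) :
    ∃ (L : Type) (_ : Group L) (ι : G →* L) (r : I → L),
      Function.Injective ι ∧ ∀ i p, r i * ι (f i p) = ι (g i p) * r i := by
  classical
  have := Fintype.ofFinite I
  suffices H : ∀ s : Finset I, ∃ (L : Type) (_ : Group L) (ι : G →* L) (r : I → L),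
      Function.Injective ι ∧ ∀ i ∈ s, ∀ p, r i * ι (f i p) = ι (g i p) * r i by
    simpa using H Finset.univ
  intro s
  induction s using Finset.induction_on with
  | empty => exact ⟨G, inferInstance, MonoidHom.id G, fun _ => 1, fun _ _ h => h, by simp⟩
  | insert a s ha ih =>
    obtain ⟨L, _, ι, r, hι, hr⟩ := ih
    have hf' : Function.Injective (ι.comp (f a)) := hι.comp (hf a)
    have hg' : Function.Injective (ι.comp (g a)) := hι.comp (hg a)
    let φ := (MonoidHom.ofInjective hf').symm.trans (MonoidHom.ofInjective hg')
    refine ⟨HNNExtension L _ _ φ, inferInstance, HNNExtension.of.comp ι,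
      Function.update (fun i => HNNExtension.of (r i)) a HNNExtension.t,
      (HNNExtension.of_injective (φ := φ)).comp hι, fun i hi p => ?_⟩
    rcases eq_or_ne i a with rfl | hia
    · have := HNNExtension.t_mul_of (φ := φ) (MonoidHom.ofInjective hf' p)
      rw [show φ (MonoidHom.ofInjective hf' p) = MonoidHom.ofInjective hg' p by simp [φ]] at this
      simp only [Function.update_self]
      exact this
    · have his : i ∈ s := (Finset.mem_insert.1 hi).resolve_left hia
      simp only [Function.update_of_ne hia, MonoidHom.comp_apply, ← map_mul, hr i his p]

/-- The permutational wreath product of `ℤ/2` by a group `H` acting on `X`: pairs of a finitely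
supported function `X → ℤ/2` and an element of `H`. -/
@[ext]
structure Lamp (H X : Type) where
  /-- The finitely supported function. -/
  lamps : X →₀ ZMod 2
  /-- The component in the acting group. -/
  shift : H

namespace Lamp

variable {H X H' X' : Type} [Group H] [MulAction H X] [Group H'] [MulAction H' X']

theorem mapDomain_one_smul (F : X →₀ ZMod 2) : F.mapDomain ((1 : H) • ·) = F := by
  simp only [one_smul]
  exact Finsupp.mapDomain_id

noncomputable instance : Group (Lamp H X) :=
  letI : Mul (Lamp H X) :=
    ⟨fun a b => ⟨a.lamps + b.lamps.mapDomain (a.shift • ·), a.shift * b.shift⟩⟩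
  letI : One (Lamp H X) := ⟨⟨0, 1⟩⟩
  letI : Inv (Lamp H X) := ⟨fun a => ⟨-a.lamps.mapDomain (a.shift⁻¹ • ·), a.shift⁻¹⟩⟩
  Group.ofLeftAxioms
    (fun a b c => by
      refine Lamp.ext ?_ (mul_assoc _ _ _)
      change (a.lamps + b.lamps.mapDomain _) + c.lamps.mapDomain _
        = a.lamps + (b.lamps + c.lamps.mapDomain _).mapDomain _
      rw [Finsupp.mapDomain_add, ← Finsupp.mapDomain_comp, add_assoc]
      congr 3
      funext x
      exact mul_smul _ _ _)
    (fun a => by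
      refine Lamp.ext ?_ (one_mul _)
      change 0 + a.lamps.mapDomain ((1 : H) • ·) = a.lamps
      rw [zero_add, mapDomain_one_smul])
    (fun a => by
      refine Lamp.ext ?_ (inv_mul_cancel _)
      change -a.lamps.mapDomain _ + a.lamps.mapDomain _ = 0
      exact neg_add_cancel _)

theorem mul_lamps (a b : Lamp H X) :
    (a * b).lamps = a.lamps + b.lamps.mapDomain (a.shift • ·) := rfl

@[simp] theorem mul_shift (a b : Lamp H X) : (a * b).shift = a.shift * b.shift := rfl

@[simp] theorem one_lamps : (1 : Lamp H X).lamps = 0 := rfl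

@[simp] theorem one_shift : (1 : Lamp H X).shift = 1 := rfl

@[simp] theorem inv_shift (a : Lamp H X) : (a⁻¹).shift = a.shift⁻¹ := rfl

theorem inv_lamps (a : Lamp H X) : (a⁻¹).lamps = -a.lamps.mapDomain (a.shift⁻¹ • ·) := rfl

/-- The generator switching the lamp at `x`. -/
noncomputable def lamp (x : X) : Lamp H X := ⟨Finsupp.single x 1, 1⟩

/-- The inclusion of the acting group. -/
noncomputable def inr : H →* Lamp H X where
  toFun h := ⟨0, h⟩
  map_one' := rfl
  map_mul' a b := Lamp.ext (by simp [mul_lamps]) rfl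

@[simp] theorem inr_shift (h : H) : (inr h : Lamp H X).shift = h := rfl

@[simp] theorem inr_lamps (h : H) : (inr h : Lamp H X).lamps = 0 := rfl

theorem inr_mul_lamp (h : H) (x : X) : inr h * lamp x = lamp (h • x) * (inr h : Lamp H X) :=
  Lamp.ext (by simp [mul_lamps, lamp, Finsupp.mapDomain_single]) (by simp [lamp])

theorem lamp_mul_lamp (x y : X) :
    (lamp x * lamp y : Lamp H X) = ⟨Finsupp.single x 1 + Finsupp.single y 1, 1⟩ :=
  Lamp.ext (by simp [mul_lamps, lamp, Finsupp.mapDomain_single]) (by simp [lamp])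

theorem lamp_comm (x y : X) : (lamp x * lamp y : Lamp H X) = lamp y * lamp x := by
  rw [lamp_mul_lamp, lamp_mul_lamp, add_comm]

theorem lamp_mul_self (x : X) : (lamp x * lamp x : Lamp H X) = 1 := by
  rw [lamp_mul_lamp, ← Finsupp.single_add, show (1 + 1 : ZMod 2) = 0 from rfl,
    Finsupp.single_zero]
  rfl

theorem lamp_injective {G Y : Type} [Group G] : Function.Injective (lamp : Y → Lamp G Y) :=
  fun _ _ h =>
    Finsupp.single_left_injective (one_ne_zero : (1 : ZMod 2) ≠ 0) (congrArg Lamp.lamps h)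

/-- An equivariant map of actions induces a homomorphism of wreath products. -/
noncomputable def map (f : H' →* H) (g : X' → X) (hg : ∀ h x, g (h • x) = f h • g x) :
    Lamp H' X' →* Lamp H X where
  toFun a := ⟨a.lamps.mapDomain g, f a.shift⟩
  map_one' := Lamp.ext (by simp) (by simp)
  map_mul' a b := by
    refine Lamp.ext ?_ (by simp)
    simp only [mul_lamps, Finsupp.mapDomain_add, ← Finsupp.mapDomain_comp]
    congr 2
    funext x
    exact hg _ _

section map

variable (f : H' →* H) (g : X' → X) (hg : ∀ h x, g (h • x) = f h • g x)

theorem map_lamp (x : X') : map f g hg (lamp x) = lamp (g x) :=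
  Lamp.ext (by simp [map, lamp, Finsupp.mapDomain_single]) (by simp [map, lamp])

theorem map_inr (h : H') : map f g hg (inr h) = inr (f h) :=
  Lamp.ext (by simp [map]) (by simp [map])

theorem map_injective (hf : Function.Injective f) (hg' : Function.Injective g) :
    Function.Injective (map f g hg) := fun _ _ h =>
  Lamp.ext (Finsupp.mapDomain_injective hg' (congrArg Lamp.lamps h))
    (hf (congrArg Lamp.shift h))

end map

/-- The elements of the base group supported on `S`. -/
def supported (H : Type) {X : Type} [Group H] [MulAction H X] (S : Set X) :
    Subgroup (Lamp H X) where
  carrier := {a | a.shift = 1 ∧ ∀ x ∉ S, a.lamps x = 0}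
  one_mem' := by simp
  mul_mem' := by
    rintro a b ⟨ha, ha'⟩ ⟨hb, hb'⟩
    refine ⟨by simp [ha, hb], fun x hx => ?_⟩
    rw [mul_lamps, ha, mapDomain_one_smul, Finsupp.add_apply, ha' x hx, hb' x hx, add_zero]
  inv_mem' := by
    rintro a ⟨ha, ha'⟩
    refine ⟨by simp [ha], fun x hx => ?_⟩
    rw [inv_lamps, ha, inv_one, mapDomain_one_smul, Finsupp.neg_apply, ha' x hx, neg_zero]

theorem lamp_mem_supported {S : Set X} {x : X} : lamp x ∈ supported H S ↔ x ∈ S := by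
  refine ⟨fun h => ?_, fun h => ⟨rfl, fun y hy => ?_⟩⟩
  · by_contra hx
    simpa [lamp] using h.2 x hx
  · exact Finsupp.single_eq_of_ne (fun e => hy (e ▸ h))

theorem map_mem_supported {f : H' →* H} {g : X' → X} {hg : ∀ h x, g (h • x) = f h • g x}
    (hf : Function.Injective f) (hg' : Function.Injective g) {S : Set X} {a : Lamp H' X'} :
    map f g hg a ∈ supported H S ↔ a ∈ supported H' (g ⁻¹' S) := by
  constructor
  · rintro ⟨h, h'⟩
    refine ⟨hf (h.trans (map_one f).symm), fun x hx => ?_⟩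
    rw [← h' (g x) hx]
    exact (Finsupp.mapDomain_apply hg' _ _).symm
  · rintro ⟨h, h'⟩
    refine ⟨by simp [map, h], fun x hx => ?_⟩
    by_cases hx' : x ∈ Set.range g
    · obtain ⟨y, rfl⟩ := hx'
      exact (Finsupp.mapDomain_apply hg' _ _).trans (h' y hx)
    · exact Finsupp.mapDomain_of_notMem_range _ _ hx'

/-- A homomorphism `e : H' → H` with `D' = e⁻¹ D` induces a homomorphism of wreath products over
the coset spaces. -/
noncomputable def cosetMap (e : H' →* H) (D' : Subgroup H') (D : Subgroup H)
    (h : ∀ p, p ∈ D' ↔ e p ∈ D) : Lamp H' (H' ⧸ D') →* Lamp H (H ⧸ D) :=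
  map e (Quotient.map' e fun a b hab => by
      rw [QuotientGroup.leftRel_apply] at hab ⊢
      simpa using (h _).1 hab)
    fun a x => by
      induction x using QuotientGroup.induction_on with
      | H x => exact congrArg (QuotientGroup.mk (s := D)) (map_mul e a x)

theorem cosetMap_inr (e : H' →* H) (D' : Subgroup H') (D : Subgroup H)
    (h : ∀ p, p ∈ D' ↔ e p ∈ D) (p : H') : cosetMap e D' D h (inr p) = inr (e p) :=
  map_inr _ _ _ _

theorem cosetMap_lamp (e : H' →* H) (D' : Subgroup H') (D : Subgroup H)
    (h : ∀ p, p ∈ D' ↔ e p ∈ D) (p : H') :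
    cosetMap e D' D h (lamp (p : H' ⧸ D')) = lamp (e p : H ⧸ D) :=
  map_lamp _ _ _ _

theorem cosetMap_injective {e : H' →* H} {D' : Subgroup H'} {D : Subgroup H}
    {h : ∀ p, p ∈ D' ↔ e p ∈ D} (he : Function.Injective e) :
    Function.Injective (cosetMap e D' D h) := by
  refine map_injective _ _ _ he fun x y => ?_
  induction x using QuotientGroup.induction_on with
  | H x =>
    induction y using QuotientGroup.induction_on with
    | H y =>
      intro hxy
      rw [QuotientGroup.eq, h]
      simpa using QuotientGroup.eq.1 hxy

/-- The lamp at the trivial coset of `D` commutes with the elements of `D`. -/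
theorem inr_mul_lamp_one {D : Subgroup H} {g : H} (hg : g ∈ D) :
    inr g * lamp ((1 : H) : H ⧸ D) = lamp ((1 : H) : H ⧸ D) * inr g := by
  rw [inr_mul_lamp]
  congr 2
  exact (QuotientGroup.eq (s := D)).2 (by simpa using hg)

end Lamp

/-- A configuration of a machine with state set `Q` and one integer for each element of `κ`;
the state `none` is the halting state. -/
@[ext]
structure Conf (κ Q : Type) where
  /-- The current state. -/
  state : Option Q
  /-- The stored integers. -/
  store : κ → ℤ

instance {κ Q : Type} : MulAction (Multiplicative (κ → ℤ)) (Conf κ Q) where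
  smul h β := ⟨β.state, h.toAdd + β.store⟩
  one_smul _ := Conf.ext rfl (zero_add _)
  mul_smul _ _ _ := Conf.ext rfl (add_assoc _ _ _)

/-- Multiplication of the `k`-th coordinate by `m`. -/
def scale {κ : Type} [DecidableEq κ] (k : κ) (m : ℤ) : (κ → ℤ) →+ (κ → ℤ) where
  toFun u := Function.update u k (m * u k)
  map_zero' := by simp
  map_add' u v := by
    ext j
    rcases eq_or_ne j k with rfl | h
    · simp [mul_add]
    · simp [h]

theorem scale_apply {κ : Type} [DecidableEq κ] (k : κ) (m : ℤ) (u : κ → ℤ) :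
    scale k m u = Function.update u k (m * u k) := rfl

theorem scale_single_self {κ : Type} [DecidableEq κ] (k : κ) (m a : ℤ) :
    scale k m (Pi.single k a) = Pi.single k (m * a) := by
  simp [scale_apply, Pi.single]

theorem scale_single_of_ne {κ : Type} [DecidableEq κ] {j k : κ} (h : j ≠ k) (m a : ℤ) :
    scale k m (Pi.single j a) = Pi.single j a := by
  simp [scale_apply, Pi.single_eq_of_ne' h]

theorem scale_injective {κ : Type} [DecidableEq κ] (k : κ) {m : ℤ} (hm : m ≠ 0) :
    Function.Injective (scale k m) := by
  intro u v h
  ext j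
  have := congrFun h j
  rcases eq_or_ne j k with rfl | hj
  · simpa [scale_apply, hm] using this
  · simpa [scale_apply, hj] using this

/-- A machine whose instruction in the state `q` replaces the integer `5 * n + d` in the register
`stk q`, where `0 ≤ d < 5`, by `mul q d * n + add q d`, and goes to the state `next q d`. -/
structure AffineMachine (κ Q : Type) where
  /-- The register used in a state. -/
  stk : Q → κ
  /-- The new factor. -/
  mul : Q → Fin 5 → ℤ
  /-- The new constant term. -/
  add : Q → Fin 5 → ℤ
  /-- The next state. -/
  next : Q → Fin 5 → Option Q
  mul_ne_zero : ∀ q d, mul q d ≠ 0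

namespace AffineMachine

variable {κ Q : Type} [DecidableEq κ] (M : AffineMachine κ Q)

/-- The configurations to which the instruction for state `q` and digit `d` applies. -/
def source (q : Q) (d : Fin 5) (u : κ → ℤ) : Conf κ Q :=
  ⟨some q, scale (M.stk q) 5 u + Pi.single (M.stk q) (d : ℤ)⟩

/-- The results of the instruction for state `q` and digit `d`. -/
def target (q : Q) (d : Fin 5) (u : κ → ℤ) : Conf κ Q :=
  ⟨M.next q d, scale (M.stk q) (M.mul q d) u + Pi.single (M.stk q) (M.add q d)⟩

/-- The step relation. -/
def Step (β γ : Conf κ Q) : Prop :=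
  ∃ q d u, β = M.source q d u ∧ γ = M.target q d u

/-- Reaching the halting state with all registers zero. -/
def Halts (β : Conf κ Q) : Prop := Relation.ReflTransGen M.Step β ⟨none, 0⟩

variable {M}

theorem source_inj {q q' : Q} {d d' : Fin 5} {u u' : κ → ℤ}
    (h : M.source q d u = M.source q' d' u') : q = q' ∧ d = d' ∧ u = u' := by
  obtain rfl : q = q' := by simpa [source] using congrArg Conf.state h
  have h := congrArg Conf.store h
  have hk := congrFun h (M.stk q)
  simp only [source, scale_apply, Pi.add_apply, Function.update_self, Pi.single_eq_same] at hk
  obtain rfl : d = d' := by omega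
  exact ⟨rfl, rfl, scale_injective _ (by norm_num) (add_right_cancel h)⟩

theorem target_injective (q : Q) (d : Fin 5) : Function.Injective (M.target q d) := fun _ _ h =>
  scale_injective _ (M.mul_ne_zero q d) (add_right_cancel (congrArg Conf.store h))

theorem halts_source_iff {q : Q} {d : Fin 5} {u : κ → ℤ} :
    M.Halts (M.source q d u) ↔ M.Halts (M.target q d u) := by
  refine ⟨fun h => ?_, fun h => Relation.ReflTransGen.head ⟨q, d, u, rfl, rfl⟩ h⟩
  rcases Relation.ReflTransGen.cases_head h with h | ⟨γ, ⟨q', d', u', h, rfl⟩, hγ⟩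
  · simpa [source] using congrArg Conf.state h
  · obtain ⟨rfl, rfl, rfl⟩ := source_inj h
    exact hγ

end AffineMachine

/-- Relations simulating a machine in a group: conjugates of `t q` by products of the `x j`
represent configurations, and `k` commutes with those representing halting configurations. -/
structure AffineMachine.Simulation {κ Q Γ : Type} [Group Γ] (M : AffineMachine κ Q)
    (x : κ → Γ) (t : Option Q → Γ) (k : Γ) (r : Q → Fin 5 → Γ) : Prop where
  x_comm : ∀ i j, x i * x j = x j * x i
  r_t : ∀ q d, r q d * (x (M.stk q) ^ (d : ℤ) * t (some q) * (x (M.stk q) ^ (d : ℤ))⁻¹) =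
    x (M.stk q) ^ M.add q d * t (M.next q d) * (x (M.stk q) ^ M.add q d)⁻¹ * r q d
  r_x : ∀ q d, r q d * x (M.stk q) ^ (5 : ℤ) = x (M.stk q) ^ M.mul q d * r q d
  r_x_of_ne : ∀ q d j, j ≠ M.stk q → r q d * x j = x j * r q d
  k_r : ∀ q d, k * r q d = r q d * k
  k_t : k * t none = t none * k

namespace AffineMachine

variable {κ Q : Type} [DecidableEq κ] [Finite κ] {M : AffineMachine κ Q}

theorem Simulation.commute_of_halts {Γ : Type} [Group Γ] {x : κ → Γ} {t : Option Q → Γ}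
    {k : Γ} {r : Q → Fin 5 → Γ} (h : M.Simulation x t k r) {q : Option Q} {j : κ} {a : ℤ}
    (hM : M.Halts ⟨q, Pi.single j a⟩) : Commute k (x j ^ a * t q * (x j ^ a)⁻¹) := by
  have := Fintype.ofFinite κ
  let X₀ : (κ → Multiplicative ℤ) →* Γ := MonoidHom.noncommPiCoprod
    (fun i => zpowersHom Γ (x i)) fun i j _ a b => by
      simpa using Commute.zpow_zpow (h.x_comm i j) _ _
  let X : (κ → ℤ) →+ Additive Γ :=
    ⟨⟨fun u => Additive.ofMul (X₀ fun i => Multiplicative.ofAdd (u i)), map_one X₀⟩,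
      fun u v => map_mul X₀ _ _⟩
  have hX : ∀ i a, (X (Pi.single i a)).toMul = x i ^ a := by
    intro i a
    have : (fun j => Multiplicative.ofAdd ((Pi.single i a : κ → ℤ) j)) =
        Pi.mulSingle i (Multiplicative.ofAdd a) := by
      ext j
      rcases eq_or_ne j i with rfl | hj
      · simp
      · simp [hj]
    change X₀ _ = _
    rw [this]
    exact (MonoidHom.noncommPiCoprod_mulSingle _ _ _).trans (by simp)
  have hr : ∀ q d u, r q d * (X (scale (M.stk q) 5 u)).toMul =
      (X (scale (M.stk q) (M.mul q d) u)).toMul * r q d := by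
    intro q d u
    let C : Additive Γ →+ Additive Γ := (MulAut.conj (r q d)).toMonoidHom.toAdditive
    have : C.comp (X.comp (scale (M.stk q) 5)) = X.comp (scale (M.stk q) (M.mul q d)) := by
      refine AddMonoidHom.ext fun u => ?_
      rw [← Finset.univ_sum_single u]
      refine AddSubmonoid.sum_mem (AddMonoidHom.eqLocusM _ _) fun j _ => ?_
      generalize u j = a
      change r q d * (X (scale (M.stk q) 5 (Pi.single j a))).toMul * (r q d)⁻¹ =
        (X (scale (M.stk q) (M.mul q d) (Pi.single j a))).toMul
      rw [mul_inv_eq_iff_eq_mul]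
      rcases eq_or_ne j (M.stk q) with rfl | hj
      · rw [scale_single_self, scale_single_self, hX, hX, zpow_mul, zpow_mul]
        have : SemiconjBy (r q d) (x (M.stk q) ^ (5 : ℤ)) (x (M.stk q) ^ M.mul q d) := h.r_x q d
        exact this.zpow_right a
      · rw [scale_single_of_ne hj, scale_single_of_ne hj, hX]
        have : Commute (r q d) (x j) := h.r_x_of_ne q d j hj
        exact this.zpow_right a
    exact mul_inv_eq_iff_eq_mul.1 (DFunLike.congr_fun this u)
  let T : Conf κ Q → Γ := fun β => (X β.store).toMul * t β.state * (X β.store).toMul⁻¹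
  have hT : ∀ q d u, SemiconjBy (r q d) (T (M.source q d u)) (T (M.target q d u)) := by
    intro q d u
    have key : ∀ s k v a, T ⟨s, v + Pi.single k a⟩ =
        (X v).toMul * (x k ^ a * t s * (x k ^ a)⁻¹) * (X v).toMul⁻¹ := by
      intro s k v a
      simp only [T, map_add, toMul_add, hX, mul_inv_rev, mul_assoc]
    rw [source, target, key, key]
    have h₁ : SemiconjBy (r q d) _ _ := hr q d u
    have h₂ : SemiconjBy (r q d) _ _ := h.r_t q d
    exact (h₁.mul_right h₂).mul_right h₁.inv_right
  have hcomm : ∀ β, M.Halts β → Commute k (T β) := by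
    intro β hβ
    induction hβ using Relation.ReflTransGen.head_induction_on with
    | refl =>
      have : T ⟨none, 0⟩ = t none := by simp [T]
      rw [this]
      exact h.k_t
    | head hs _ ih =>
      obtain ⟨q, d, u, rfl, rfl⟩ := hs
      have hk : Commute k (r q d) := h.k_r q d
      have : T (M.source q d u) = (r q d)⁻¹ * T (M.target q d u) * r q d := by
        rw [mul_assoc, ← (hT q d u).eq, inv_mul_cancel_left]
      rw [this]
      exact (hk.inv_right.mul_right ih).mul_right hk
  simpa [T, hX] using hcomm _ hM

end AffineMachine

theorem Lamp.commutator_lamp_one {H : Type} [Group H] (D : Subgroup H) {g : H} (hg : g ∉ D)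
    {k w : Lamp H (H ⧸ D)} (hk : k = lamp ((1 : H) : H ⧸ D))
    (hw : w = k * inr g * k⁻¹ * (inr g)⁻¹) : w ≠ 1 ∧ w * w = 1 := by
  have hkk : k⁻¹ = k := inv_eq_of_mul_eq_one_left (by rw [hk, lamp_mul_self])
  have h₂ : w = k * lamp (g : H ⧸ D) := by
    rw [hw, hkk, hk, mul_assoc, mul_assoc, ← mul_assoc (inr g), inr_mul_lamp,
      mul_inv_cancel_right]
    congr 2
    exact congrArg _ (mul_one g)
  refine ⟨fun h => hg ?_, ?_⟩
  · rw [h₂, mul_eq_one_iff_inv_eq, hkk, hk] at h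
    simpa using QuotientGroup.eq.1 (lamp_injective h)
  · rw [h₂, hk, mul_assoc, ← mul_assoc (lamp (g : H ⧸ D)), lamp_comm (g : H ⧸ D), mul_assoc,
      lamp_mul_self, mul_one, lamp_mul_self]

namespace AffineMachine

variable {κ Q : Type} [DecidableEq κ]

/-- The simulation is faithful in a suitable group. -/
theorem exists_simulation [Finite Q] (M : AffineMachine κ Q) :
    ∃ (L : Type) (_ : Group L) (x : κ → L) (t : Option Q → L) (k : L) (r : Q → Fin 5 → L),
      M.Simulation x t k r ∧ ∀ q j a, ¬ M.Halts ⟨q, Pi.single j a⟩ →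
        ∀ u w, u = x j ^ a * t q * (x j ^ a)⁻¹ → w = k * u * k⁻¹ * u⁻¹ → w ≠ 1 ∧ w * w = 1 := by
  let H := Multiplicative (κ → ℤ)
  let D : Subgroup (Lamp H (Conf κ Q)) := Lamp.supported H {β | M.Halts β}
  let σ : κ → ℤ → H →* H := fun k m => (scale k m).toMultiplicative
  have hσ : ∀ k {m}, m ≠ 0 → Function.Injective (σ k m) := fun k m hm => scale_injective k hm
  let e : Q × Fin 5 → Lamp H H →* Lamp H (Conf κ Q) := fun i =>
    Lamp.map (σ (M.stk i.1) 5) (fun u => M.source i.1 i.2 u.toAdd) fun h u =>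
      Conf.ext rfl (by simp [source, add_assoc, H, σ]; rfl)
  let e' : Q × Fin 5 → Lamp H H →* Lamp H (Conf κ Q) := fun i =>
    Lamp.map (σ (M.stk i.1) (M.mul i.1 i.2)) (fun u => M.target i.1 i.2 u.toAdd) fun h u =>
      Conf.ext rfl (by simp [target, add_assoc, H, σ]; rfl)
  have hs : ∀ q d, Function.Injective fun u : H => M.source q d u.toAdd :=
    fun q d u v h => (source_inj h).2.2
  have ht : ∀ q d, Function.Injective fun u : H => M.target q d u.toAdd :=
    fun q d => target_injective q d
  have he : ∀ i, Function.Injective (e i) := fun i =>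
    Lamp.map_injective _ _ _ (hσ _ (by norm_num)) (hs _ _)
  have he' : ∀ i, Function.Injective (e' i) := fun i =>
    Lamp.map_injective _ _ _ (hσ _ (M.mul_ne_zero _ _)) (ht _ _)
  let D' : Q × Fin 5 → Subgroup (Lamp H H) := fun i => D.comap (e i)
  have hD : ∀ i p, p ∈ D' i ↔ e i p ∈ D := fun i p => Iff.rfl
  have hD' : ∀ i p, p ∈ D' i ↔ e' i p ∈ D := fun i p => by
    rw [hD]
    refine (Lamp.map_mem_supported (hσ _ (by norm_num)) (hs _ _)).trans ?_
    refine Iff.trans ?_ (Lamp.map_mem_supported (hσ _ (M.mul_ne_zero _ _)) (ht _ _)).symm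
    have : (fun u : H => M.source i.1 i.2 u.toAdd) ⁻¹' {β | M.Halts β} =
        (fun u : H => M.target i.1 i.2 u.toAdd) ⁻¹' {β | M.Halts β} := by
      ext u
      exact halts_source_iff
    rw [this]
  obtain ⟨L, _, ι, r, hι, hr⟩ := exists_conj_extension
    (fun i => Lamp.cosetMap (e i) (D' i) D (hD i)) (fun i => Lamp.cosetMap (e' i) (D' i) D (hD' i))
    (fun i => Lamp.cosetMap_injective (he i)) (fun i => Lamp.cosetMap_injective (he' i))
  let x₀ : κ → Lamp H (Conf κ Q) := fun j => Lamp.inr (Multiplicative.ofAdd (Pi.single j 1))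
  have hx₀ : ∀ j (a : ℤ), Lamp.inr (Multiplicative.ofAdd (Pi.single j a)) = x₀ j ^ a := by
    intro j a
    rw [← map_zpow, ← ofAdd_zsmul, ← Pi.single_smul, smul_eq_mul, mul_one]
  have ht₀ : ∀ s j a, x₀ j ^ a * Lamp.lamp ⟨s, 0⟩ * (x₀ j ^ a)⁻¹ =
      Lamp.lamp (⟨s, Pi.single j a⟩ : Conf κ Q) := by
    intro s j a
    rw [← hx₀, Lamp.inr_mul_lamp, mul_inv_cancel_right]
    exact congrArg Lamp.lamp (Conf.ext rfl (add_zero _))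
  let φ : Lamp H (Conf κ Q) →* L := ι.comp Lamp.inr
  have hφ : ∀ i p, r i * φ (e i p) = φ (e' i p) * r i := by
    intro i p
    have := hr i (Lamp.inr p)
    simp only [Lamp.cosetMap_inr] at this
    exact this
  refine ⟨L, inferInstance, fun j => φ (x₀ j), fun q => φ (Lamp.lamp ⟨q, 0⟩),
    ι (Lamp.lamp ((1 : Lamp H (Conf κ Q)) : _ ⧸ D)), fun q d => r (q, d), ?_, ?_⟩
  · constructor
    · intro i j
      simp only [x₀, ← map_mul, mul_comm]
    · intro q d
      have := hφ (q, d) (Lamp.lamp 1)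
      simp only [e, e', Lamp.map_lamp] at this
      simp only [← map_zpow, ← map_mul, ← map_inv, ht₀]
      convert this using 4
      · exact Conf.ext rfl (by simp [source])
      · exact Conf.ext rfl (by simp [target])
    · intro q d
      have := hφ (q, d) (Lamp.inr (Multiplicative.ofAdd (Pi.single (M.stk q) 1)))
      simp only [e, e', Lamp.map_inr] at this
      simp only [← map_zpow, ← hx₀]
      rw [show (Multiplicative.ofAdd (Pi.single (M.stk q) 5) : H) = σ (M.stk q) 5
        (Multiplicative.ofAdd (Pi.single (M.stk q) 1)) from
          congrArg Multiplicative.ofAdd (scale_single_self (M.stk q) 5 1).symm,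
        show (Multiplicative.ofAdd (Pi.single (M.stk q) (M.mul q d)) : H) =
          σ (M.stk q) (M.mul q d) (Multiplicative.ofAdd (Pi.single (M.stk q) 1)) from
            congrArg Multiplicative.ofAdd
              ((congrArg _ (mul_one _)).symm.trans (scale_single_self (M.stk q) _ 1).symm)]
      exact this
    · intro q d j hj
      have := hφ (q, d) (Lamp.inr (Multiplicative.ofAdd (Pi.single j 1)))
      simp only [e, e', Lamp.map_inr] at this
      have h : ∀ m, σ (M.stk q) m (Multiplicative.ofAdd (Pi.single j 1)) =
          Multiplicative.ofAdd (Pi.single j 1) := fun m =>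
        congrArg Multiplicative.ofAdd (scale_single_of_ne hj m 1)
      rw [h, h] at this
      exact this
    · intro q d
      have := hr (q, d) (Lamp.lamp ((1 : Lamp H H) : _ ⧸ D' (q, d)))
      rw [Lamp.cosetMap_lamp, Lamp.cosetMap_lamp, map_one, map_one] at this
      exact this.symm
    · change ι _ * ι _ = ι _ * ι _
      rw [← map_mul, ← map_mul]
      exact congrArg ι (Lamp.inr_mul_lamp_one
        (Lamp.lamp_mem_supported (S := {β | M.Halts β}).2 Relation.ReflTransGen.refl)).symm
  · rintro q j a hM u w hu rfl
    simp only [← map_zpow, ← map_mul, ← map_inv, ht₀] at hu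
    have hgD : Lamp.lamp ⟨q, Pi.single j a⟩ ∉ D := fun h =>
      hM (Lamp.lamp_mem_supported (S := {β | M.Halts β}).1 h)
    obtain ⟨h₁, h₂⟩ := Lamp.commutator_lamp_one D hgD rfl rfl
    rw [hu, MonoidHom.comp_apply, ← map_inv, ← map_inv, ← map_mul, ← map_mul, ← map_mul,
      ← map_mul]
    exact ⟨(map_ne_one_iff ι hι).2 h₁, by rw [h₂, map_one]⟩

end AffineMachine

/-- Any group containing an involution `w` embeds in a group with elements `b` and `c` as below;
in contrast, these relations force `b = c = 1` if `w = 1`. -/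
theorem exists_swap_of_involution {L : Type} [Group L] {w : L} (hw : w * w = 1) (hne : w ≠ 1) :
    ∃ (Γ : Type) (_ : Group Γ) (f : L →* Γ) (b c : Γ), Function.Injective f ∧ c * c = 1 ∧
      (f w * c) ^ 3 = 1 ∧ b = c * f w * (b * f w * b⁻¹) * c ∧
      ∀ s s', f s * (b * f s' * b⁻¹) = b * f s' * b⁻¹ * f s := by
  classical
  obtain ⟨τ, hτ⟩ : ∃ τ : L → Bool, ∀ p, τ (w * p) = !τ p := by
    let _ : LinearOrder L := linearOrderOfSTO WellOrderingRel
    refine ⟨fun p => decide (p < w * p), fun p => ?_⟩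
    have h : w * p ≠ p := fun h => hne (by simpa using h)
    simp only [← mul_assoc, hw, one_mul]
    rcases lt_or_gt_of_ne h with h | h <;> simp [h, h.le]
  have hww : ∀ p, w * (w * p) = p := fun p => by rw [← mul_assoc, hw, one_mul]
  let c₀ : L ⊕ L → L ⊕ L := Sum.elim
    (fun p => if τ p then .inr (w * p) else .inl p) (fun p => if τ p then .inr p else .inl (w * p))
  have hc₀ : Function.Involutive c₀ := by
    rintro (p | p) <;> cases h : τ p <;> simp [c₀, h, hτ, hww]
  let f : L →* Equiv.Perm (L ⊕ L) :=
    (Equiv.Perm.sumCongrHom L L).comp ((MonoidHom.inl _ _).comp (MulAction.toPermHom L L))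
  let b : Equiv.Perm (L ⊕ L) := Equiv.sumComm L L
  have hfl : ∀ s p, f s (.inl p) = .inl (s * p) := fun _ _ => rfl
  have hfr : ∀ s p, f s (.inr p) = .inr p := fun _ _ => rfl
  have hbl : ∀ p, b (.inl p) = .inr p := fun _ => rfl
  have hbr : ∀ p, b (.inr p) = .inl p := fun _ => rfl
  have hbi : b⁻¹ = b := rfl
  obtain ⟨c, hcc, hcl, hcr⟩ : ∃ c : Equiv.Perm (L ⊕ L), c * c = 1 ∧
      (∀ p, c (.inl p) = if τ p then .inr (w * p) else .inl p) ∧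
      ∀ p, c (.inr p) = if τ p then .inr p else .inl (w * p) :=
    ⟨hc₀.toPerm c₀, Equiv.ext hc₀, fun _ => rfl, fun _ => rfl⟩
  refine ⟨Equiv.Perm (L ⊕ L), inferInstance, f, b, c, ?_, hcc, ?_, ?_, ?_⟩
  · intro s s' h
    simpa [hfl] using DFunLike.congr_fun h (.inl 1)
  · ext1 (p | p) <;> cases h : τ p <;>
      simp [pow_succ, hfl, hfr, hcl, hcr, h, hτ, hww]
  · ext1 (p | p) <;> cases h : τ p <;>
      simp [hbi, hbl, hbr, hfl, hfr, hcl, hcr, h, hτ, hww]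
  · intro s s'
    ext1 (p | p) <;> simp [hbi, hbl, hbr, hfl, hfr]

/-- A finite presentation with a variable relator which presents an abelian or a non-abelian
group, depending on whether a machine halts. -/
theorem AffineMachine.exists_relators {κ Q : Type} [DecidableEq κ] [Finite κ] [Finite Q]
    (M : AffineMachine κ Q) (q : Option Q) (j : κ) :
    ∃ (G : Type) (_ : Finite G) (R : Set (FreeGroup G)) (x t u : G), R.Finite ∧ ∀ a : ℤ,
      (M.Halts ⟨q, Pi.single j a⟩ → ∀ (Γ : Type) [Group Γ] (v : G → Γ),
        (∀ r ∈ R, FreeGroup.lift v r = 1) → v u = v x ^ a * v t * (v x ^ a)⁻¹ →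
          ∀ g h, Commute (v g) (v h)) ∧
      (¬ M.Halts ⟨q, Pi.single j a⟩ → ∃ (Γ : Type) (_ : Group Γ) (v : G → Γ),
        (∀ r ∈ R, FreeGroup.lift v r = 1) ∧ v u = v x ^ a * v t * (v x ^ a)⁻¹ ∧
          ∃ g h, ¬ Commute (v g) (v h)) := by
  let S := (κ ⊕ Option Q) ⊕ ((Q × Fin 5) ⊕ Bool)
  let G := S ⊕ Bool
  let s : S → FreeGroup G := fun i => .of (.inl i)
  let x : κ → FreeGroup G := fun i => s (.inl (.inl i))
  let t : Option Q → FreeGroup G := fun i => s (.inl (.inr i))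
  let r : Q → Fin 5 → FreeGroup G := fun q d => s (.inr (.inl (q, d)))
  let k : FreeGroup G := s (.inr (.inr false))
  let u : FreeGroup G := s (.inr (.inr true))
  let b : FreeGroup G := .of (.inr false)
  let c : FreeGroup G := .of (.inr true)
  let w : FreeGroup G := k * u * k⁻¹ * u⁻¹
  let R₁ : Set (FreeGroup G) := Set.range fun p : κ × κ => x p.1 * x p.2 * (x p.2 * x p.1)⁻¹
  let R₂ : Set (FreeGroup G) := Set.range fun p : Q × Fin 5 =>
    r p.1 p.2 * (x (M.stk p.1) ^ (p.2 : ℤ) * t (some p.1) * (x (M.stk p.1) ^ (p.2 : ℤ))⁻¹) *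
    (x (M.stk p.1) ^ M.add p.1 p.2 * t (M.next p.1 p.2) *
      (x (M.stk p.1) ^ M.add p.1 p.2)⁻¹ * r p.1 p.2)⁻¹
  let R₃ : Set (FreeGroup G) := Set.range fun p : Q × Fin 5 =>
    r p.1 p.2 * x (M.stk p.1) ^ (5 : ℤ) * (x (M.stk p.1) ^ M.mul p.1 p.2 * r p.1 p.2)⁻¹
  let R₄ : Set (FreeGroup G) := Set.range fun p : {p : (Q × Fin 5) × κ // p.2 ≠ M.stk p.1.1} =>
    r p.1.1.1 p.1.1.2 * x p.1.2 * (x p.1.2 * r p.1.1.1 p.1.1.2)⁻¹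
  let R₅ : Set (FreeGroup G) := Set.range fun p : Q × Fin 5 =>
    k * r p.1 p.2 * (r p.1 p.2 * k)⁻¹
  let R₆ : Set (FreeGroup G) := {k * t none * (t none * k)⁻¹, c * c, (w * c) ^ 3,
    b * (c * w * (b * w * b⁻¹) * c)⁻¹}
  let R₇ : Set (FreeGroup G) := Set.range fun p : S × S =>
    s p.1 * (b * s p.2 * b⁻¹) * (b * s p.2 * b⁻¹ * s p.1)⁻¹
  let R := R₁ ∪ R₂ ∪ R₃ ∪ R₄ ∪ R₅ ∪ R₆ ∪ R₇
  have hfin : R.Finite := by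
    refine (((((Set.Finite.union ?_ ?_).union ?_).union ?_).union ?_).union ?_).union ?_
    all_goals first | exact Set.finite_range _ | exact Set.toFinite _
  have hR : ∀ (Γ : Type) [Group Γ] (v : G → Γ), (∀ r ∈ R, FreeGroup.lift v r = 1) ↔
      M.Simulation (fun i => v (.inl (.inl (.inl i)))) (fun i => v (.inl (.inl (.inr i))))
        (v (.inl (.inr (.inr false)))) (fun q d => v (.inl (.inr (.inl (q, d))))) ∧
      ∀ w, w = v (.inl (.inr (.inr false))) * v (.inl (.inr (.inr true))) *
        (v (.inl (.inr (.inr false))))⁻¹ * (v (.inl (.inr (.inr true))))⁻¹ →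
      v (.inr true) * v (.inr true) = 1 ∧ (w * v (.inr true)) ^ 3 = 1 ∧
      v (.inr false) = v (.inr true) * w * (v (.inr false) * w * (v (.inr false))⁻¹) *
        v (.inr true) ∧
      ∀ i j : S, v (.inl i) * (v (.inr false) * v (.inl j) * (v (.inr false))⁻¹) =
        v (.inr false) * v (.inl j) * (v (.inr false))⁻¹ * v (.inl i) := by
    intro Γ _ v
    simp only [R, R₁, R₂, R₃, R₄, R₅, R₆, R₇, Set.mem_union, or_imp, forall_and,
      Set.forall_mem_range, Prod.forall, Subtype.forall, Set.mem_insert_iff,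
      Set.mem_singleton_iff, forall_eq, w, x, t, r, k, u, b, c, s, map_mul, map_inv, map_pow,
      map_zpow, FreeGroup.lift_apply_of, mul_inv_eq_one]
    constructor
    · rintro ⟨⟨⟨⟨⟨⟨h₁, h₂⟩, h₃⟩, h₄⟩, h₅⟩, h₆, h₇, h₈, h₉⟩, h⟩
      exact ⟨⟨h₁, h₂, h₃, h₄, h₅, h₆⟩, h₇, h₈, h₉, h⟩
    · rintro ⟨⟨h₁, h₂, h₃, h₄, h₅, h₆⟩, h₇, h₈, h₉, h⟩
      exact ⟨⟨⟨⟨⟨⟨h₁, h₂⟩, h₃⟩, h₄⟩, h₅⟩, h₆, h₇, h₈, h₉⟩, h⟩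
  refine ⟨G, inferInstance, R, .inl (.inl (.inl j)), .inl (.inl (.inr q)),
    .inl (.inr (.inr true)), hfin, fun a => ⟨fun hM Γ _ v hv hu => ?_, fun hM => ?_⟩⟩
  · obtain ⟨hs, hw⟩ := (hR Γ v).1 hv
    have := hs.commute_of_halts hM
    rw [← hu] at this
    obtain ⟨h₁, h₂, h₃, h₄⟩ := hw 1 (by rw [this.eq, mul_inv_cancel_right, mul_inv_cancel])
    have hc : v (.inr true) = 1 := by
      rwa [one_mul, pow_succ, pow_two, h₁, one_mul] at h₂
    have hb : v (.inr false) = 1 := by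
      rw [h₃, hc]
      group
    have h₅ : ∀ i j : S, Commute (v (.inl i)) (v (.inl j)) := fun i j => by
      simpa [hb, commute_iff_eq] using h₄ i j
    rintro (g | _ | _) (h | _ | _) <;> simp [hb, hc, h₅]
  · obtain ⟨L, _, x, t, k, r, hs, hw⟩ := M.exists_simulation
    obtain ⟨hne, hww⟩ := hw q j a hM _ _ rfl rfl
    obtain ⟨Γ, _, f, b, c, hf, h₁, h₂, h₃, h₄⟩ := exists_swap_of_involution hww hne
    let y : S → L := Sum.elim (Sum.elim x t)
      (Sum.elim (fun p => r p.1 p.2) fun i => bif i then x j ^ a * t q * (x j ^ a)⁻¹ else k)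
    refine ⟨Γ, inferInstance, Sum.elim (f ∘ y) (fun i => bif i then c else b),
      (hR _ _).2 ⟨⟨?_, ?_, ?_, ?_, ?_, ?_⟩, ?_⟩, ?_, .inl (.inr (.inr false)),
      .inl (.inr (.inr true)), fun h => ?_⟩
    · intro i j
      simpa [y] using congrArg f (hs.x_comm i j)
    · intro q d
      simpa [y] using congrArg f (hs.r_t q d)
    · intro q d
      simpa [y] using congrArg f (hs.r_x q d)
    · intro q d j hj
      simpa [y] using congrArg f (hs.r_x_of_ne q d j hj)
    · intro q d
      simpa [y] using congrArg f (hs.k_r q d)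
    · simpa [y] using congrArg f hs.k_t
    · rintro w hw
      obtain rfl : w = f (k * (x j ^ a * t q * (x j ^ a)⁻¹) * k⁻¹ *
          (x j ^ a * t q * (x j ^ a)⁻¹)⁻¹) := by
        rw [hw, map_mul, map_mul, map_mul, map_inv, map_inv]
        rfl
      exact ⟨h₁, h₂, h₃, fun i j => h₄ (y i) (y j)⟩
    · simp [y]
    · refine hne (hf ?_)
      have : f k * f (x j ^ a * t q * (x j ^ a)⁻¹) = f (x j ^ a * t q * (x j ^ a)⁻¹) * f k := h
      rw [map_mul, map_mul, map_mul, this, map_inv, map_inv, mul_inv_cancel_right,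
        mul_inv_cancel, map_one]

namespace AffineMachine

/-- The restriction of a machine to a set of states. -/
noncomputable def restrict {κ Q : Type} (M : AffineMachine κ Q) (F : Set Q) :
    AffineMachine κ F where
  stk q := M.stk q
  mul q := M.mul q
  add q := M.add q
  next q d := open Classical in (M.next q d).bind fun p => if h : p ∈ F then some ⟨p, h⟩ else none
  mul_ne_zero q := M.mul_ne_zero q

theorem halts_restrict_iff {κ Q : Type} [DecidableEq κ] {M : AffineMachine κ Q} {F : Set Q}
    (hF : ∀ q ∈ F, ∀ d, ∀ p ∈ M.next q d, p ∈ F) {s : Option F} {u : κ → ℤ} :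
    (M.restrict F).Halts ⟨s, u⟩ ↔ M.Halts ⟨s.map (↑), u⟩ := by
  let f : Conf κ F → Conf κ Q := fun β => ⟨β.state.map (↑), β.store⟩
  have hf : Function.Injective f := fun β γ h => Conf.ext
    (Option.map_injective Subtype.val_injective (congrArg Conf.state h)) (congrArg Conf.store h :)
  have hnext : ∀ q d, ((M.restrict F).next q d).map (↑) = M.next q d := by
    intro q d
    cases h : M.next q d with
    | none => simp [restrict, h]
    | some p => simp [restrict, h, hF q q.2 d p h]
  have ht : ∀ q d u, f ((M.restrict F).target q d u) = M.target q d u := fun q d u =>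
    Conf.ext (hnext q d) rfl
  constructor
  · intro h
    refine Relation.ReflTransGen.lift (r := (M.restrict F).Step) (p := M.Step) f ?_ _ _ h
    rintro β γ ⟨q, d, u, rfl, rfl⟩
    exact ⟨q, d, u, rfl, ht q d u⟩
  · suffices ∀ γ, M.Halts γ → ∀ β, γ = f β → (M.restrict F).Halts β from
      fun h => this _ h ⟨s, u⟩ rfl
    intro γ hγ
    induction hγ using Relation.ReflTransGen.head_induction_on with
    | refl =>
      intro β hβ
      obtain rfl : ⟨none, 0⟩ = β := hf hβ
      exact Relation.ReflTransGen.refl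
    | head h _ ih =>
      rintro ⟨_ | p, v⟩ hβ
      · obtain ⟨q, d, u, rfl, rfl⟩ := h
        cases congrArg Conf.state hβ
      · obtain ⟨q, d, u, rfl, rfl⟩ := h
        obtain rfl : q = p := Option.some.inj (congrArg Conf.state hβ)
        refine Relation.ReflTransGen.head ⟨p, d, u, ?_, rfl⟩ (ih _ (ht p d u).symm)
        exact hf hβ.symm

end AffineMachine

namespace Turing.TM2

open PartrecToTM2 (Γ')

variable {K Λ σ : Type} (M : Λ → Stmt (fun _ : K => Γ') Λ σ)

/-- The nonzero base 5 digits encoding the letters. -/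
def digit : Γ' → Fin 5
  | .consₗ => 1
  | .cons => 2
  | .bit0 => 3
  | .bit1 => 4

/-- The first letter of a stack from the last digit of its code. -/
def letter : Fin 5 → Option Γ' := ![none, some .consₗ, some .cons, some .bit0, some .bit1]

/-- The code of a stack. -/
def stackCode : List Γ' → ℕ
  | [] => 0
  | a :: l => digit a + 5 * stackCode l

theorem stackCode_eq_zero {l : List Γ'} (h : stackCode l = 0) : l = [] := by
  rcases l with _ | ⟨_ | _, l⟩ <;> simp_all [stackCode, digit]

theorem exists_stackCode_eq (l : List Γ') :
    ∃ d : Fin 5, letter d = l.head? ∧ (stackCode l : ℤ) = 5 * stackCode l.tail + (d : ℤ) := by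
  rcases l with _ | ⟨a, l⟩
  · exact ⟨0, rfl, rfl⟩
  · refine ⟨digit a, by cases a <;> rfl, ?_⟩
    simp [stackCode, add_comm]

/-- The state for executing a statement. -/
def stmtState : Stmt (fun _ : K => Γ') Λ σ → σ → Option (Stmt (fun _ : K => Γ') Λ σ × σ)
  | .halt, _ => none
  | s, v => some (s, v)

theorem stmtState_of_ne {s : Stmt (fun _ : K => Γ') Λ σ} (h : s ≠ .halt) (v : σ) :
    stmtState s v = some (s, v) := by
  cases s <;> first | rfl | exact absurd rfl h

/-- The affine machine executing the elementary statements of a stack machine. -/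
def affineMachine [Inhabited K] : AffineMachine K (Stmt (fun _ : K => Γ') Λ σ × σ) where
  stk
    | (.push k _ _, _) => k
    | (.peek k _ _, _) => k
    | (.pop k _ _, _) => k
    | _ => default
  mul
    | (.push _ _ _, _), _ => 25
    | (.pop _ _ _, _), _ => 1
    | _, _ => 5
  add
    | (.push _ f _, v), d => 5 * (d : ℤ) + (digit (f v) : ℤ)
    | (.pop _ _ _, _), _ => 0
    | _, d => (d : ℤ)
  next
    | (.push _ _ s, v), _ => stmtState s v
    | (.peek _ f s, v), d => stmtState s (f v (letter d))
    | (.pop _ f s, v), d => stmtState s (f v (letter d))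
    | (.load f s, v), _ => stmtState s (f v)
    | (.branch f s₁ s₂, v), _ => stmtState (cond (f v) s₁ s₂) v
    | (.goto f, v), _ => stmtState (M (f v)) v
    | (.halt, _), _ => none
  mul_ne_zero := by
    rintro ⟨_ | _, _⟩ _ <;> norm_num

theorem mem_stmts_of_mem_next [Inhabited K] [Inhabited Λ] {F : Finset Λ} (hF : Supports M F)
    {p q : Stmt (fun _ : K => Γ') Λ σ × σ} {d : Fin 5} (hq : some q.1 ∈ stmts M F)
    (h : p ∈ (affineMachine M).next q d) : some p.1 ∈ stmts M F := by
  have hst : ∀ {s : Stmt (fun _ : K => Γ') Λ σ} {v p}, p ∈ stmtState s v → p.1 = s := by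
    rintro (_ | _) v p h <;> cases h <;> rfl
  have hs : ∀ {s}, s ∈ stmts₁ q.1 → some s ∈ stmts M F := fun h => stmts_trans h hq
  rcases q with ⟨_ | _ | _ | _ | ⟨f, s₁, s₂⟩ | f | _, v⟩
  case goto =>
    rw [hst h]
    classical
    refine Finset.some_mem_insertNone.2 (Finset.mem_biUnion.2 ⟨f v, ?_, stmts₁_self⟩)
    exact stmts_supportsStmt hF hq v
  case halt => cases h
  case branch =>
    rw [hst h]
    apply hs
    cases f v <;> simp [stmts₁, stmts₁_self]
  all_goals
    rw [hst h]
    apply hs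
    simp [stmts₁, stmts₁_self]

variable [DecidableEq K]

/-- The configuration of the affine machine just before executing a statement. -/
def stmtConf (s : Stmt (fun _ : K => Γ') Λ σ) (v : σ) (S : K → List Γ') :
    Conf K (Stmt (fun _ : K => Γ') Λ σ × σ) :=
  ⟨stmtState s v, fun k => stackCode (S k)⟩

theorem exists_source_eq_stmtConf [Inhabited K] {s : Stmt (fun _ : K => Γ') Λ σ} (hs : s ≠ .halt)
    (v : σ) (S : K → List Γ') :
    ∃ q d u s' v' S', stmtConf s v S = (affineMachine M).source q d u ∧
      (affineMachine M).target q d u = stmtConf s' v' S' ∧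
      (stepAux s' v' S' = stepAux s v S ∧ sizeOf s' < sizeOf s ∨
        stepAux s' v' S' ∈ step M (stepAux s v S)) := by
  have key : ∀ k (m a : ℤ) l, (stackCode l : ℤ) = m * stackCode (S k).tail + a →
      (fun i => (stackCode (Function.update S k l i) : ℤ)) =
        scale k m (fun i => (stackCode (Function.update S k (S k).tail i) : ℤ)) +
          Pi.single k a := by
    intro k m a l h
    ext i
    rcases eq_or_ne i k with rfl | hi
    · simp [scale_apply, h]
    · simp [scale_apply, hi]
  choose d hd hd' using fun k => exists_stackCode_eq (S k)
  have source : ∀ k, (fun i => (stackCode (S i) : ℤ)) =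
      scale k 5 (fun i => (stackCode (Function.update S k (S k).tail i) : ℤ)) +
        Pi.single k (d k : ℤ) := fun k => by
    rw [← key k 5 (d k) (S k) (hd' k), Function.update_eq_self]
  obtain ⟨s', v', l, hnext, hl, hstep⟩ : ∃ s' v' l,
      (affineMachine M).next (s, v) (d ((affineMachine M).stk (s, v))) = stmtState s' v' ∧
      (stackCode l : ℤ) = (affineMachine M).mul (s, v) (d ((affineMachine M).stk (s, v))) *
        stackCode (S ((affineMachine M).stk (s, v))).tail +
          (affineMachine M).add (s, v) (d ((affineMachine M).stk (s, v))) ∧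
      (stepAux s' v' (Function.update S ((affineMachine M).stk (s, v)) l) = stepAux s v S ∧
        sizeOf s' < sizeOf s ∨
        stepAux s' v' (Function.update S ((affineMachine M).stk (s, v)) l) ∈
          step M (stepAux s v S)) := by
    cases s with
    | push k f s =>
      refine ⟨s, v, f v :: S k, rfl, ?_, .inl ⟨rfl, by simp⟩⟩
      simp only [stackCode, affineMachine]
      push_cast
      rw [hd' k]
      ring
    | peek k f s =>
      refine ⟨s, f v (S k).head?, S k, ?_, hd' k, .inl ⟨?_, by simp⟩⟩
      · exact congrArg (fun o => stmtState s (f v o)) (hd k)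
      · rw [affineMachine, Function.update_eq_self]
        rfl
    | pop k f s =>
      refine ⟨s, f v (S k).head?, (S k).tail, ?_, ?_, .inl ⟨rfl, by simp⟩⟩
      · exact congrArg (fun o => stmtState s (f v o)) (hd k)
      · simp [affineMachine]
    | load f s =>
      refine ⟨s, f v, S default, rfl, hd' _, .inl ⟨?_, by simp⟩⟩
      rw [affineMachine, Function.update_eq_self]
      rfl
    | branch f s₁ s₂ =>
      refine ⟨cond (f v) s₁ s₂, v, S default, rfl, hd' _, .inl ⟨?_, ?_⟩⟩
      · rw [affineMachine, Function.update_eq_self, stepAux]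
        cases f v <;> rfl
      · cases f v <;> simp +arith
    | goto f =>
      refine ⟨M (f v), v, S default, rfl, hd' _, .inr ?_⟩
      rw [affineMachine, Function.update_eq_self]
      rfl
    | halt => exact absurd rfl hs
  exact ⟨(s, v), _, _, s', v', _, Conf.ext (stmtState_of_ne hs v) (source _),
    Conf.ext hnext (key _ _ _ l hl).symm, hstep⟩

theorem halts_stmtConf_iff [Inhabited K] (s : Stmt (fun _ : K => Γ') Λ σ) (v : σ)
    (S : K → List Γ') : (affineMachine M).Halts (stmtConf s v S) ↔
      ∃ v', Reaches M (stepAux s v S) ⟨none, v', fun _ => []⟩ := by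
  constructor
  · suffices ∀ β, (affineMachine M).Halts β → ∀ s v S, β = stmtConf s v S →
        ∃ v', Reaches M (stepAux s v S) ⟨none, v', fun _ => []⟩ from fun h => this _ h s v S rfl
    intro β hβ
    induction hβ using Relation.ReflTransGen.head_induction_on with
    | refl =>
      intro s v S h
      obtain rfl : s = .halt := by
        by_contra hs
        cases (congrArg Conf.state h).trans (stmtState_of_ne hs v)
      obtain rfl : S = fun _ => [] := funext fun k => stackCode_eq_zero <|
        Int.natCast_eq_zero.1 (congrFun (congrArg Conf.store h) k).symm
      exact ⟨v, Relation.ReflTransGen.refl⟩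
    | head h _ ih =>
      rintro s v S rfl
      obtain ⟨q, d, u, hβ, rfl⟩ := h
      have hs : s ≠ .halt := by
        rintro rfl
        cases congrArg Conf.state hβ
      obtain ⟨q', d', u', s', v', S', h₁, h₂, h₃⟩ := exists_source_eq_stmtConf M hs v S
      obtain ⟨rfl, rfl, rfl⟩ := AffineMachine.source_inj (h₁.symm.trans hβ)
      obtain ⟨w, hw⟩ := ih s' v' S' h₂
      rcases h₃ with h₃ | h₃
      · exact ⟨w, h₃.1 ▸ hw⟩
      · exact ⟨w, Relation.ReflTransGen.head h₃ hw⟩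
  · rintro ⟨w, hw⟩
    generalize hc : stepAux s v S = c at hw
    induction hw using Relation.ReflTransGen.head_induction_on generalizing s v S with
    | refl =>
      induction hn : sizeOf s using Nat.strong_induction_on generalizing s v S with
      | _ n ih =>
      subst hn
      by_cases hs : s = .halt
      · subst hs
        cases hc
        exact Relation.ReflTransGen.refl
      · obtain ⟨q', d', u', s', v', S', h₁, h₂, h₃⟩ := exists_source_eq_stmtConf M hs v S
        rcases h₃ with h₃ | h₃
        · rw [h₁]
          refine Relation.ReflTransGen.head ⟨q', d', u', rfl, h₂.symm⟩ ?_
          exact ih _ h₃.2 s' v' S' (h₃.1.trans hc) rfl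
        · rw [hc] at h₃
          cases h₃
    | head hstep _ ih' =>
      induction hn : sizeOf s using Nat.strong_induction_on generalizing s v S with
      | _ n ih =>
      subst hn
      by_cases hs : s = .halt
      · subst hs hc
        cases hstep
      · obtain ⟨q', d', u', s', v', S', h₁, h₂, h₃⟩ := exists_source_eq_stmtConf M hs v S
        rw [h₁]
        refine Relation.ReflTransGen.head ⟨q', d', u', rfl, h₂.symm⟩ ?_
        rcases h₃ with h₃ | h₃
        · exact ih _ h₃.2 s' v' S' (h₃.1.trans hc) rfl
        · rw [hc] at h₃
          exact ih' s' v' S' (Option.mem_unique h₃ hstep)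

end Turing.TM2

open Turing PartrecToTM2 in
theorem stackCode_trNat_bit (b : Bool) {n : ℕ} (h : Nat.bit b n ≠ 0) (l : List Γ') :
    TM2.stackCode (trNat (Nat.bit b n) ++ l) =
      (bif b then 4 else 3) + 5 * TM2.stackCode (trNat n ++ l) := by
  simp only [trNat, ← Num.ofNat'_eq, Num.ofNat'_bit]
  cases hn : Num.ofNat' n with
  | zero =>
    cases b
    · rw [Num.ofNat'_eq] at hn
      have : n = 0 := by simpa using congrArg (fun m : Num => (m : ℕ)) hn
      simp [this] at h
    · rfl
  | pos p => cases b <;> rfl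

open Turing PartrecToTM2 in
theorem computable_stackCode_trNat (l : List Γ') :
    Computable fun n => TM2.stackCode (trNat n ++ l) := by
  let a := TM2.stackCode l
  have : Primrec₂ fun (_ : Unit) n => TM2.stackCode (trNat n ++ l) := by
    refine Primrec.nat_strong_rec _ (g := fun _ L => some (bif L.length == 0 then a else
      (bif L.length % 2 == 1 then 4 else 3) + 5 * (L[L.length / 2]?).getD 0)) ?_ ?_
    · have hl : Primrec fun L : List ℕ => L.length := Primrec.list_length
      have : Primrec fun L : List ℕ => some (bif L.length == 0 then a else
          (bif L.length % 2 == 1 then 4 else 3) + 5 * (L[L.length / 2]?).getD 0) := by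
        refine Primrec.option_some.comp (Primrec.cond (Primrec.beq.comp hl (Primrec.const 0))
          (Primrec.const a) (Primrec.nat_add.comp (Primrec.cond (Primrec.beq.comp
            (Primrec.nat_mod.comp hl (Primrec.const 2)) (Primrec.const 1)) (Primrec.const 4)
              (Primrec.const 3)) (Primrec.nat_mul.comp (Primrec.const 5)
                (Primrec.option_getD.comp ?_ (Primrec.const 0)))))
        exact Primrec.list_getElem?.comp Primrec.id
          (Primrec.nat_div.comp hl (Primrec.const 2))
      exact this.comp Primrec.snd
    · intro _ n
      rcases eq_or_ne n 0 with rfl | hn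
      · simp [a]
      · obtain ⟨b, m, rfl⟩ : ∃ b m, n = Nat.bit b m := ⟨_, _, (Nat.bit_bodd_div2 n).symm⟩
        have hm : m < Nat.bit b m := by
          have := Nat.bit_val b m
          omega
        rw [stackCode_trNat_bit b hn]
        simp only [List.length_map, List.length_range, List.getElem?_map, Nat.bit_mod_two,
          Nat.bit_div_two, List.getElem?_range hm, Option.map_some, Option.getD_some,
          beq_eq_false_iff_ne.2 hn, cond_false]
        cases b <;> rfl
  exact (this.comp (Primrec.const ()) Primrec.id).to_comp

open Turing PartrecToTM2 in
theorem exists_affineMachine {p : ℕ → Prop} (hp : REPred p) :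
    ∃ (κ Q : Type) (_ : DecidableEq κ) (_ : Finite κ) (_ : Finite Q) (M : AffineMachine κ Q)
      (q : Option Q) (j : κ) (α : ℕ → ℕ), Computable α ∧
        ∀ n, p n ↔ M.Halts ⟨q, Pi.single j (α n : ℤ)⟩ := by
  have hK : Finite K' := Finite.of_surjective ![K'.main, K'.rev, K'.aux, K'.stack] fun k => by
    cases k
    exacts [⟨0, rfl⟩, ⟨1, rfl⟩, ⟨2, rfl⟩, ⟨3, rfl⟩]
  have hp' : Partrec fun n => (Part.assert (p n) fun _ => Part.some ()).map fun _ => 0 :=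
    Partrec.map hp (Computable.const 0).to₂
  obtain ⟨c, hc⟩ := ToPartrec.Code.exists_code (Nat.Partrec'.part_iff₁.2 hp')
  let c' : ToPartrec.Code := .comp .nil c
  have heval : ∀ n (x : Cfg'), x ∈ StateTransition.eval (TM2.step tr) (init c' [n]) ↔
      p n ∧ halt [] = x := by
    intro n x
    have h₁ : c.eval [n] = _ := hc (n ::ᵥ List.Vector.nil)
    have h₂ : c'.eval [n] = (c.eval [n]).bind fun _ => Part.some [] :=
      (congrFun (ToPartrec.Code.comp_eval _ _) _).trans
        (congrArg (c.eval [n]).bind (funext ToPartrec.Code.nil_eval))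
    have h₃ : (StateTransition.eval (TM2.step tr) (init c' [n]) : Part Cfg') =
      (c'.eval [n]).map halt := tr_eval c' [n]
    refine (iff_of_eq (congrArg (x ∈ ·) h₃)).trans ?_
    rw [h₂, h₁, List.Vector.head_cons]
    simp [eq_comm]
  let F : Set (TM2.Stmt (fun _ : K' => Γ') Λ' (Option Γ') × Option Γ') :=
    {q | some q.1 ∈ TM2.stmts tr (codeSupp c' .halt)}
  have hsupp := tr_supports c' .halt
  have hF : F.Finite := by
    refine (((TM2.stmts tr (codeSupp c' .halt)).finite_toSet.preimage
      (Option.some_injective _).injOn).prod (Set.finite_univ (α := Option Γ'))).subset ?_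
    exact fun q hq => ⟨hq, trivial⟩
  let s₀ : TM2.Stmt (fun _ : K' => Γ') Λ' (Option Γ') := tr (trNormal c' .halt)
  have hs₀ : some s₀ ∈ TM2.stmts tr (codeSupp c' .halt) := by
    classical
    exact Finset.some_mem_insertNone.2 (Finset.mem_biUnion.2 ⟨_, hsupp.1, TM2.stmts₁_self⟩)
  obtain ⟨q₀, hq₀⟩ : ∃ q₀ : Option F, q₀.map (↑) = TM2.stmtState s₀ none := by
    by_cases h : s₀ = .halt
    · exact ⟨none, by rw [h]; rfl⟩
    · exact ⟨some ⟨(s₀, none), hs₀⟩, (TM2.stmtState_of_ne h _).symm⟩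
  refine ⟨K', F, inferInstance, hK, hF, (TM2.affineMachine tr).restrict F, q₀, .main,
    fun n => TM2.stackCode (trNat n ++ [Γ'.cons]), computable_stackCode_trNat _, fun n => ?_⟩
  have hnext : ∀ q ∈ F, ∀ d, ∀ p ∈ (TM2.affineMachine tr).next q d, p ∈ F := fun q hq d p hp =>
    @TM2.mem_stmts_of_mem_next _ _ _ tr _ ⟨trNormal c' .halt⟩ _ hsupp _ _ _ hq hp
  rw [AffineMachine.halts_restrict_iff hnext, hq₀]
  have hconf : TM2.stmtConf s₀ none (K'.elim (trList [n]) [] [] []) =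
      ⟨TM2.stmtState s₀ none, Pi.single .main (TM2.stackCode (trNat n ++ [Γ'.cons]) : ℤ)⟩ := by
    refine Conf.ext rfl (funext fun k => ?_)
    cases k <;> rfl
  rw [← hconf]
  refine Iff.trans ?_ (TM2.halts_stmtConf_iff _ _ _ _).symm
  have hhalt : halt [] = ⟨none, none, fun _ => []⟩ := by
    refine congrArg (TM2.Cfg.mk none none) (funext fun k => ?_)
    cases k <;> rfl
  have hinit : ∀ x, TM2.Reaches tr (TM2.stepAux s₀ none (K'.elim (trList [n]) [] [] [])) x →
      StateTransition.Reaches (TM2.step tr) (init c' [n]) x := fun x h =>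
    Relation.ReflTransGen.head rfl h
  constructor
  · intro h
    obtain ⟨h, -⟩ := StateTransition.mem_eval.1 ((heval n _).2 ⟨h, rfl⟩)
    rcases Relation.ReflTransGen.cases_head h with h | ⟨y, hy, h⟩
    · cases h
    · cases (Option.some.inj hy : TM2.stepAux s₀ none (K'.elim (trList [n]) [] [] []) = y)
      exact ⟨none, hhalt ▸ h⟩
  · rintro ⟨v, hv⟩
    exact ((heval n _).1 (StateTransition.mem_eval.2 ⟨hinit _ hv, rfl⟩)).1

theorem FreeGroup.lift_mk_map {α β Γ : Type*} [Group Γ] (f : α → β) (v : β → Γ)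
    (L : List (α × Bool)) :
    FreeGroup.lift v (.mk (L.map fun x => (f x.1, x.2))) = FreeGroup.lift (v ∘ f) (.mk L) := by
  simp [Function.comp_def]

theorem FreeGroup.lift_mk_replicate {α Γ : Type*} [Group Γ] (v : α → Γ) (x t u : α) (a : ℕ) :
    FreeGroup.lift v (.mk ((List.range a).map (fun _ => (x, true)) ++ [(t, true)] ++
      (List.range a).map (fun _ => (x, false)) ++ [(u, false)])) =
      v x ^ a * v t * (v x ^ a)⁻¹ * (v u)⁻¹ := by
  simp [mul_assoc]

/-- A family of elements of a group satisfies the given relators. -/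
def Satisfies {α Γ : Type*} [Group Γ] (R : List (List (α × Bool))) (v : α → Γ) : Prop :=
  ∀ r ∈ R, FreeGroup.lift v (.mk r) = 1

theorem satisfies_one {α Γ : Type*} [Group Γ] (R : List (List (α × Bool))) :
    Satisfies R fun _ => (1 : Γ) := by
  intro r _
  have : FreeGroup.lift (fun _ : α => (1 : Γ)) = 1 := by
    ext
    simp
  rw [this, MonoidHom.one_apply]

theorem exists_computable_relators {p : ℕ → Prop} (hp : REPred p) :
    ∃ (m : ℕ) (R : ℕ → List (Word m)), Computable R ∧ ∀ n,
      (p n → ∀ (Γ : Type) [Group Γ] (v : Fin m → Γ), Satisfies (R n) v →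
        ∀ i j, Commute (v i) (v j)) ∧
      (¬ p n → ∃ (Γ : Type) (_ : Group Γ) (v : Fin m → Γ), Satisfies (R n) v ∧
        ∃ i j, ¬ Commute (v i) (v j)) := by
  obtain ⟨κ, Q, _, _, _, M, q, j, α, hα, hM⟩ := exists_affineMachine hp
  obtain ⟨G, _, S, x, t, u, hS, h⟩ := M.exists_relators q j
  let e := Finite.equivFin G
  let L : List (Word (Nat.card G)) :=
    hS.toFinset.toList.map fun r => (FreeGroup.map e r).toWord
  let w : ℕ → Word (Nat.card G) := fun a => (List.range a).map (fun _ => (e x, true)) ++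
    [(e t, true)] ++ (List.range a).map (fun _ => (e x, false)) ++ [(e u, false)]
  have hw : Primrec w := by
    have hr : ∀ c : Fin (Nat.card G) × Bool, Primrec fun a => (List.range a).map fun _ => c :=
      fun c => Primrec.list_map Primrec.list_range (Primrec.const c).to₂
    exact Primrec.list_append.comp (Primrec.list_append.comp (Primrec.list_append.comp
      (hr _) (Primrec.const _)) (hr _)) (Primrec.const _)
  have hsat : ∀ (Γ : Type) [Group Γ] (v : Fin (Nat.card G) → Γ) (a : ℕ),
      Satisfies (w a :: L) v ↔ (∀ r ∈ S, FreeGroup.lift (v ∘ e) r = 1) ∧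
        (v ∘ e) u = (v ∘ e) x ^ (a : ℤ) * (v ∘ e) t * ((v ∘ e) x ^ (a : ℤ))⁻¹ := by
    intro Γ _ v a
    have hlift : ∀ r, FreeGroup.lift v (FreeGroup.map e r) = FreeGroup.lift (v ∘ e) r :=
      DFunLike.congr_fun (f := (FreeGroup.lift v).comp (FreeGroup.map e)) (by ext; simp)
    simp only [Satisfies, List.forall_mem_cons, L, List.forall_mem_map, Finset.mem_toList,
      Set.Finite.mem_toFinset, FreeGroup.mk_toWord, hlift, w, FreeGroup.lift_mk_replicate,
      mul_inv_eq_one, zpow_natCast, Function.comp_apply]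
    rw [and_comm, eq_comm]
  refine ⟨Nat.card G, fun n => w (α n) :: L,
    Computable.list_cons.comp (hw.to_comp.comp hα) (Computable.const L), fun n => ⟨?_, ?_⟩⟩
  · intro hn Γ _ v hv i j
    obtain ⟨h₁, h₂⟩ := (hsat Γ v _).1 hv
    simpa using (h (α n)).1 ((hM n).1 hn) Γ (v ∘ e) h₁ h₂ (e.symm i) (e.symm j)
  · intro hn
    obtain ⟨Γ, _, v, h₁, h₂, g, k, hgk⟩ := (h (α n)).2 fun h => hn ((hM n).2 h)
    have hv : (v ∘ e.symm) ∘ e = v := by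
      ext
      simp
    refine ⟨Γ, _, v ∘ e.symm, (hsat Γ _ _).2 (by simpa only [hv] using ⟨h₁, h₂⟩), e g, e k, ?_⟩
    simpa using hgk

/-- Relators of the direct product of two groups given by generators and relators. -/
def productRelators {m k : ℕ} (R : List (Word m)) (S : List (Word k)) : List (Word (m + k)) :=
  R.map (List.map fun x => (Fin.castAdd k x.1, x.2)) ++
    (S.map (List.map fun x => (Fin.natAdd m x.1, x.2)) ++
      (List.finRange m).flatMap fun i => (List.finRange k).map fun j =>
        [(Fin.castAdd k i, true), (Fin.natAdd m j, true),
          (Fin.castAdd k i, false), (Fin.natAdd m j, false)])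

theorem computable_productRelators {m k : ℕ} {R : ℕ → List (Word m)} {S : ℕ → List (Word k)}
    (hR : Computable R) (hS : Computable S) :
    Computable fun n => productRelators (R n) (S n) := by
  have hmap : ∀ {a b : ℕ} (f : Fin a → Fin b),
      Computable fun L : List (Word a) => L.map (List.map fun x => (f x.1, x.2)) := by
    intro a b f
    have hf : Primrec fun x : Fin a × Bool => (f x.1, x.2) := Primrec.dom_finite _
    have hl : Primrec (List.map fun x : Fin a × Bool => (f x.1, x.2)) :=
      Primrec.list_map Primrec.id (hf.comp Primrec.snd).to₂
    exact (Primrec.list_map Primrec.id (hl.comp Primrec.snd).to₂).to_comp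
  exact Computable.list_append.comp ((hmap _).comp hR)
    (Computable.list_append.comp ((hmap _).comp hS) (Computable.const _))

theorem satisfies_productRelators_iff {m k : ℕ} {R : List (Word m)} {S : List (Word k)}
    {Γ : Type*} [Group Γ] {v : Fin (m + k) → Γ} :
    Satisfies (productRelators R S) v ↔ Satisfies R (v ∘ Fin.castAdd k) ∧
      Satisfies S (v ∘ Fin.natAdd m) ∧
        ∀ i j, Commute (v (Fin.castAdd k i)) (v (Fin.natAdd m j)) := by
  have hcomm : ∀ a b : Γ, a * (b * (a⁻¹ * b⁻¹)) = 1 ↔ Commute a b := fun a b => by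
    rw [← commutatorElement_eq_one_iff_commute, commutatorElement_def, mul_assoc, mul_assoc]
  simp only [Satisfies, productRelators, List.forall_mem_append, List.forall_mem_map,
    List.forall_mem_flatMap, FreeGroup.lift_mk_map]
  simp [hcomm]

theorem FinPres.satisfies_proj (P : FinPres) : Satisfies P.2 fun i => P.proj (.of i) := by
  intro r hr
  have : FreeGroup.lift (fun i => P.proj (.of i)) = P.proj := by
    ext
    simp
  rw [this]
  exact PresentedGroup.one_of_mem ⟨r, hr, rfl⟩

theorem FinPres.not_commute_proj {P : FinPres} {Γ : Type*} [Group Γ] {v : Fin P.1 → Γ}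
    (hv : Satisfies P.2 v) {i j : Fin P.1} (h : ¬ Commute (v i) (v j)) :
    ¬ Commute (P.proj (.of i)) (P.proj (.of j)) := by
  intro hij
  have hrels : ∀ r ∈ P.rels, FreeGroup.lift v r = 1 := by
    rintro _ ⟨r, hr, rfl⟩
    exact hv r hr
  have hof : ∀ i, PresentedGroup.toGroup hrels (P.proj (.of i)) = v i := fun i =>
    PresentedGroup.toGroup.of hrels
  exact h (hof i ▸ hof j ▸ hij.map (PresentedGroup.toGroup hrels))

theorem REPred.mem_eval_self (b : ℕ) :
    REPred fun n => b ∈ (Denumerable.ofNat Nat.Partrec.Code n).eval n := by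
  have heval : Partrec fun n : ℕ => (Denumerable.ofNat Nat.Partrec.Code n).eval n :=
    Nat.Partrec.Code.eval_part.comp (Computable.ofNat _) Computable.id
  have : Partrec fun n : ℕ => ((Denumerable.ofNat Nat.Partrec.Code n).eval n).bind fun x =>
      bif x == b then Part.some () else Part.none :=
    heval.bind (Partrec.cond ((Primrec.beq.comp Primrec.id (Primrec.const b)).to_comp.comp
      Computable.snd) (Computable.const ()).partrec Partrec.none).to₂
  refine this.dom_re.of_eq fun n => ?_
  rw [Part.dom_iff_mem]
  constructor
  · rintro ⟨y, hy⟩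
    obtain ⟨x, hx, hxy⟩ := Part.mem_bind_iff.1 hy
    cases hxb : x == b
    · simp [hxb] at hxy
    · rwa [← beq_iff_eq.1 hxb]
  · exact fun h => ⟨(), Part.mem_bind_iff.2 ⟨b, h, by simp⟩⟩

/-- Corollary 4.6 (Chiodo): there is no algorithm that, on input of a finite
presentation of a non-abelian group, halts and outputs two generators whose
images in the presented group do not commute. -/
theorem no_algorithm_noncommuting_generators :
    ¬ ∃ g : ℕ →. ℕ, Nat.Partrec g ∧
      ∀ P : FinPres, (∃ a b : P.Grp, ¬ Commute a b) →
        ∃ i j : Fin P.1,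
          Encodable.encode ((i : ℕ), (j : ℕ)) ∈ g (Encodable.encode P) ∧
          ¬ Commute (P.proj (FreeGroup.of i)) (P.proj (FreeGroup.of j)) := by
  rintro ⟨g, hg, hgP⟩
  obtain ⟨m, R, hR, hRn⟩ := exists_computable_relators (REPred.mem_eval_self 0)
  obtain ⟨k, S, hS, hSn⟩ := exists_computable_relators (REPred.mem_eval_self 1)
  let P : ℕ → FinPres := fun n => ⟨m + k, productRelators (R n) (S n)⟩
  have hP : Computable fun n => Encodable.encode (P n) :=
    (Primrec₂.natPair.to_comp.comp (Computable.const (m + k))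
      (Computable.encode.comp (computable_productRelators hR hS)) :)
  have hF : Partrec fun n => (g (Encodable.encode (P n))).map fun z =>
      bif decide (z.unpair.1 < m) then 0 else 1 := by
    have hlt : Primrec fun z : ℕ => decide (z.unpair.1 < m) :=
      Primrec.nat_lt.decide.comp (Primrec.fst.comp Primrec.unpair) (Primrec.const m)
    have hcond : Primrec fun z : ℕ => bif decide (z.unpair.1 < m) then 0 else 1 :=
      Primrec.cond hlt (Primrec.const 0) (Primrec.const 1)
    exact ((Partrec.nat_iff.2 hg).comp hP).map (hcond.to_comp.comp Computable.snd).to₂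
  obtain ⟨c, hc⟩ := Nat.Partrec.Code.exists_code.1 (Partrec.nat_iff.1 hF)
  let n := Encodable.encode c
  have hn : (Denumerable.ofNat Nat.Partrec.Code n).eval n =
      (g (Encodable.encode (P n))).map fun z => bif decide (z.unpair.1 < m) then 0 else 1 := by
    rw [Denumerable.ofNat_encode, hc]
  obtain ⟨i, j, hij, hncomm⟩ := hgP (P n) <| by
    by_cases h : 0 ∈ (Denumerable.ofNat Nat.Partrec.Code n).eval n
    · have h₁ : 1 ∉ (Denumerable.ofNat Nat.Partrec.Code n).eval n := fun h₁ =>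
        zero_ne_one (Part.mem_unique h h₁)
      obtain ⟨Γ, _, v, hv, i, j, hij⟩ := (hSn n).2 h₁
      have hsat : Satisfies (P n).2 (Fin.addCases (fun _ => 1) v : Fin (m + k) → Γ) :=
        satisfies_productRelators_iff.2 ⟨by simpa [Function.comp_def] using satisfies_one (R n),
          by simpa [Function.comp_def] using hv, by simp⟩
      exact ⟨_, _, FinPres.not_commute_proj hsat (i := Fin.natAdd m i) (j := Fin.natAdd m j)
        (by simpa using hij)⟩
    · obtain ⟨Γ, _, v, hv, i, j, hij⟩ := (hRn n).2 h
      have hsat : Satisfies (P n).2 (Fin.addCases v (fun _ => 1) : Fin (m + k) → Γ) :=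
        satisfies_productRelators_iff.2 ⟨by simpa [Function.comp_def] using hv,
          by simpa [Function.comp_def] using satisfies_one (S n), by simp⟩
      exact ⟨_, _, FinPres.not_commute_proj hsat (i := Fin.castAdd k i) (j := Fin.castAdd k j)
        (by simpa using hij)⟩
  obtain ⟨h₁, h₂, h₃⟩ := satisfies_productRelators_iff.1 (P n).satisfies_proj
  have hmem : (bif decide ((i : ℕ) < m) then 0 else 1) ∈
      (Denumerable.ofNat Nat.Partrec.Code n).eval n := by
    rw [hn]
    refine (Part.mem_map_iff _).2 ⟨_, hij, ?_⟩
    simp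
  induction i using Fin.addCases with
  | left i =>
    induction j using Fin.addCases with
    | left j => exact hncomm ((hRn n).1 (by simpa using hmem) _ _ h₁ i j)
    | right j => exact hncomm (h₃ i j)
  | right i =>
    induction j using Fin.addCases with
    | left j => exact hncomm (h₃ j i).symm
    | right j => exact hncomm ((hSn n).1 (by simpa using hmem) _ _ h₂ i j)
end

section
/- There is no algorithm (partial recursive function on codes) that, on input of a code of a finite presentation P whose presented group is isomorphic to a free product A ∗ B of two nontrivial finitely presented groups, halts and outputs codes of two finite presentations P_1, P_2 such that both presented groups of P_1 and P_2 are nontrivial and the free product (Monoid.Coprod) of the presented groups of P_1 and P_2 is isomorphic (as a group, via a MulEquiv) to the presented group of P. -/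
section

open Function

/-- A machine acting on states in `Q` and integer registers indexed by `K`: in state `q` the
register `coord q` is written as `5 * u + a` with `a : Fin 5`, and replaced by
`mul q a * u + add q a`, while the state becomes `next q a`. -/
structure DigitMachine (Q K : Type) where
  coord : Q → K
  next : Q → Fin 5 → Q
  mul : Q → Fin 5 → ℕ
  mul_pos : ∀ q a, 0 < mul q a
  add : Q → Fin 5 → ℕ

namespace DigitMachine

variable {Q K : Type} [DecidableEq K]

/-- A set of configurations is invariant if it is a union of orbits of the machine. -/
def Invariant (M : DigitMachine Q K) (C : Set (Q × (K → ℤ))) : Prop :=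
  ∀ (q : Q) (a : Fin 5) (u : ℤ) (v : K → ℤ),
    (q, update v (M.coord q) (5 * u + (a : ℕ))) ∈ C ↔
      (M.next q a, update v (M.coord q) (M.mul q a * u + M.add q a)) ∈ C

/-- The last base-five digit of an integer. -/
def digit (n : ℤ) : Fin 5 := ⟨(n % 5).toNat, by omega⟩

theorem digit_spec (n : ℤ) : 5 * (n / 5) + ((digit n : ℕ) : ℤ) = n := by
  simp only [digit]; omega

theorem digit_eq (u : ℤ) (a : Fin 5) : digit (5 * u + (a : ℕ)) = a := by
  ext; simp only [digit]; omega

theorem div_eq (u : ℤ) (a : Fin 5) : (5 * u + (a : ℕ)) / 5 = u := by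
  omega

/-- One step of the machine. -/
def run (M : DigitMachine Q K) (y : Q × (K → ℤ)) : Q × (K → ℤ) :=
  (M.next y.1 (digit (y.2 (M.coord y.1))),
    update y.2 (M.coord y.1) (M.mul y.1 (digit (y.2 (M.coord y.1))) * (y.2 (M.coord y.1) / 5) +
      M.add y.1 (digit (y.2 (M.coord y.1)))))

theorem run_update (M : DigitMachine Q K) (q : Q) (a : Fin 5) (u : ℤ) (v : K → ℤ) :
    M.run (q, update v (M.coord q) (5 * u + (a : ℕ))) =
      (M.next q a, update v (M.coord q) (M.mul q a * u + M.add q a)) := by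
  simp [run, digit_eq, div_eq]

theorem invariant_iff (M : DigitMachine Q K) (C : Set (Q × (K → ℤ))) :
    M.Invariant C ↔ ∀ y, y ∈ C ↔ M.run y ∈ C := by
  constructor
  · rintro h ⟨q, v⟩
    have := h q (digit (v (M.coord q))) (v (M.coord q) / 5) v
    rwa [← run_update, digit_spec, update_eq_self] at this
  · intro h q a u v
    rw [← run_update]
    exact h _

theorem Invariant.mem_iterate {M : DigitMachine Q K} {C : Set (Q × (K → ℤ))}
    (h : M.Invariant C) (n : ℕ) (y : Q × (K → ℤ)) : y ∈ C ↔ M.run^[n] y ∈ C := by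
  rw [invariant_iff] at h
  induction n generalizing y with
  | zero => rfl
  | succ n ih => rw [iterate_succ_apply, ← ih, ← h]

theorem invariant_reaches (M : DigitMachine Q K) {y₀ : Q × (K → ℤ)} (h : M.run y₀ = y₀) :
    M.Invariant {y | ∃ n, M.run^[n] y = y₀} := by
  rw [invariant_iff]
  intro y
  constructor
  · rintro ⟨n, hn⟩
    refine ⟨n, ?_⟩
    rw [← iterate_succ_apply, iterate_succ_apply', hn, h]
  · rintro ⟨n, hn⟩
    exact ⟨n + 1, by rwa [iterate_succ_apply]⟩

/-- Restriction of a machine to a closed set of states. -/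
def restrict (M : DigitMachine Q K) (s : Set Q) (hs : ∀ q ∈ s, ∀ a, M.next q a ∈ s) :
    DigitMachine s K where
  coord q := M.coord q
  next q a := ⟨M.next q a, hs q q.2 a⟩
  mul q a := M.mul q a
  mul_pos q a := M.mul_pos q a
  add q a := M.add q a

theorem restrict_run (M : DigitMachine Q K) {s : Set Q} (hs : ∀ q ∈ s, ∀ a, M.next q a ∈ s)
    (q : s) (v : K → ℤ) :
    (((M.restrict s hs).run (q, v)).1.1, ((M.restrict s hs).run (q, v)).2) = M.run (q, v) :=
  rfl

theorem restrict_iterate (M : DigitMachine Q K) {s : Set Q}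
    (hs : ∀ q ∈ s, ∀ a, M.next q a ∈ s) (n : ℕ) (y : s × (K → ℤ)) :
    ((((M.restrict s hs).run^[n] y).1 : Q), ((M.restrict s hs).run^[n] y).2) =
      M.run^[n] ((y.1 : Q), y.2) := by
  induction n generalizing y with
  | zero => rfl
  | succ n ih => rw [iterate_succ_apply, iterate_succ_apply, ih]; rfl

end DigitMachine

namespace StackDigits

open Turing Turing.PartrecToTM2

/-- The digit coding a stack letter; the digit `0` is reserved for the empty stack. -/
def enc : Γ' → Fin 5
  | .consₗ => 1
  | .cons => 2
  | .bit0 => 3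
  | .bit1 => 4

/-- The stack letter coded by a digit. -/
def dec : Fin 5 → Option Γ'
  | 0 => none
  | 1 => some .consₗ
  | 2 => some .cons
  | 3 => some .bit0
  | 4 => some .bit1

/-- The number coding a stack. -/
def stackNum : List Γ' → ℕ
  | [] => 0
  | g :: l => 5 * stackNum l + enc g

theorem dec_digit (l : List Γ') : dec (DigitMachine.digit (stackNum l)) = l.head? := by
  cases l with
  | nil => rfl
  | cons g l =>
    simp only [stackNum]
    push_cast
    rw [DigitMachine.digit_eq]
    cases g <;> rfl

theorem stackNum_div (l : List Γ') : (stackNum l : ℤ) / 5 = stackNum l.tail := by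
  cases l with
  | nil => rfl
  | cons g l =>
    simp only [stackNum, List.tail_cons]
    omega

/-- Statements of the stack machine of a partial recursive function. -/
abbrev StackStmt : Type := TM2.Stmt (fun _ : K' => Γ') Λ' (Option Γ')

/-- Configurations of the stack machine of a partial recursive function. -/
abbrev StackCfg : Type := TM2.Cfg (fun _ : K' => Γ') Λ' (Option Γ')

/-- The program of the stack machine of a partial recursive function. -/
abbrev program : Λ' → StackStmt := tr

/-- The states of the simulating machine: the remaining statement and the local variable. -/
abbrev State : Type := Option StackStmt × Option Γ'

/-- The digit machine simulating the stack machine of a partial recursive function. -/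
def rule : State → K' × (Fin 5 → State × ℕ × ℕ)
  | (some (.push k f q), s) => (k, fun a => ((some q, s), 25, 5 * a + enc (f s)))
  | (some (.peek k f q), s) => (k, fun a => ((some q, f s (dec a)), 5, a))
  | (some (.pop k f q), s) => (k, fun a => ((some q, f s (dec a)), 1, 0))
  | (some (.load f q), s) => (.main, fun a => ((some q, f s), 5, a))
  | (some (.branch f q₁ q₂), s) => (.main, fun a => ((some (cond (f s) q₁ q₂), s), 5, a))
  | (some (.goto l), s) => (.main, fun a => ((some (program (l s)), s), 5, a))
  | (some .halt, s) => (.main, fun a => ((none, s), 5, a))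
  | (none, s) => (.main, fun a => ((none, s), 5, a))

/-- The digit machine simulating the stack machine of a partial recursive function. -/
def machine : DigitMachine State K' where
  coord q := (rule q).1
  next q a := ((rule q).2 a).1
  mul q a := ((rule q).2 a).2.1
  mul_pos q a := by
    rcases q with ⟨(_ | (_ | _ | _ | _ | _ | _ | _)), s⟩ <;> simp [rule]
  add q a := ((rule q).2 a).2.2

theorem machine_run (q : State) (v : K' → ℤ) :
    machine.run (q, v) =
      (((rule q).2 (DigitMachine.digit (v (rule q).1))).1,
        update v (rule q).1 (((rule q).2 (DigitMachine.digit (v (rule q).1))).2.1 *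
          (v (rule q).1 / 5) + ((rule q).2 (DigitMachine.digit (v (rule q).1))).2.2)) := rfl

/-- The configuration of the digit machine coding a configuration of the stack machine. -/
def embed (c : StackCfg) : State × (K' → ℤ) :=
  ((c.l.map program, c.var), fun k => stackNum (c.stk k))

theorem update_stackNum (S : K' → List Γ') (k : K') (l : List Γ') :
    (fun i => (stackNum (update S k l i) : ℤ)) =
      update (fun i => (stackNum (S i) : ℤ)) k (stackNum l) := by
  ext i
  by_cases h : i = k
  · subst h; simp
  · simp [h]

theorem exists_iterate_stmt (q : StackStmt) (s : Option Γ') (S : K' → List Γ') :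
    ∃ n, machine.run^[n + 1] ((some q, s), fun k => stackNum (S k)) =
      embed (TM2.stepAux q s S) := by
  induction q generalizing s S with
  | push k f q ih =>
    obtain ⟨n, hn⟩ := ih s (update S k (f s :: S k))
    refine ⟨n + 1, ?_⟩
    rw [iterate_succ_apply, TM2.stepAux, ← hn, update_stackNum, machine_run]
    congr 3
    simp only [rule, stackNum]
    have := DigitMachine.digit_spec (stackNum (S k))
    push_cast
    linarith
  | peek k f q ih =>
    obtain ⟨n, hn⟩ := ih (f s (S k).head?) S
    refine ⟨n + 1, ?_⟩
    rw [iterate_succ_apply, TM2.stepAux, ← hn, machine_run]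
    simp only [rule, dec_digit]
    congr 2
    push_cast
    rw [DigitMachine.digit_spec, update_eq_self_iff.2 rfl]
  | pop k f q ih =>
    obtain ⟨n, hn⟩ := ih (f s (S k).head?) (update S k (S k).tail)
    refine ⟨n + 1, ?_⟩
    rw [iterate_succ_apply, TM2.stepAux, ← hn, update_stackNum, machine_run]
    simp only [rule, dec_digit, stackNum_div]
    simp
  | load f q ih =>
    obtain ⟨n, hn⟩ := ih (f s) S
    refine ⟨n + 1, ?_⟩
    rw [iterate_succ_apply, TM2.stepAux, ← hn, machine_run]
    simp only [rule]
    push_cast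
    rw [DigitMachine.digit_spec, update_eq_self_iff.2 rfl]
  | branch f q₁ q₂ ih₁ ih₂ =>
    have : ∃ n, machine.run^[n + 1] ((some (cond (f s) q₁ q₂), s), fun k => stackNum (S k)) =
        embed (TM2.stepAux (.branch f q₁ q₂) s S) := by
      rw [TM2.stepAux]
      cases f s
      · exact ih₂ s S
      · exact ih₁ s S
    obtain ⟨n, hn⟩ := this
    refine ⟨n + 1, ?_⟩
    rw [iterate_succ_apply, ← hn, machine_run]
    simp only [rule]
    push_cast
    rw [DigitMachine.digit_spec, update_eq_self_iff.2 rfl]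
  | goto l =>
    refine ⟨0, ?_⟩
    rw [iterate_one, machine_run]
    simp only [rule]
    push_cast
    rw [DigitMachine.digit_spec, update_eq_self_iff.2 rfl]
    rfl
  | halt =>
    refine ⟨0, ?_⟩
    rw [iterate_one, machine_run]
    simp only [rule]
    push_cast
    rw [DigitMachine.digit_spec, update_eq_self_iff.2 rfl]
    rfl

theorem exists_iterate_of_reaches {c c' : Cfg'}
    (h : TM2.Reaches program c c') :
    ∃ n, machine.run^[n] (embed c) = embed c' := by
  induction h with
  | refl => exact ⟨0, rfl⟩
  | @tail b d _ hbc ih =>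
    obtain ⟨n, hn⟩ := ih
    obtain ⟨l, s, S⟩ := b
    cases l with
    | none => cases hbc
    | some l =>
      obtain rfl : TM2.stepAux (program l) s S = d := Option.some.inj hbc
      obtain ⟨m, hm⟩ := exists_iterate_stmt (program l) s S
      refine ⟨(m + 1) + n, ?_⟩
      rw [iterate_add_apply, hn]
      exact hm

theorem run_halted (s : Option Γ') (v : K' → ℤ) :
    machine.run ((none, s), v) = ((none, s), v) := by
  rw [machine_run]
  simp only [rule]
  push_cast
  rw [DigitMachine.digit_spec, update_eq_self_iff.2 rfl]

theorem halted_mono {y : State × (K' → ℤ)} {m n : ℕ} (hmn : m ≤ n)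
    (h : (machine.run^[m] y).1.1 = none) : (machine.run^[n] y).1.1 = none := by
  obtain ⟨d, rfl⟩ := Nat.exists_eq_add_of_le hmn
  rw [Nat.add_comm, iterate_add_apply]
  generalize machine.run^[m] y = y' at h
  obtain ⟨⟨o, s⟩, v⟩ := y'
  obtain rfl : o = none := h
  rw [iterate_fixed (run_halted s v)]

theorem eval_dom_of_halted (n : ℕ) (c : StackCfg) (h : (machine.run^[n] (embed c)).1.1 = none) :
    (StateTransition.eval (TM2.step program) c).Dom := by
  induction n using Nat.strong_induction_on generalizing c with
  | _ n ih =>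
    obtain ⟨l, s, S⟩ := c
    cases l with
    | none =>
      rw [Part.dom_iff_mem]
      exact ⟨_, StateTransition.mem_eval.2 ⟨.refl, rfl⟩⟩
    | some l =>
      have hred : StateTransition.Reaches (TM2.step program) ⟨some l, s, S⟩
          (TM2.stepAux (program l) s S) := .single rfl
      rw [StateTransition.reaches_eval hred]
      obtain ⟨m, hm⟩ := exists_iterate_stmt (program l) s S
      change machine.run^[m + 1] (embed ⟨some l, s, S⟩) = _ at hm
      refine ih (n - (m + 1)) ?_ _ ?_
      · rcases n with _ | n
        · simp [embed] at h
        · omega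
      · rcases le_or_gt (m + 1) n with hle | hlt
        · rw [← hm, ← iterate_add_apply, Nat.sub_add_cancel hle]
          exact h
        · rw [← hm, ← iterate_add_apply]
          exact halted_mono (by omega) h

/-- The states of the simulating machine supported by a code. -/
def states (c : ToPartrec.Code) : Set State :=
  {q | q.1 ∈ TM2.stmts program (codeSupp c Cont'.halt)}

instance (c : ToPartrec.Code) : Finite (states c) :=
  (((TM2.stmts program (codeSupp c Cont'.halt)).finite_toSet.prod
    (Set.finite_univ (α := Option Γ'))).subset fun _ hq => ⟨hq, trivial⟩).to_subtype

theorem some_program_mem {c : ToPartrec.Code} {l : Λ'} (hl : l ∈ codeSupp c Cont'.halt) :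
    some (program l) ∈ TM2.stmts program (codeSupp c Cont'.halt) := by
  simp only [TM2.stmts, Finset.mem_insertNone, Finset.mem_biUnion, Option.mem_def,
    Option.some.injEq, forall_eq']
  exact ⟨l, hl, TM2.stmts₁_self⟩

theorem none_mem (c : ToPartrec.Code) : none ∈ TM2.stmts program (codeSupp c Cont'.halt) := by
  simp [TM2.stmts]

theorem next_mem (c : ToPartrec.Code) (q : State) (hq : q ∈ states c) (a : Fin 5) :
    machine.next q a ∈ states c := by
  rcases q with ⟨(_ | q), s⟩
  · exact hq
  · change some q ∈ TM2.stmts program _ at hq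
    cases q with
    | push k f q =>
      exact TM2.stmts_trans (by simp [TM2.stmts₁, TM2.stmts₁_self]) hq
    | peek k f q =>
      exact TM2.stmts_trans (by simp [TM2.stmts₁, TM2.stmts₁_self]) hq
    | pop k f q =>
      exact TM2.stmts_trans (by simp [TM2.stmts₁, TM2.stmts₁_self]) hq
    | load f q =>
      exact TM2.stmts_trans (by simp [TM2.stmts₁, TM2.stmts₁_self]) hq
    | branch f q₁ q₂ =>
      refine TM2.stmts_trans (q₁ := cond (f s) q₁ q₂) ?_ hq
      cases f s <;> simp [TM2.stmts₁, TM2.stmts₁_self]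
    | goto l =>
      have := @TM2.stmts_supportsStmt _ _ _ _ ⟨trNormal c Cont'.halt⟩ _ _ _
        (tr_supports c Cont'.halt) hq
      exact some_program_mem (this s)
    | halt => exact none_mem c

/-- The number coding the input stack of the stack machine on input `2 ^ z`. -/
def input : ℕ → ℕ
  | 0 => 5 * 2 + 4
  | z + 1 => 5 * input z + 3

theorem primrec_input : Primrec input := by
  have : Primrec fun z : ℕ => Nat.rec (motive := fun _ => ℕ) (5 * 2 + 4)
      (fun _ r => 5 * r + 3) z :=
    Primrec.nat_rec₁ _ (Primrec.nat_add.comp (Primrec.nat_mul.comp (Primrec.const 5)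
      Primrec.snd) (Primrec.const 3)).to₂
  refine this.of_eq fun z => ?_
  induction z with
  | zero => rfl
  | succ z ih => simp only [input, ← ih]

theorem stackNum_two_pow (z : ℕ) : stackNum (trList [2 ^ z]) = input z := by
  have key : stackNum (trNat (2 ^ z) ++ [.cons]) = input z := by
    induction z with
    | zero => rfl
    | succ z ih =>
      have : trNat (2 ^ (z + 1)) = .bit0 :: trNat (2 ^ z) := by
        rw [trNat, trNat, ← Num.ofNat'_eq, ← Num.ofNat'_eq, pow_succ',
          ← Nat.bit_false_apply, Num.ofNat'_bit]
        have hne : Num.ofNat' (2 ^ z) ≠ 0 := by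
          rw [Num.ofNat'_eq]
          intro h0
          have := congrArg (fun n : Num => (n : ℕ)) h0
          rw [Num.to_of_nat] at this
          exact absurd this (by positivity)
        generalize Num.ofNat' (2 ^ z) = m at hne
        cases m with
        | zero => exact absurd rfl hne
        | pos p => rfl
      rw [this, List.cons_append, stackNum, ih]
      rfl
  exact key

theorem eval_eq (c : ToPartrec.Code) (v : List ℕ) :
    StateTransition.eval (TM2.step program) (init c v) = (ToPartrec.Code.eval c v).map halt :=
  tr_eval c v

/-- Every recursively enumerable set of natural numbers is decided by the invariant sets of a
finite digit machine. -/
theorem exists_digitMachine {S : ℕ → Prop} (hS : REPred S) :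
    ∃ (Q K : Type) (_ : Finite Q) (_ : Finite K) (_ : DecidableEq K) (M : DigitMachine Q K)
      (h q₀ : Q) (i₀ : K) (R : ℕ → ℕ), Primrec R ∧ ∀ z,
        (S z → ∀ C, M.Invariant C → (h, 0) ∈ C → (q₀, Pi.single i₀ (R z : ℤ)) ∈ C) ∧
        (¬ S z → ∃ C, M.Invariant C ∧ (h, 0) ∈ C ∧ (q₀, Pi.single i₀ (R z : ℤ)) ∉ C) := by
  let L : ℕ → ℕ := fun x => Nat.findGreatest (fun z => 2 ^ z = x) x
  have hL : Primrec L := by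
    refine Primrec.nat_findGreatest Primrec.id ?_
    exact Primrec.eq.comp ((Primrec₂.unpaired'.1 Nat.Primrec.pow).comp (Primrec.const 2)
      Primrec.snd)
      Primrec.fst
  have hL2 : ∀ z, L (2 ^ z) = z := fun z => by
    refine (Nat.findGreatest_eq_iff).2 ⟨Nat.lt_two_pow_self.le, fun _ => rfl, ?_⟩
    intro n hn _ h
    exact absurd (Nat.pow_right_injective le_rfl h) hn.ne'
  have hp : Partrec fun x : ℕ => Part.assert (S (L x)) fun _ => Part.some 0 :=
    ((hS.comp hL.to_comp).map (Computable.const 0).to₂).of_eq fun x => by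
      ext; simp [eq_comm]
  obtain ⟨c, hc⟩ := ToPartrec.Code.exists_code (Nat.Partrec'.part_iff₁.2 hp)
  let c' := ToPartrec.Code.comp ToPartrec.Code.nil c
  have hc' : ∀ z, (c'.eval [2 ^ z] : Part (List ℕ)) = Part.assert (S z) fun _ => Part.some [] := by
    intro z
    have h₁ : c.eval [2 ^ z] = (Part.assert (S (L (2 ^ z))) fun _ => Part.some 0).map
        fun a : ℕ => [a] := hc (2 ^ z ::ᵥ List.Vector.nil)
    have h₂ : c'.eval [2 ^ z] = (c.eval [2 ^ z]).bind fun _ => Part.some [] :=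
      congrArg (Part.bind (c.eval [2 ^ z])) (funext ToPartrec.Code.nil_eval)
    rw [h₂, h₁, hL2, Part.bind_map]
    ext w
    simp
  let M := machine.restrict (states c') (next_mem c')
  let h : states c' := ⟨(none, none), none_mem c'⟩
  let q₀ : states c' := ⟨(some (program (trNormal c' Cont'.halt)), none),
    some_program_mem (codeSupp_self _ _ (trStmts₁_self _))⟩
  have hinit : ∀ z, (((q₀ : State), Pi.single K'.main ((input z : ℕ) : ℤ)) :
      State × (K' → ℤ)) = embed (init c' [2 ^ z]) := by
    intro z
    refine Prod.ext rfl (funext fun k => ?_)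
    cases k <;> simp [embed, init, ← stackNum_two_pow, stackNum]
  have hhalt : (((h : State), 0) : State × (K' → ℤ)) = embed (halt []) := by
    refine Prod.ext rfl (funext fun k => ?_)
    cases k <;> simp [embed, halt, stackNum, trList]
  refine ⟨states c', K', inferInstance, Finite.of_injective (β := Fin 4)
    (fun | .main => 0 | .rev => 1 | .aux => 2 | .stack => 3) ?_, inferInstance, M, h, q₀, .main,
    input, primrec_input, fun z => ⟨fun hz C hC hh => ?_, fun hz => ?_⟩⟩
  · rintro (_ | _ | _ | _) (_ | _ | _ | _) hij <;> simp_all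
  · have hmem : halt [] ∈ StateTransition.eval (TM2.step program) (init c' [2 ^ z]) := by
      rw [eval_eq, hc']
      exact Part.mem_map _ (Part.mem_assert hz (Part.mem_some _))
    obtain ⟨n, hn⟩ := exists_iterate_of_reaches (StateTransition.mem_eval.1 hmem).1
    rw [hC.mem_iterate n]
    have := machine.restrict_iterate (next_mem c') n (q₀, Pi.single .main ((input z : ℕ) : ℤ))
    rw [hinit, hn, ← hhalt] at this
    rwa [show M.run^[n] (q₀, Pi.single .main ((input z : ℕ) : ℤ)) = (h, 0) from
      Prod.ext (Subtype.ext (congrArg (fun y => y.1) this)) (congrArg (fun y => y.2) this)]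
  · refine ⟨{y | ∃ n, M.run^[n] y = (h, 0)}, M.invariant_reaches ?_, ⟨0, rfl⟩, ?_⟩
    · have := machine.restrict_run (next_mem c') h 0
      rw [run_halted none 0] at this
      exact Prod.ext (Subtype.ext (congrArg (fun y => y.1) this)) (congrArg (fun y => y.2) this)
    · rintro ⟨n, hn⟩
      have := machine.restrict_iterate (next_mem c') n (q₀, Pi.single .main ((input z : ℕ) : ℤ))
      rw [hinit] at this
      have hd := eval_dom_of_halted n (init c' [2 ^ z])
        (by rw [← this]; exact congrArg (fun y => y.1.1.1) hn)
      rw [eval_eq, hc'] at hd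
      exact hz hd.1

end StackDigits

end

section

open Function Cardinal

/-- Two maps with equinumerous fibres differ by an equivalence, which may be chosen to respect
base points. -/
theorem exists_equiv_of_fibers {A B Y : Type} (f : A → Y) (g : B → Y)
    (h : ∀ y, Nonempty ({a // f a = y} ≃ {b // g b = y})) {a₀ : A} {b₀ : B} (h₀ : f a₀ = g b₀) :
    ∃ e : A ≃ B, (∀ a, g (e a) = f a) ∧ e a₀ = b₀ := by
  classical
  let e₁ : A ≃ B := Equiv.ofFiberEquiv fun y => (h y).some
  have h₁ : ∀ a, g (e₁ a) = f a := fun a => Equiv.ofFiberEquiv_map _ a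
  refine ⟨e₁.trans (Equiv.swap (e₁ a₀) b₀), fun a => ?_, by simp⟩
  rw [Equiv.trans_apply, Equiv.swap_apply_def]
  split_ifs with h2 h3
  · rw [← h₀, ← h₁ a, h2, h₁]
  · rw [h₁, h₀, ← h3, h₁]
  · exact h₁ a

namespace PermModel

variable (Q K : Type)

/-- Labels of the orbits in the permutation model: a set of configurations together with an
auxiliary coordinate making all fibres large. -/
abbrev Label : Type := Set (Q × (K → ℤ)) × Set ((Q × (K → ℤ)) ⊕ ℕ)

/-- The set on which the permutation model acts. -/
abbrev Point : Type := Label Q K × (K → ℤ) × Bool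

variable {Q K} [DecidableEq K]

/-- Translation of the register `i`. -/
def shift (i : K) : Equiv.Perm (Point Q K) where
  toFun y := (y.1, y.2.1 - Pi.single i 1, y.2.2)
  invFun y := (y.1, y.2.1 + Pi.single i 1, y.2.2)
  left_inv y := by simp
  right_inv y := by simp

theorem shift_pow (i : K) (n : ℕ) (y : Point Q K) :
    (shift i ^ n) y = (y.1, y.2.1 - Pi.single i (n : ℤ), y.2.2) := by
  induction n generalizing y with
  | zero => simp
  | succ n ih =>
    rw [pow_succ, Equiv.Perm.mul_apply, ih]
    simp only [shift, Equiv.coe_fn_mk, sub_sub, ← Pi.single_add]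
    push_cast
    rw [add_comm]

theorem shift_pow_inv (i : K) (n : ℕ) (y : Point Q K) :
    (shift i ^ n)⁻¹ y = (y.1, y.2.1 + Pi.single i (n : ℤ), y.2.2) := by
  rw [Equiv.Perm.inv_eq_iff_eq, shift_pow]
  simp

open Classical in
/-- The sign of a configuration with respect to a label. -/
noncomputable def sign (P : Prop) (b : Bool) : Bool := if P then b else !b

theorem sign_eq_self {P : Prop} {b : Bool} : sign P b = b ↔ P := by
  unfold sign
  split_ifs with h <;> simp [h]

/-- The involution exchanging the signs of the configurations in state `q` outside the label. -/
noncomputable def flip (q : Q) : Equiv.Perm (Point Q K) :=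
  Involutive.toPerm (fun y => (y.1, y.2.1, sign ((q, y.2.1) ∈ y.1.1) y.2.2)) fun y => by
    dsimp only [sign]
    split_ifs <;> simp

theorem conj_flip (q : Q) (i : K) (n : ℕ) (y : Point Q K) :
    (shift i ^ n * flip q * (shift i ^ n)⁻¹ : Equiv.Perm (Point Q K)) y =
      (y.1, y.2.1, sign ((q, y.2.1 + Pi.single i (n : ℤ)) ∈ y.1.1) y.2.2) := by
  rw [Equiv.Perm.mul_apply, Equiv.Perm.mul_apply, shift_pow_inv, shift_pow]
  change (y.1, y.2.1 + Pi.single i (n : ℤ) - Pi.single i (n : ℤ), _) = _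
  rw [add_sub_cancel_right]
  rfl

/-- Writing the register `i` in base `m`. -/
def chart (i : K) (m : ℕ) (hm : 0 < m) :
    (Label Q K × Fin m) × (K → ℤ) × Bool ≃ Point Q K where
  toFun y := (y.1.1, update y.2.1 i (m * y.2.1 i + (y.1.2 : ℕ)), y.2.2)
  invFun y := ((y.1, ⟨(y.2.1 i % m).toNat, by
    have := Int.emod_lt_of_pos (y.2.1 i) (by exact_mod_cast hm : (0 : ℤ) < m)
    omega⟩), update y.2.1 i (y.2.1 i / m), y.2.2)
  left_inv := by
    rintro ⟨⟨l, s⟩, v, b⟩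
    have hm' : (0 : ℤ) < m := by exact_mod_cast hm
    have h1 : ((m : ℤ) * v i + (s : ℕ)) % m = (s : ℕ) := by
      rw [Int.mul_add_emod_self_left]
      exact Int.emod_eq_of_lt (by positivity) (by exact_mod_cast s.2)
    have h2 : ((m : ℤ) * v i + (s : ℕ)) / m = v i := by
      rw [Int.mul_add_ediv_left _ _ hm'.ne', Int.ediv_eq_zero_of_lt (by positivity)
        (by exact_mod_cast s.2), add_zero]
    simp [h1, h2]
  right_inv := by
    rintro ⟨l, v, b⟩
    have hm' : (0 : ℤ) < m := by exact_mod_cast hm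
    have h1 : (((v i % m).toNat : ℕ) : ℤ) = v i % m :=
      Int.toNat_of_nonneg (Int.emod_nonneg _ hm'.ne')
    simp [h1, Int.mul_ediv_add_emod]

/-- The type of a label relative to a state and a base expansion. -/
def labelType (q : Q) (i : K) (m c : ℕ) (y : Label Q K × Fin m) : Set (K → ℤ) :=
  {w | (q, update w i (m * w i + (y.2 : ℕ) + c)) ∈ y.1.1}

theorem mk_fiber (q : Q) (i : K) (m c : ℕ) (hm : 0 < m) (Y : Set (K → ℤ)) :
    #{y : Label Q K × Fin m // labelType q i m c y = Y} = #(Set ((Q × (K → ℤ)) ⊕ ℕ)) := by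
  have hinf : ℵ₀ ≤ #(Set ((Q × (K → ℤ)) ⊕ ℕ)) := aleph0_le_mk _
  apply le_antisymm
  · refine (mk_subtype_le _).trans ?_
    have h1 : #(Set (Q × (K → ℤ))) ≤ #(Set ((Q × (K → ℤ)) ⊕ ℕ)) :=
      mk_le_of_injective (Set.image_injective.2 Sum.inl_injective)
    have h2 : #(Fin m) ≤ #(Set ((Q × (K → ℤ)) ⊕ ℕ)) := (mk_le_aleph0).trans hinf
    rw [mk_prod, mk_prod]
    simp only [lift_id]
    calc _ ≤ #(Set ((Q × (K → ℤ)) ⊕ ℕ)) * #(Set ((Q × (K → ℤ)) ⊕ ℕ)) *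
          #(Set ((Q × (K → ℤ)) ⊕ ℕ)) := by gcongr
      _ = _ := by rw [mul_eq_self hinf, mul_eq_self hinf]
  · let P : Set (Q × (K → ℤ)) :=
      {z | z.1 = q ∧ ∃ w ∈ Y, z.2 = update w i (m * w i + ((0 : ℕ) : ℤ) + c)}
    refine mk_le_of_injective (f := fun J => ⟨((P, J), ⟨0, hm⟩), ?_⟩) ?_
    · ext w
      simp only [labelType, P, Set.mem_ofPred_eq, true_and]
      constructor
      · rintro ⟨w', hw', h⟩
        have : w = w' := by
          ext j
          by_cases hj : j = i
          · subst hj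
            have := congrFun h j
            simpa [hm.ne'] using this
          · have := congrFun h j
            simpa [hj] using this
        rwa [this]
      · exact fun hw => ⟨w, hw, rfl⟩
    · intro J J' h
      simpa using h

variable (M : DigitMachine Q K)

theorem exists_rule_equiv {C : Set (Q × (K → ℤ))} (hC : M.Invariant C) (q : Q) (a : Fin 5) :
    ∃ e : Label Q K × Fin 5 ≃ Label Q K × Fin (M.mul q a),
      (∀ y, labelType (M.next q a) (M.coord q) (M.mul q a) (M.add q a) (e y) =
        labelType q (M.coord q) 5 a y) ∧
      e ((C, ∅), 0) = ((C, ∅), ⟨0, M.mul_pos q a⟩) := by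
  refine exists_equiv_of_fibers _ _ (fun Y => ?_) ?_
  · rw [← Cardinal.eq, mk_fiber _ _ _ _ (by norm_num), mk_fiber _ _ _ _ (M.mul_pos q a)]
  · ext w
    have := hC q a (w (M.coord q)) w
    simpa [labelType] using this

theorem chart_shift (i : K) (m : ℕ) (hm : 0 < m) (y : Label Q K × Fin m) (w : K → ℤ) (b : Bool) :
    (shift i ^ m) (chart i m hm (y, w, b)) = chart i m hm (y, w - Pi.single i 1, b) := by
  rw [shift_pow]
  simp only [chart, Equiv.coe_fn_mk, Prod.mk.injEq, true_and, and_true]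
  ext j
  by_cases hj : j = i
  · subst hj
    simp
    ring
  · simp [hj]

theorem chart_shift_of_ne {i j : K} (hij : j ≠ i) (m : ℕ) (hm : 0 < m) (y : Label Q K × Fin m)
    (w : K → ℤ) (b : Bool) :
    shift j (chart i m hm (y, w, b)) = chart i m hm (y, w - Pi.single j 1, b) := by
  simp only [shift, chart, Equiv.coe_fn_mk, Prod.mk.injEq, true_and, and_true]
  ext l
  by_cases hl : l = i
  · subst hl
    simp [hij.symm]
  · simp [hl]

theorem chart_flip (q : Q) (i : K) (m c : ℕ) (hm : 0 < m) (y : Label Q K × Fin m) (w : K → ℤ)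
    (b : Bool) :
    (shift i ^ c * flip q * (shift i ^ c)⁻¹ : Equiv.Perm (Point Q K)) (chart i m hm (y, w, b)) =
      chart i m hm (y, w, sign (w ∈ labelType q i m c y) b) := by
  rw [conj_flip]
  simp only [chart, Equiv.coe_fn_mk, labelType, Set.mem_ofPred_eq]
  congr 5
  ext j
  by_cases hj : j = i
  · subst hj; simp
  · simp [hj]

/-- An invariant set of configurations of a digit machine gives rise to a permutation
representation in which membership in the set is detected by a point stabilizer. -/
theorem exists_perm_model {C : Set (Q × (K → ℤ))} (hC : M.Invariant C) :
    ∃ (X : Type) (p : X) (x : K → Equiv.Perm X) (t : Q → Equiv.Perm X)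
      (r : Q → Fin 5 → Equiv.Perm X), (∀ i j, x i * x j = x j * x i) ∧
      (∀ q a, r q a * x (M.coord q) ^ 5 = x (M.coord q) ^ M.mul q a * r q a) ∧
      (∀ q a j, j ≠ M.coord q → r q a * x j = x j * r q a) ∧
      (∀ q a, r q a * (x (M.coord q) ^ (a : ℕ) * t q * (x (M.coord q) ^ (a : ℕ))⁻¹) =
        x (M.coord q) ^ M.add q a * t (M.next q a) * (x (M.coord q) ^ M.add q a)⁻¹ * r q a) ∧
      (∀ q a, r q a p = p) ∧
      ∀ q i (n : ℕ), (x i ^ n * t q * (x i ^ n)⁻¹) p = p ↔ (q, Pi.single i (n : ℤ)) ∈ C := by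
  choose e he he₀ using exists_rule_equiv M hC
  let r : Q → Fin 5 → Equiv.Perm (Point Q K) := fun q a =>
    ((chart (M.coord q) 5 (by norm_num)).symm.trans ((e q a).prodCongr (Equiv.refl _))).trans
      (chart (M.coord q) (M.mul q a) (M.mul_pos q a))
  have hr : ∀ q a (y : Label Q K × Fin 5) (w : K → ℤ) (b : Bool),
      r q a (chart (M.coord q) 5 (by norm_num) (y, w, b)) =
        chart (M.coord q) (M.mul q a) (M.mul_pos q a) (e q a y, w, b) := by
    intro q a y w b
    simp [r]
  refine ⟨Point Q K, ((C, ∅), 0, false), shift, flip, r, ?_, ?_, ?_, ?_, ?_, ?_⟩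
  · intro i j
    ext1 y
    simp only [Equiv.Perm.mul_apply, shift, Equiv.coe_fn_mk]
    rw [sub_right_comm]
  · intro q a
    ext1 y
    obtain ⟨⟨y, w, b⟩, rfl⟩ := (chart (M.coord q) 5 (by norm_num)).surjective y
    rw [Equiv.Perm.mul_apply, Equiv.Perm.mul_apply, hr, chart_shift, chart_shift, hr]
  · intro q a j hj
    ext1 y
    obtain ⟨⟨y, w, b⟩, rfl⟩ := (chart (M.coord q) 5 (by norm_num)).surjective y
    rw [Equiv.Perm.mul_apply, Equiv.Perm.mul_apply, hr, chart_shift_of_ne hj,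
      chart_shift_of_ne hj, hr]
  · intro q a
    ext1 y
    obtain ⟨⟨y, w, b⟩, rfl⟩ := (chart (M.coord q) 5 (by norm_num)).surjective y
    rw [Equiv.Perm.mul_apply (r q a), Equiv.Perm.mul_apply _ (r q a), hr, chart_flip, chart_flip,
      hr, he]
  · intro q a
    have : (((C, ∅), 0, false) : Point Q K) =
        chart (M.coord q) 5 (by norm_num) (((C, ∅), 0), 0, false) := by
      simp [chart]
    rw [this, hr, he₀]
    simp [chart]
  · intro q i n
    rw [conj_flip]
    simp [sign_eq_self]

end PermModel

end

section

open Monoid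
open scoped commutatorElement

namespace Monoid.CoprodI

variable {ι : Type*} {M : ι → Type*} [∀ i, Group (M i)]

theorem NeWord.prod_ne_one {i j : ι} (w : NeWord M i j) : w.prod ≠ 1 := by
  classical
  intro h
  have h' : w.toWord = Word.empty := by
    apply Word.equiv.symm.injective
    change w.toWord.prod = Word.empty.prod
    rw [Word.prod_empty]
    exact h
  exact w.toList_ne_nil (congrArg Word.toList h')

theorem NeWord.prod_pow_ne_one {i j : ι} (hij : i ≠ j) (w : NeWord M i j) (n : ℕ) :
    w.prod ^ (n + 1) ≠ 1 := by
  suffices h : ∃ w' : NeWord M i j, w'.prod = w.prod ^ (n + 1) by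
    obtain ⟨w', h⟩ := h
    exact h ▸ w'.prod_ne_one
  induction n with
  | zero => exact ⟨w, by simp⟩
  | succ n ih =>
    obtain ⟨w', h⟩ := ih
    exact ⟨w'.append hij.symm w, by rw [NeWord.append_prod, h, ← pow_succ]⟩

/-- The product in the free product of a list of elements of the factors. -/
def listProd (l : List (Σ i, M i)) : CoprodI M :=
  (l.map fun x => (of x.2 : CoprodI M)).prod

theorem listProd_append (l₁ l₂ : List (Σ i, M i)) :
    listProd (l₁ ++ l₂) = listProd l₁ * listProd l₂ := by
  simp [listProd]

theorem listProd_cons (x : Σ i, M i) (l : List (Σ i, M i)) :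
    listProd (x :: l) = of x.2 * listProd l := by
  simp [listProd]

theorem exists_listProd (a : CoprodI M) : ∃ l : List (Σ i, M i), listProd l = a := by
  induction a using CoprodI.induction_left with
  | one => exact ⟨[], rfl⟩
  | mul m x ih =>
    obtain ⟨l, rfl⟩ := ih
    exact ⟨⟨_, m⟩ :: l, listProd_cons _ _⟩

/-- A torsion element of a free product is conjugate to an element of a factor. -/
theorem exists_conj_of_pow_eq_one {a : CoprodI M} {n : ℕ} (ha : a ^ (n + 1) = 1) (i₀ : ι) :
    ∃ (i : ι) (m : M i) (g : CoprodI M), a = g * of m * g⁻¹ := by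
  classical
  have hex : ∃ N, ∃ l : List (Σ i, M i), l.length = N ∧ ∃ g, a = g * listProd l * g⁻¹ := by
    obtain ⟨l, hl⟩ := exists_listProd a
    exact ⟨_, l, rfl, 1, by simp [hl]⟩
  obtain ⟨l, hlen, g, hg⟩ := Nat.find_spec hex
  have hmin : ∀ (l' : List (Σ i, M i)) (g' : CoprodI M), a = g' * listProd l' * g'⁻¹ →
      l.length ≤ l'.length := by
    intro l' g' h
    rw [hlen]
    exact Nat.find_min' hex ⟨l', rfl, g', h⟩
  have hne : ∀ x ∈ l, x.2 ≠ 1 := by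
    rintro ⟨i, m⟩ hx hm
    obtain ⟨l₁, l₂, rfl⟩ := List.append_of_mem hx
    have := hmin (l₁ ++ l₂) g (by
      rw [hg, listProd_append, listProd_append, listProd_cons]
      simp only at hm
      simp [hm])
    simp at this
  have hchain : l.IsChain (fun x y => x.1 ≠ y.1) := by
    rw [List.isChain_iff_forall_rel_of_append_cons_cons]
    rintro ⟨i, m⟩ ⟨j, m'⟩ l₁ l₂ hl hij
    simp only at hij
    subst hij
    have := hmin (l₁ ++ ⟨i, m * m'⟩ :: l₂) g (by
      rw [hg, hl, listProd_append, listProd_append, listProd_cons, listProd_cons, listProd_cons]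
      simp [mul_assoc])
    simp [hl] at this
  rcases l with _ | ⟨x, l⟩
  · exact ⟨i₀, 1, 1, by simp [hg, listProd]⟩
  rcases List.eq_nil_or_concat l with rfl | ⟨l, y, rfl⟩
  · exact ⟨x.1, x.2, g, by rw [hg, listProd_cons]; simp [listProd]⟩
  exfalso
  have hxy : x.1 ≠ y.1 := by
    obtain ⟨i, m⟩ := x
    obtain ⟨j, m'⟩ := y
    intro hij
    simp only at hij
    subst hij
    have := hmin (⟨i, m' * m⟩ :: l) (g * (of m')⁻¹) (by
      rw [hg, listProd_cons, List.concat_eq_append, listProd_append, listProd_cons, listProd_cons]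
      simp [listProd, mul_assoc])
    simp at this
  let w : Word M := ⟨x :: l.concat y, hne, hchain⟩
  obtain ⟨i, j, w', hw'⟩ := NeWord.of_word w fun h => by
    have := congrArg Word.toList h
    simp [w, Word.empty] at this
  have hL : w'.toList = x :: (l ++ [y]) := by
    have := congrArg Word.toList hw'
    simpa [w, NeWord.toWord] using this
  have hi : x.1 = i := by
    have := w'.toList_head?
    rw [hL] at this
    simp only [List.head?_cons, Option.some.injEq] at this
    rw [this]
  have hj : y.1 = j := by
    have := w'.toList_getLast?
    rw [hL, ← List.cons_append, List.getLast?_concat] at this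
    simp only [Option.some.injEq] at this
    rw [this]
  refine w'.prod_pow_ne_one (hi ▸ hj ▸ hxy) n ?_
  have hprod : w'.prod = listProd (x :: l.concat y) := by
    rw [NeWord.prod, hw']
    rfl
  have : a ^ (n + 1) = g * listProd (x :: l.concat y) ^ (n + 1) * g⁻¹ := by
    rw [hg, conj_pow]
  rw [ha, ← hprod] at this
  rw [eq_comm, mul_inv_eq_one, mul_eq_left] at this
  exact this

/-- The family of two types indexed by the Booleans. -/
abbrev PairFam (A B : Type) : Bool → Type
  | true => A
  | false => B

instance (A B : Type) [Group A] [Group B] : ∀ b, Group (PairFam A B b)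
  | true => inferInstanceAs (Group A)
  | false => inferInstanceAs (Group B)

end Monoid.CoprodI

open Monoid.CoprodI

/-- A torsion element of a binary free product dies in one of the factors. -/
theorem Monoid.Coprod.fst_eq_one_or_snd_eq_one {A B : Type} [Group A] [Group B]
    {a : Coprod A B} {n : ℕ} (ha : a ^ (n + 1) = 1) : Coprod.fst a = 1 ∨ Coprod.snd a = 1 := by
  let f : Coprod A B →* CoprodI (PairFam A B) :=
    Coprod.lift (of (M := PairFam A B) (i := true)) (of (M := PairFam A B) (i := false))
  let f' : CoprodI (PairFam A B) →* Coprod A B :=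
    CoprodI.lift fun b => match b with
      | true => (Coprod.inl : A →* Coprod A B)
      | false => (Coprod.inr : B →* Coprod A B)
  have hf : f'.comp f = MonoidHom.id _ := by
    apply Coprod.hom_ext
    · ext x
      simp [f, f']
    · ext x
      simp [f, f']
  obtain ⟨i, m, g, h⟩ := exists_conj_of_pow_eq_one (a := f a) (n := n)
    (by rw [← map_pow, ha, map_one]) true
  have h' : a = f' g * f' (of m) * (f' g)⁻¹ := by
    rw [← map_inv, ← map_mul, ← map_mul, ← h]
    exact (DFunLike.congr_fun hf a).symm
  cases i
  · left
    rw [h']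
    simp [f']
  · right
    rw [h']
    simp [f']

/-- Any nontrivial element of a group has an infinite order commutator with some element of a
larger group. -/
theorem exists_commutator_infinite_order (H : Type) [Group H] :
    ∃ (Γ : Type) (_ : Group Γ) (f : H →* Γ) (s : Γ), ∀ h, h ≠ 1 →
      ∀ n : ℕ, ⁅f h, s⁆ ^ (n + 1) ≠ 1 := by
  refine ⟨CoprodI (PairFam H (Multiplicative ℤ)), inferInstance,
    of (M := PairFam H (Multiplicative ℤ)) (i := true),
    of (M := PairFam H (Multiplicative ℤ)) (i := false) (Multiplicative.ofAdd 1), ?_⟩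
  intro h hh n
  have hs : (Multiplicative.ofAdd (1 : ℤ)) ≠ 1 := by decide
  let w₁ : NeWord (PairFam H (Multiplicative ℤ)) true true := .singleton h hh
  let w₂ : NeWord (PairFam H (Multiplicative ℤ)) false false :=
    .singleton (Multiplicative.ofAdd (1 : ℤ)) hs
  have := NeWord.prod_pow_ne_one (by decide)
    (((w₁.append (by decide) w₂).append (by decide) w₁.inv).append (by decide) w₂.inv) n
  rw [NeWord.append_prod, NeWord.append_prod, NeWord.append_prod, NeWord.inv_prod,
    NeWord.inv_prod, NeWord.prod_singleton, NeWord.prod_singleton] at this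
  exact this

end

section

open Function
open scoped commutatorElement

namespace MachineGroup

/-- Generators of the group attached to a digit machine: register translations `x`, states `t`,
rules `r`, an involution `k` and two auxiliary letters `s` and `T`. -/
inductive Gen (Q K : Type)
  | x (i : K)
  | t (q : Q)
  | r (q : Q) (a : Fin 5)
  | k
  | s
  | T

instance (Q K : Type) [Finite Q] [Finite K] : Finite (Gen Q K) := by
  let f : Gen Q K → K ⊕ Q ⊕ (Q × Fin 5) ⊕ Fin 3
    | .x i => .inl i
    | .t q => .inr (.inl q)
    | .r q a => .inr (.inr (.inl (q, a)))
    | .k => .inr (.inr (.inr 0))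
    | .s => .inr (.inr (.inr 1))
    | .T => .inr (.inr (.inr 2))
  refine Finite.of_injective f fun a b h => ?_
  cases a <;> cases b <;> simp_all [f]

variable {Q K : Type} (M : DigitMachine Q K)

open FreeGroup in
/-- The relators attached to a digit machine with halting state `h`. -/
def rels (h : Q) : Set (FreeGroup (Gen Q K)) :=
  Set.range (fun p : K × K => ⁅of (Gen.x (Q := Q) p.1), of (Gen.x (Q := Q) p.2)⁆) ∪
  Set.range (fun p : Q × Fin 5 => of (Gen.r (K := K) p.1 p.2) * of (Gen.x (M.coord p.1)) ^ 5 *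
    (of (Gen.x (M.coord p.1)) ^ M.mul p.1 p.2 * of (Gen.r (K := K) p.1 p.2))⁻¹) ∪
  Set.range (fun p : {p : Q × Fin 5 × K // p.2.2 ≠ M.coord p.1} =>
    ⁅of (Gen.r (K := K) p.1.1 p.1.2.1), of (Gen.x (Q := Q) p.1.2.2)⁆) ∪
  Set.range (fun p : Q × Fin 5 => of (Gen.r (K := K) p.1 p.2) *
    (of (Gen.x (M.coord p.1)) ^ (p.2 : ℕ) *
      of (Gen.t p.1) * (of (Gen.x (M.coord p.1)) ^ (p.2 : ℕ))⁻¹) *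
    (of (Gen.x (M.coord p.1)) ^ M.add p.1 p.2 * of (Gen.t (M.next p.1 p.2)) *
      (of (Gen.x (M.coord p.1)) ^ M.add p.1 p.2)⁻¹ * of (Gen.r (K := K) p.1 p.2))⁻¹) ∪
  Set.range (fun p : Q × Fin 5 => ⁅of (Gen.k : Gen Q K), of (Gen.r (K := K) p.1 p.2)⁆) ∪
  {⁅of (Gen.k : Gen Q K), of (Gen.t (K := K) h)⁆, of (Gen.k : Gen Q K) * of (Gen.k : Gen Q K)}

theorem finite_rels [Finite Q] [Finite K] (h : Q) : (rels M h).Finite := by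
  unfold rels
  refine ((((((Set.finite_range _).union (Set.finite_range _)).union (Set.finite_range _)).union
    (Set.finite_range _)).union (Set.finite_range _)).union (Set.toFinite _))

/-- The relations attached to a digit machine. -/
structure Rel {Γ : Type*} [Group Γ] (h : Q) (f : Gen Q K → Γ) : Prop where
  comm_x : ∀ i j, f (.x i) * f (.x j) = f (.x j) * f (.x i)
  rule_x : ∀ q a, f (.r q a) * f (.x (M.coord q)) ^ 5 =
    f (.x (M.coord q)) ^ M.mul q a * f (.r q a)
  rule_x_of_ne : ∀ q a j, j ≠ M.coord q → f (.r q a) * f (.x j) = f (.x j) * f (.r q a)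
  rule_t : ∀ q a, f (.r q a) * (f (.x (M.coord q)) ^ (a : ℕ) * f (.t q) *
      (f (.x (M.coord q)) ^ (a : ℕ))⁻¹) =
    f (.x (M.coord q)) ^ M.add q a * f (.t (M.next q a)) *
      (f (.x (M.coord q)) ^ M.add q a)⁻¹ * f (.r q a)
  comm_k : ∀ q a, f .k * f (.r q a) = f (.r q a) * f .k
  comm_h : f .k * f (.t h) = f (.t h) * f .k
  k_sq : f .k * f .k = 1

theorem rel_iff {Γ : Type*} [Group Γ] (h : Q) (φ : FreeGroup (Gen Q K) →* Γ) :
    (∀ r ∈ rels M h, φ r = 1) ↔ Rel M h (fun g => φ (FreeGroup.of g)) := by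
  constructor
  · intro H
    simp only [rels, Set.mem_union, or_imp, forall_and, Set.forall_mem_range,
      Set.mem_insert_iff, Set.mem_singleton_iff, forall_eq, map_commutatorElement,
      commutatorElement_eq_one_iff_mul_comm, map_mul, map_inv, map_pow, mul_inv_eq_one] at H
    obtain ⟨⟨⟨⟨⟨h1, h2⟩, h3⟩, h4⟩, h5⟩, h6, h7⟩ := H
    exact ⟨fun i j => h1 (i, j), fun q a => h2 (q, a), fun q a j hj => h3 ⟨(q, a, j), hj⟩,
      fun q a => h4 (q, a), fun q a => h5 (q, a), h6, h7⟩
  · rintro ⟨h1, h2, h3, h4, h5, h6, h7⟩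
    simp only [rels, Set.mem_union, or_imp, forall_and, Set.forall_mem_range,
      Set.mem_insert_iff, Set.mem_singleton_iff, forall_eq, map_commutatorElement,
      commutatorElement_eq_one_iff_mul_comm, map_mul, map_inv, map_pow, mul_inv_eq_one]
    exact ⟨⟨⟨⟨⟨fun p => h1 p.1 p.2, fun p => h2 p.1 p.2⟩, fun p => h3 _ _ _ p.2⟩,
      fun p => h4 p.1 p.2⟩, fun p => h5 p.1 p.2⟩, h6, h7⟩

variable {M}

/-- The relations of a digit machine force the configurations whose letter commutes with `k` to
form an invariant set. -/
theorem Rel.exists_invariant [Finite K] [DecidableEq K] {Γ : Type*} [Group Γ] {h : Q}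
    {f : Gen Q K → Γ} (H : Rel M h f) :
    ∃ C, M.Invariant C ∧ (h, 0) ∈ C ∧ ∀ q i (n : ℕ), (q, Pi.single i (n : ℤ)) ∈ C →
      Commute (f .k) (f (.x i) ^ n * f (.t q) * (f (.x i) ^ n)⁻¹) := by
  have := Fintype.ofFinite K
  let e : ∀ i : K, Multiplicative ℤ →* Γ := fun i => zpowersHom Γ (f (.x i))
  have hcomm : Pairwise fun i j => ∀ m n, Commute (e i m) (e j n) := fun i j _ m n =>
    (Commute.zpow_zpow (H.comm_x i j) _ _)
  let X : (K → ℤ) → Γ := fun v =>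
    MonoidHom.noncommPiCoprod e hcomm fun i => Multiplicative.ofAdd (v i)
  have hX_add : ∀ u v, X (u + v) = X u * X v := fun u v => by
    rw [← map_mul]
    rfl
  have hX_zero : X 0 = 1 := map_one (MonoidHom.noncommPiCoprod e hcomm)
  have hX_single : ∀ i (n : ℤ), X (Pi.single i n) = f (.x i) ^ n := fun i n => by
    have : (fun j => Multiplicative.ofAdd ((Pi.single i n : K → ℤ) j)) =
        Pi.mulSingle i (Multiplicative.ofAdd n) := by
      ext j
      by_cases hj : j = i
      · subst hj; simp
      · simp [hj]
    change MonoidHom.noncommPiCoprod e hcomm (fun j => Multiplicative.ofAdd _) = _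
    rw [this, MonoidHom.noncommPiCoprod_mulSingle]
    rfl
  have hX_update : ∀ i v (n : ℤ), X (update v i n) = X (update v i 0) * f (.x i) ^ n := by
    intro i v n
    rw [← hX_single, ← hX_add]
    congr 1
    ext j
    by_cases hj : j = i
    · subst hj; simp
    · simp [hj]
  have hrX : ∀ q a v, Commute (f (.r q a)) (X (update v (M.coord q) 0)) := by
    intro q a v
    refine Finset.noncommProd_commute _ _ (fun a _ b _ hab => hcomm hab _ _) _ fun j _ => ?_
    by_cases hj : j = M.coord q
    · subst hj
      simp
    · exact Commute.zpow_right (H.rule_x_of_ne q a j hj) _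
  refine ⟨{y | Commute (f .k) (X y.2 * f (.t y.1) * (X y.2)⁻¹)}, ?_, ?_, ?_⟩
  · intro q a u v
    have key : f (.r q a) * (X (update v (M.coord q) (5 * u + (a : ℕ))) * f (.t q) *
        (X (update v (M.coord q) (5 * u + (a : ℕ))))⁻¹) * (f (.r q a))⁻¹ =
        X (update v (M.coord q) (M.mul q a * u + M.add q a)) * f (.t (M.next q a)) *
        (X (update v (M.coord q) (M.mul q a * u + M.add q a)))⁻¹ := by
      rw [hX_update, hX_update _ _ (_ + _)]
      generalize hY : X (update v (M.coord q) 0) = Y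
      have h1 := hrX q a v
      rw [hY] at h1
      have h2 := H.rule_x q a
      have h3 := H.rule_t q a
      have h4 : ∀ g, MulAut.conj (f (.r q a)) g = f (.r q a) * g * (f (.r q a))⁻¹ := fun g => rfl
      have h1' : MulAut.conj (f (.r q a)) Y = Y := by rw [h4, h1.eq, mul_inv_cancel_right]
      have h2' : MulAut.conj (f (.r q a)) (f (.x (M.coord q)) ^ 5) =
        f (.x (M.coord q)) ^ M.mul q a := by rw [h4, h2, mul_inv_cancel_right]
      have h3' := (h4 (f (.x (M.coord q)) ^ (a : ℕ) * f (.t q) *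
        (f (.x (M.coord q)) ^ (a : ℕ))⁻¹)).trans (by rw [h3, mul_inv_cancel_right])
      rw [← h4]
      have e1 : Y * f (.x (M.coord q)) ^ (5 * u + (a : ℕ)) * f (.t q) *
          (Y * f (.x (M.coord q)) ^ (5 * u + (a : ℕ)))⁻¹ =
          Y * (f (.x (M.coord q)) ^ 5) ^ u * (f (.x (M.coord q)) ^ (a : ℕ) * f (.t q) *
        (f (.x (M.coord q)) ^ (a : ℕ))⁻¹) * (Y * (f (.x (M.coord q)) ^ 5) ^ u)⁻¹ := by
        rw [zpow_add, zpow_mul, zpow_natCast]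
        have : f (.x (M.coord q)) ^ (5 : ℤ) = f (.x (M.coord q)) ^ 5 := by norm_cast
        rw [this]
        group
      have e2 : Y * f (.x (M.coord q)) ^ (M.mul q a * u + (M.add q a : ℕ)) *
          f (.t (M.next q a)) * (Y * f (.x (M.coord q)) ^ (M.mul q a * u + (M.add q a : ℕ)))⁻¹ =
          Y * (f (.x (M.coord q)) ^ M.mul q a) ^ u * (f (.x (M.coord q)) ^ M.add q a *
          f (.t (M.next q a)) * (f (.x (M.coord q)) ^ M.add q a)⁻¹) *
          (Y * (f (.x (M.coord q)) ^ M.mul q a) ^ u)⁻¹ := by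
        rw [zpow_add, zpow_mul, zpow_natCast, zpow_natCast]
        group
      rw [e1, e2, map_mul, map_mul, map_mul, h3', map_inv, map_mul, map_zpow, h1', h2']
    have hk : f (.r q a) * f .k * (f (.r q a))⁻¹ = f .k := by
      rw [← H.comm_k, mul_inv_cancel_right]
    simp only [Set.mem_ofPred_eq]
    rw [← key]
    conv_rhs => rw [← hk]
    exact (Commute.conj_iff _).symm
  · simp only [Set.mem_ofPred_eq, hX_zero]
    simpa using (show Commute _ _ from H.comm_h)
  · intro q i n hn
    simpa [hX_single] using hn

/-- The commutator word which detects whether a configuration is reached. -/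
def omega : FreeGroup (Gen Q K) :=
  ⁅⁅FreeGroup.of (Gen.k : Gen Q K), FreeGroup.of (Gen.T : Gen Q K)⁆,
  FreeGroup.of (Gen.s : Gen Q K)⁆

/-- The relator declaring `T` to be the letter of the configuration with state `q` and value `n`
in register `i`. -/
def inputRel (i : K) (q : Q) (n : ℕ) : FreeGroup (Gen Q K) :=
  FreeGroup.of (Gen.x i) ^ n * FreeGroup.of (Gen.t q) * (FreeGroup.of (Gen.x i) ^ n)⁻¹ *
    (FreeGroup.of Gen.T)⁻¹

theorem exists_model [DecidableEq K] {h : Q} {C : Set (Q × (K → ℤ))}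
    (hC : M.Invariant C) (hh : (h, 0) ∈ C) {q₀ : Q} {i₀ : K} {n₀ : ℕ}
    (hq : (q₀, Pi.single i₀ (n₀ : ℤ)) ∉ C) :
    ∃ (Γ : Type) (_ : Group Γ) (φ : FreeGroup (Gen Q K) →* Γ), (∀ r ∈ rels M h, φ r = 1) ∧
      φ (inputRel i₀ q₀ n₀) = 1 ∧ ∀ n : ℕ, φ omega ^ (n + 1) ≠ 1 := by
  classical
  obtain ⟨X, p, x, t, r, h1, h2, h3, h4, h5, h6⟩ := PermModel.exists_perm_model M hC
  let ext : Equiv.Perm X →* Equiv.Perm (Option X) := MonoidHom.mk' Equiv.optionCongr fun a b => by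
    ext y
    cases y <;> simp
  let k : Equiv.Perm (Option X) := Equiv.swap (some p) none
  have hk : ∀ σ : Equiv.Perm X, k * ext σ = ext σ * k ↔ σ p = p := by
    intro σ
    have e1 : ext σ * k = Equiv.swap (some (σ p)) none * ext σ := by
      rw [Equiv.mul_swap_eq_swap_mul]
      rfl
    rw [e1, mul_left_inj]
    change Equiv.swap (some p) none = Equiv.swap (some (σ p)) none ↔ _
    constructor
    · intro he
      have := congrArg (fun σ : Equiv.Perm (Option X) => σ none) he
      simpa using this.symm
    · intro he
      rw [he]
  obtain ⟨Γ, _, ι, s, hs⟩ := exists_commutator_infinite_order (Equiv.Perm (Option X))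
  let T := x i₀ ^ n₀ * t q₀ * (x i₀ ^ n₀)⁻¹
  let f : Gen Q K → Γ
    | .x i => ι (ext (x i))
    | .t q => ι (ext (t q))
    | .r q a => ι (ext (r q a))
    | .k => ι k
    | .s => s
    | .T => ι (ext T)
  refine ⟨Γ, inferInstance, FreeGroup.lift f, ?_, ?_, ?_⟩
  · rw [rel_iff]
    simp only [FreeGroup.lift_apply_of]
    refine ⟨?_, ?_, ?_, ?_, ?_, ?_, ?_⟩
    · intro i j
      simp only [f, ← map_mul, h1 i j]
    · intro q a
      simp only [f, ← map_mul, ← map_pow, h2]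
    · intro q a j hj
      simp only [f, ← map_mul, h3 q a j hj]
    · intro q a
      simp only [f, ← map_mul, ← map_pow, ← map_inv, h4]
    · intro q a
      simp only [f, ← map_mul, (hk _).2 (h5 q a)]
    · simp only [f, ← map_mul]
      rw [(hk _).2]
      simpa using (h6 h i₀ 0).2 (by simpa using hh)
    · simp only [f, ← map_mul, k, Equiv.swap_mul_self, map_one]
  · simp [inputRel, f, T]
  · intro n
    have := hs ⁅k, ext T⁆ (by
      rw [Ne, commutatorElement_eq_one_iff_mul_comm, hk, h6]
      exact hq) n
    simpa [omega, f, map_commutatorElement] using this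

theorem omega_eq_one [Finite K] [DecidableEq K] {h : Q} {q₀ : Q} {i₀ : K} {n₀ : ℕ}
    (hC : ∀ C, M.Invariant C → (h, 0) ∈ C → (q₀, Pi.single i₀ (n₀ : ℤ)) ∈ C) {Γ : Type*} [Group Γ]
    (φ : FreeGroup (Gen Q K) →* Γ) (hφ : ∀ r ∈ rels M h, φ r = 1)
    (hT : φ (inputRel i₀ q₀ n₀) = 1) : φ omega = 1 := by
  obtain ⟨C, hC', hh, hk⟩ := ((rel_iff M h φ).1 hφ).exists_invariant
  have hc := hk _ _ _ (hC C hC' hh)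
  have hT' : φ (FreeGroup.of (Gen.x i₀)) ^ n₀ * φ (FreeGroup.of (Gen.t q₀)) *
      (φ (FreeGroup.of (Gen.x i₀)) ^ n₀)⁻¹ = φ (FreeGroup.of Gen.T) := by
    rw [← mul_inv_eq_one]
    simpa [inputRel] using hT
  rw [hT'] at hc
  rw [omega, map_commutatorElement, map_commutatorElement,
    commutatorElement_eq_one_iff_mul_comm.2 hc.eq, commutatorElement_one_left]

theorem omega_eq_one_of_k {Γ : Type*} [Group Γ] (φ : FreeGroup (Gen Q K) →* Γ)
    (hk : φ (FreeGroup.of Gen.k) = 1) : φ omega = 1 := by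
  rw [omega, map_commutatorElement, map_commutatorElement, hk, commutatorElement_one_left,
    commutatorElement_one_left]

end MachineGroup

end

section

open scoped commutatorElement

section StableLetter

open HNNExtension

theorem exists_stable_letter {B H : Type} [Group B] [Group H] (α β : H →* B)
    (hα : Function.Injective α) (hβ : Function.Injective β) :
    ∃ (L : Type) (_ : Group L) (ι : B →* L) (t : L), Function.Injective ι ∧
      (∀ h, t * ι (α h) * t⁻¹ = ι (β h)) ∧
      ∀ {X : Type} (j : FreeGroup X →* B), Function.Injective j → (∀ x h, j x = α h → x = 1) →
        (∀ x h, j x = β h → x = 1) →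
        ∃ ψ : FreeGroup (Option X) →* L, Function.Injective ψ ∧ ψ (FreeGroup.of none) = t ∧
          (∀ x, ψ (FreeGroup.of (some x)) = ι (j (FreeGroup.of x))) ∧
          ∀ y b, ψ y = ι b → ∃ x, j x = b ∧ y = FreeGroup.map some x := by
  let e : α.range ≃* β.range := (MonoidHom.ofInjective hα).symm.trans (MonoidHom.ofInjective hβ)
  have he : ∀ h, e ⟨α h, h, rfl⟩ = ⟨β h, h, rfl⟩ := fun h => by
    have : (⟨α h, h, rfl⟩ : α.range) = MonoidHom.ofInjective hα h := rfl
    rw [this, MulEquiv.trans_apply, MulEquiv.symm_apply_apply]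
    rfl
  refine ⟨HNNExtension B _ _ e, inferInstance, of, t, of_injective _, fun h => ?_, ?_⟩
  · have := equiv_eq_conj (φ := e) ⟨α h, h, rfl⟩
    rw [he] at this
    exact this.symm
  intro X j hj hjα hjβ
  let E := HNNExtension (FreeGroup X) ⊥ ⊥ (MulEquiv.refl _)
  let θ : E →* HNNExtension B _ _ e := lift (of.comp j) t fun a => by
    have := a.2
    rw [Subgroup.mem_bot] at this
    simp [this]
  have hθt : θ t = t := lift_t _ _ _
  have hθof : ∀ x, θ (of x) = of (j x) := lift_of _ _ _
  have key : ∀ (y : E) (b : B), θ y = of b → ∃ x, j x = b ∧ y = of x := by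
    intro y b hy
    obtain ⟨d⟩ := NormalWord.TransversalPair.nonempty (FreeGroup X) ⊥ ⊥
    obtain ⟨w, rfl⟩ : ∃ w : NormalWord d, w.prod (MulEquiv.refl _) = y :=
      ⟨y • NormalWord.empty, by rw [NormalWord.prod_smul, NormalWord.prod_empty, mul_one]⟩
    let w' : NormalWord.ReducedWord B α.range β.range :=
      { head := j w.head
        toList := w.toList.map fun p => (p.1, j p.2)
        chain := by
          rw [List.isChain_map]
          refine w.chain.imp fun p q hpq hp => hpq ?_
          have : p.2 = 1 := by
            rcases Int.units_eq_one_or p.1 with hu | hu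
            · rw [hu] at hp
              obtain ⟨h, hh⟩ := hp
              exact hjα _ h hh.symm
            · rw [hu] at hp
              obtain ⟨h, hh⟩ := hp
              exact hjβ _ h hh.symm
          rw [this]
          exact one_mem _ }
    have hw : w'.prod e = θ (w.prod (MulEquiv.refl _)) := by
      simp only [NormalWord.ReducedWord.prod, w', map_mul, hθof, map_list_prod, List.map_map]
      refine congrArg _ (congrArg List.prod (List.map_congr_left fun p _ => ?_))
      simp [hθof, hθt]
    have hn := ReducedWord.toList_eq_nil_of_mem_of_range e w' (hw ▸ hy ▸ ⟨b, rfl⟩)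
    have hn' : w.toList = [] := by simpa [w'] using hn
    have hy' : w.prod (MulEquiv.refl _) = of w.head := by
      simp [NormalWord.ReducedWord.prod, hn']
    refine ⟨w.head, of_injective e ?_, hy'⟩
    rw [← hy, hy', hθof]
  let μ : FreeGroup (Option X) →* E := FreeGroup.lift fun o => o.elim t fun x => of (FreeGroup.of x)
  let ν : E →* FreeGroup (Option X) := lift (FreeGroup.map some) (FreeGroup.of none) fun a => by
    have := a.2
    rw [Subgroup.mem_bot] at this
    simp [this]
  have hνt : ν t = FreeGroup.of none := lift_t _ _ _
  have hνof : ∀ x, ν (of x) = FreeGroup.map some x := lift_of _ _ _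
  have hνμ : ∀ y, ν (μ y) = y := fun y => by
    have : ν.comp μ = MonoidHom.id _ := by
      ext o
      cases o <;> simp [μ, hνt, hνof]
    exact DFunLike.congr_fun this y
  have hθ : ∀ y b, θ (μ y) = of b → ∃ x, j x = b ∧ y = FreeGroup.map some x := by
    intro y b hy
    obtain ⟨x, hx, hyx⟩ := key _ _ hy
    refine ⟨x, hx, ?_⟩
    rw [← hνμ y, hyx, hνof]
  refine ⟨θ.comp μ, ?_, by simp [μ, hθt], by simp [μ, hθof], hθ⟩
  rw [injective_iff_map_eq_one]
  intro y hy
  obtain ⟨x, hx, rfl⟩ := hθ y 1 (by simpa using hy)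
  rw [(injective_iff_map_eq_one j).1 hj x hx, map_one]

end StableLetter

namespace Killing

/-- Two copies of the generators `X` and three further letters. -/
inductive Gen (X : Type)
  | fst (x : X)
  | snd (x : X)
  | b
  | b'
  | c

instance (X : Type) [Finite X] : Finite (Gen X) := by
  let f : Gen X → X ⊕ X ⊕ Fin 3
    | .fst x => .inl x
    | .snd x => .inr (.inl x)
    | .b => .inr (.inr 0)
    | .b' => .inr (.inr 1)
    | .c => .inr (.inr 2)
  refine Finite.of_injective f fun x y h => ?_
  cases x <;> cases y <;> simp_all [f]

variable {X : Type}

/-- The word in the letters `fst`, `snd` which is forced to act on `c` by squaring. -/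
def witness (w : FreeGroup X) : FreeGroup (Gen X) :=
  FreeGroup.map Gen.fst w * FreeGroup.map Gen.snd w ^ 2

open FreeGroup in
/-- Relators which collapse the whole group as soon as the first copy of `w` becomes trivial. -/
def rels (w : FreeGroup X) : Set (FreeGroup (Gen X)) :=
  Set.range (fun p : X × X => ⁅of (Gen.fst p.1), of (Gen.snd p.2)⁆) ∪
  Set.range (fun x : X => of Gen.b * of (Gen.fst x) * (of Gen.b)⁻¹ *
    (of (Gen.fst x) * of (Gen.snd x))⁻¹) ∪
  Set.range (fun x : X => of Gen.b' * of (Gen.snd x) * (of Gen.b')⁻¹ *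
    (of (Gen.fst x) * of (Gen.snd x))⁻¹) ∪
  {of Gen.c * of Gen.b * (of Gen.c)⁻¹ * (of Gen.b')⁻¹,
    of Gen.c * of Gen.b' * (of Gen.c)⁻¹ * (of Gen.b * of Gen.b')⁻¹,
    witness w * of Gen.c * (witness w)⁻¹ * (of Gen.c ^ 2)⁻¹}

theorem finite_rels [Finite X] (w : FreeGroup X) : (rels w).Finite := by
  unfold rels
  exact ((((Set.finite_range _).union (Set.finite_range _)).union (Set.finite_range _)).union
    (Set.toFinite _))

/-- The relations `Killing.rels` for the images of the letters. -/
structure Rel {Γ : Type*} [Group Γ] (W : Γ) (f : Gen X → Γ) : Prop where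
  comm : ∀ x y, f (.fst x) * f (.snd y) = f (.snd y) * f (.fst x)
  conj_b : ∀ x, f .b * f (.fst x) * (f .b)⁻¹ = f (.fst x) * f (.snd x)
  conj_b' : ∀ x, f .b' * f (.snd x) * (f .b')⁻¹ = f (.fst x) * f (.snd x)
  conj_c_b : f .c * f .b * (f .c)⁻¹ = f .b'
  conj_c_b' : f .c * f .b' * (f .c)⁻¹ = f .b * f .b'
  conj_c : W * f .c * W⁻¹ = f .c ^ 2

theorem rel_iff {Γ : Type*} [Group Γ] (w : FreeGroup X) (φ : FreeGroup (Gen X) →* Γ) :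
    (∀ r ∈ rels w, φ r = 1) ↔ Rel (φ (witness w)) (fun g => φ (FreeGroup.of g)) := by
  constructor
  · intro H
    simp only [rels, Set.mem_union, or_imp, forall_and, Set.forall_mem_range,
      Set.mem_insert_iff, Set.mem_singleton_iff, forall_eq, map_commutatorElement,
      commutatorElement_eq_one_iff_mul_comm, map_mul, map_inv, map_pow, mul_inv_eq_one] at H
    obtain ⟨⟨⟨h1, h2⟩, h3⟩, h4, h5, h6⟩ := H
    exact ⟨fun i j => h1 (i, j), h2, h3, h4, h5, h6⟩
  · rintro ⟨h1, h2, h3, h4, h5, h6⟩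
    simp only [rels, Set.mem_union, or_imp, forall_and, Set.forall_mem_range,
      Set.mem_insert_iff, Set.mem_singleton_iff, forall_eq, map_commutatorElement,
      commutatorElement_eq_one_iff_mul_comm, map_mul, map_inv, map_pow, mul_inv_eq_one]
    exact ⟨⟨⟨fun p => h1 p.1 p.2, h2⟩, h3⟩, h4, h5, h6⟩

theorem eq_one_of_fst {Γ : Type*} [Group Γ] {w : FreeGroup X} (φ : FreeGroup (Gen X) →* Γ)
    (hφ : ∀ r ∈ rels w, φ r = 1) (hw : φ (FreeGroup.map Gen.fst w) = 1) (g : FreeGroup (Gen X)) :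
    φ g = 1 := by
  have H := (rel_iff w φ).1 hφ
  let φ₁ := φ.comp (FreeGroup.map Gen.fst)
  let φ₂ := φ.comp (FreeGroup.map Gen.snd)
  have hc : ∀ u v, Commute (φ₁ u) (φ₂ v) := by
    intro u v
    induction u using FreeGroup.induction_on with
    | C1 => simp
    | of x =>
      induction v using FreeGroup.induction_on with
      | C1 => simp
      | of y => simpa [φ₁, φ₂] using (show Commute _ _ from H.comm x y)
      | inv_of y h => rw [map_inv]; exact h.inv_right
      | mul u v hu hv => rw [map_mul]; exact hu.mul_right hv
    | inv_of y h => rw [map_inv]; exact h.inv_left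
    | mul u v hu hv => rw [map_mul]; exact hu.mul_left hv
  have hb : ∀ u, φ (FreeGroup.of Gen.b) * φ₁ u * (φ (FreeGroup.of Gen.b))⁻¹ = φ₁ u * φ₂ u := by
    have : (MulAut.conj (φ (FreeGroup.of Gen.b))).toMonoidHom.comp φ₁ =
        (φ₁.noncommCoprod φ₂ hc).comp ((MonoidHom.id _).prod (MonoidHom.id _)) := by
      ext x
      simpa [φ₁, φ₂] using H.conj_b x
    intro u
    simpa using DFunLike.congr_fun this u
  have hw' : φ (FreeGroup.map Gen.snd w) = 1 := by
    have := hb w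
    rw [show φ₁ w = 1 from hw] at this
    simpa [φ₂] using this.symm
  have hW : φ (witness w) = 1 := by simp [witness, hw, hw']
  have hc1 : φ (FreeGroup.of Gen.c) = 1 := by
    have := H.conj_c
    simpa [hW, sq] using this
  have hbb := H.conj_c_b
  have hbb' := H.conj_c_b'
  simp only [hc1, one_mul, inv_one, mul_one] at hbb hbb'
  have hb1 : φ (FreeGroup.of Gen.b) = 1 := by simpa using hbb'
  have hb1' : φ (FreeGroup.of Gen.b') = 1 := by rw [← hbb, hb1]
  have h2 : ∀ x, φ (FreeGroup.of (Gen.snd x)) = 1 := fun x => by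
    simpa [hb1] using H.conj_b x
  have h1 : ∀ x, φ (FreeGroup.of (Gen.fst x)) = 1 := fun x => by
    simpa [hb1'] using H.conj_b' x
  have : φ = 1 := by
    ext y
    cases y <;> simp [h1, h2, hb1, hb1', hc1]
  rw [this, MonoidHom.one_apply]

/-- The automorphism of the free group on two letters by which `c` acts. -/
def twist : MulAut (FreeGroup Bool) :=
  MonoidHom.toMulEquiv
    (FreeGroup.lift fun i => bif i then .of false * .of true else .of true)
    (FreeGroup.lift fun i => bif i then .of false else .of true * (.of false)⁻¹)
    (by ext i; cases i <;> simp) (by ext i; cases i <;> simp)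

/-- A group generated by two copies of `G` and the letters `b`, `b'`, in which `b`, `b'` and
the image of the witness freely generate a free group. -/
theorem exists_first_factor {G : Type} [Group G] {g : G} (hg : ∀ n : ℕ, g ^ (n + 1) ≠ 1) :
    ∃ (L : Type) (_ : Group L) (ι : G × G →* L) (b b' : L)
      (ψ : FreeGroup (Option (Option Unit)) →* L), Function.Injective ι ∧
      (∀ x, b * ι (x, 1) * b⁻¹ = ι (x, x)) ∧ (∀ x, b' * ι (1, x) * b'⁻¹ = ι (x, x)) ∧
      Function.Injective ψ ∧ ψ (.of none) = b' ∧ ψ (.of (some none)) = b ∧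
      ψ (.of (some (some ()))) = ι (g, g ^ 2) := by
  have hg' : ∀ n : ℤ, g ^ n = 1 → n = 0 := fun n hn => by
    have : ¬ IsOfFinOrder g := by
      rw [isOfFinOrder_iff_pow_eq_one]
      rintro ⟨n, hn, h⟩
      obtain ⟨m, rfl⟩ := Nat.exists_eq_succ_of_ne_zero hn.ne'
      exact hg m h
    exact injective_zpow_iff_not_isOfFinOrder.2 this (by simpa using hn)
  obtain ⟨L₁, _, ι₁, b, hι₁, hb, hL₁⟩ := exists_stable_letter (MonoidHom.inl G G)
    ((MonoidHom.id G).prod (MonoidHom.id G)) (fun x y h => by simpa using h)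
    (fun x y h => by simpa using h)
  obtain ⟨L₂, _, ι₂, b', hι₂, hb', hL₂⟩ := exists_stable_letter (ι₁.comp (MonoidHom.inr G G))
    (ι₁.comp ((MonoidHom.id G).prod (MonoidHom.id G)))
    (hι₁.comp fun x y h => by simpa using h) (hι₁.comp fun x y h => by simpa using h)
  let j : FreeGroup Unit →* G × G := FreeGroup.lift fun _ => (g, g ^ 2)
  have hj : ∀ x : FreeGroup Unit, ∃ n : ℤ, j x = (g ^ n, g ^ (2 * n)) ∧ (n = 0 → x = 1) :=
    fun x => by
      obtain ⟨n, rfl⟩ := FreeGroup.freeGroupUnitEquivInt.symm.surjective x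
      refine ⟨n, ?_, ?_⟩
      · change j (FreeGroup.of () ^ n) = _
        rw [map_zpow, zpow_mul]
        simp only [j, FreeGroup.lift_apply_of, Prod.pow_mk]
        norm_cast
      · rintro rfl
        exact zpow_zero (FreeGroup.of ())
  have hj₁ : ∀ x, j x = 1 → x = 1 := fun x hx => by
    obtain ⟨n, hn, h⟩ := hj x
    rw [hn, Prod.mk_eq_one] at hx
    exact h (hg' n hx.1)
  have hjl : ∀ x h, j x = (h, 1) → x = 1 := fun x h hx => by
    obtain ⟨n, hn, h⟩ := hj x
    rw [hn, Prod.mk_inj] at hx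
    have := hg' _ hx.2
    exact h (by omega)
  have hjr : ∀ x h, j x = (1, h) → x = 1 := fun x h hx => by
    obtain ⟨n, hn, h⟩ := hj x
    rw [hn, Prod.mk_inj] at hx
    exact h (hg' n hx.1)
  have hjd : ∀ x h, j x = (h, h) → x = 1 := fun x h hx => by
    obtain ⟨n, hn, h⟩ := hj x
    rw [hn, Prod.mk_inj] at hx
    refine h (hg' n ?_)
    have := hx.2.trans hx.1.symm
    rw [two_mul, zpow_add] at this
    simpa using this
  obtain ⟨ψ₁, hψ₁, hψ₁b, hψ₁w, hψ₁'⟩ :=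
    hL₁ j ((injective_iff_map_eq_one _).2 hj₁) hjl hjd
  obtain ⟨ψ₂, hψ₂, hψ₂b, hψ₂w, -⟩ := hL₂ ψ₁ hψ₁
    (fun y h hy => by
      obtain ⟨x, hx, rfl⟩ := hψ₁' _ _ hy
      rw [hjr x h hx, map_one])
    (fun y h hy => by
      obtain ⟨x, hx, rfl⟩ := hψ₁' _ _ hy
      rw [hjd x h hx, map_one])
  refine ⟨L₂, inferInstance, ι₂.comp ι₁, ι₂ b, b', ψ₂, hι₂.comp hι₁, fun x => ?_, hb', hψ₂, hψ₂b,
    ?_, ?_⟩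
  · simpa using congrArg ι₂ (hb x)
  · rw [hψ₂w, hψ₁b]
  · rw [hψ₂w, hψ₁w]
    simp [j]

/-- A group generated by `b`, `b'`, `c` and a further letter `v`, in which `b`, `b'` and `v`
freely generate a free group. -/
theorem exists_second_factor :
    ∃ (N : Type) (_ : Group N) (b b' c v : N) (χ : FreeGroup (Option (Option Unit)) →* N),
      c * b * c⁻¹ = b' ∧ c * b' * c⁻¹ = b * b' ∧ v * c * v⁻¹ = c ^ 2 ∧ Function.Injective χ ∧
      χ (.of none) = b' ∧ χ (.of (some none)) = b ∧ χ (.of (some (some ()))) = v := by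
  obtain ⟨N, _, κ, v, hκ, hv, hN⟩ := exists_stable_letter
    (SemidirectProduct.inr : _ →* FreeGroup Bool ⋊[zpowersHom _ twist] Multiplicative ℤ)
    (SemidirectProduct.inr.comp (powMonoidHom 2)) SemidirectProduct.inr_injective
    (SemidirectProduct.inr_injective.comp fun x y h => by
      have h' : 2 * x.toAdd = 2 * y.toAdd := by simpa using congrArg Multiplicative.toAdd h
      exact Multiplicative.toAdd.injective (by omega))
  have hinl : ∀ (x : FreeGroup Bool) (n : Multiplicative ℤ),
      (SemidirectProduct.inl x : FreeGroup Bool ⋊[zpowersHom _ twist] Multiplicative ℤ) =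
        SemidirectProduct.inr n → x = 1 :=
    fun x n h => congrArg SemidirectProduct.left h
  obtain ⟨χ, hχ, hχv, hχb, -⟩ := hN SemidirectProduct.inl
    SemidirectProduct.inl_injective hinl (fun x n h => hinl x _ h)
  let e : Option (Option Unit) → Option Bool
    | none => some true
    | some none => some false
    | some (some _) => none
  have he : Function.Injective e := by
    rintro (_ | _ | _) (_ | _ | _) h <;> first | rfl | cases h
  have hc : ∀ x, κ (SemidirectProduct.inr (.ofAdd 1)) * κ (SemidirectProduct.inl x) *
      (κ (SemidirectProduct.inr (.ofAdd 1)))⁻¹ = κ (SemidirectProduct.inl (twist x)) := fun x => by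
    rw [← map_inv, ← map_inv, ← map_mul, ← map_mul, ← SemidirectProduct.inl_aut]
    simp
  refine ⟨N, inferInstance, κ (SemidirectProduct.inl (.of false)),
    κ (SemidirectProduct.inl (.of true)), κ (SemidirectProduct.inr (.ofAdd 1)), v,
    χ.comp (FreeGroup.map e), ?_, ?_, ?_, hχ.comp (FreeGroup.map_injective he), ?_, ?_, ?_⟩
  · rw [hc]
    simp [twist]
  · rw [hc, show twist (.of true) = .of false * .of true by simp [twist], map_mul, map_mul]
  · rw [hv]
    simp [powMonoidHom]
  · simp [e, hχb]
  · simp [e, hχb]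
  · simp [e, hχv]

theorem exists_amalgam {H A B : Type} [Group H] [Group A] [Group B] {f : H →* A} {g : H →* B}
    (hf : Function.Injective f) (hg : Function.Injective g) :
    ∃ (Γ : Type) (_ : Group Γ) (ρ₁ : A →* Γ) (ρ₂ : B →* Γ), Function.Injective ρ₁ ∧
      ∀ y, ρ₁ (f y) = ρ₂ (g y) := by
  let Gs : Bool → Type := fun i => bif i then A else B
  let _ : ∀ i, Group (Gs i)
    | true => ‹Group A›
    | false => ‹Group B›
  let θ : ∀ i, H →* Gs i
    | true => f
    | false => g
  have hθ : ∀ i, Function.Injective (θ i)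
    | true => hf
    | false => hg
  exact ⟨Monoid.PushoutI θ, inferInstance, Monoid.PushoutI.of (φ := θ) true,
    Monoid.PushoutI.of (φ := θ) false, Monoid.PushoutI.of_injective hθ true, fun y =>
    (Monoid.PushoutI.of_apply_eq_base θ true y).trans
      (Monoid.PushoutI.of_apply_eq_base θ false y).symm⟩

theorem exists_model {G : Type} [Group G] {w : FreeGroup X} (φ : FreeGroup X →* G)
    (hw : ∀ n : ℕ, φ w ^ (n + 1) ≠ 1) :
    ∃ (Γ : Type) (_ : Group Γ) (ι : G →* Γ) (ψ : FreeGroup (Gen X) →* Γ), Function.Injective ι ∧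
      (∀ u, ψ (FreeGroup.map Gen.fst u) = ι (φ u)) ∧ ∀ r ∈ rels w, ψ r = 1 := by
  obtain ⟨L, _, ι, b, b', ψ, hι, hb, hb', hψ, hψb', hψb, hψw⟩ := exists_first_factor hw
  obtain ⟨N, _, p, p', c, v, χ, hp, hp', hv, hχ, hχb', hχb, hχv⟩ := exists_second_factor
  obtain ⟨Γ, _, ρ₁, ρ₂, hρ₁, hρ⟩ := exists_amalgam hψ hχ
  let f : Gen X → Γ
    | .fst x => ρ₁ (ι (φ (.of x), 1))
    | .snd x => ρ₁ (ι (1, φ (.of x)))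
    | .b => ρ₁ b
    | .b' => ρ₁ b'
    | .c => ρ₂ c
  have hfst : (FreeGroup.lift f).comp (FreeGroup.map Gen.fst) =
      (ρ₁.comp (ι.comp (MonoidHom.inl G G))).comp φ := by
    ext x
    simp [f]
  have hsnd : (FreeGroup.lift f).comp (FreeGroup.map Gen.snd) =
      (ρ₁.comp (ι.comp (MonoidHom.inr G G))).comp φ := by
    ext x
    simp [f]
  have hfst' := DFunLike.congr_fun hfst
  have hsnd' := DFunLike.congr_fun hsnd
  refine ⟨Γ, inferInstance, ρ₁.comp (ι.comp (MonoidHom.inl G G)),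
    FreeGroup.lift f, hρ₁.comp (hι.comp fun x y h => by simpa using h), hfst', ?_⟩
  rw [rel_iff]
  have hW : FreeGroup.lift f (witness w) = ρ₂ v := by
    rw [witness, map_mul, map_pow, ← hχv, ← hρ, hψw]
    refine (congrArg₂ (fun x y => x * y ^ 2) (hfst' w) (hsnd' w)).trans ?_
    simp only [MonoidHom.comp_apply, ← map_mul, ← map_pow]
    simp
  rw [hW]
  have hbp : ρ₁ b = ρ₂ p := by rw [← hψb, ← hχb, hρ]
  have hbp' : ρ₁ b' = ρ₂ p' := by rw [← hψb', ← hχb', hρ]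
  simp only [FreeGroup.lift_apply_of]
  refine ⟨?_, ?_, ?_, ?_, ?_, ?_⟩
  · intro x y
    simp [f, ← map_mul]
  · intro x
    simp [f, ← map_mul, ← map_inv, hb]
  · intro x
    simp [f, ← map_mul, ← map_inv, hb']
  · simp only [f, hbp, hbp', ← map_mul, ← map_inv, hp]
  · simp only [f, hbp, hbp', ← map_mul, ← map_inv, hp']
  · simp only [f, ← map_mul, ← map_inv, hv, map_pow]

end Killing

end

/-- A finitely generated family of groups, depending on one exponent, whose `z`-th member is
trivial when `S z` holds, and which is collapsed by killing the single involution `k`. -/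
theorem exists_collapsing_family {S : ℕ → Prop} (hS : REPred S) :
    ∃ (X : Type) (_ : Finite X) (R : Set (FreeGroup X)) (x t T k : X) (ρ : ℕ → ℕ), R.Finite ∧
      Primrec ρ ∧ ∀ z,
      (∀ (Γ : Type) [Group Γ] (φ : FreeGroup X →* Γ), (∀ r ∈ R, φ r = 1) →
        φ (.of x) ^ ρ z * φ (.of t) * (φ (.of x) ^ ρ z)⁻¹ * (φ (.of T))⁻¹ = 1 →
        φ (.of k) * φ (.of k) = 1 ∧ (φ (.of k) = 1 → ∀ g, φ g = 1) ∧ (S z → ∀ g, φ g = 1)) ∧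
      (¬ S z → ∃ (Γ : Type) (_ : Group Γ) (φ : FreeGroup X →* Γ), (∀ r ∈ R, φ r = 1) ∧
        φ (.of x) ^ ρ z * φ (.of t) * (φ (.of x) ^ ρ z)⁻¹ * (φ (.of T))⁻¹ = 1 ∧
        φ (.of k) ≠ 1) := by
  obtain ⟨Q, K, _, _, _, M, h, q₀, i₀, ρ, hρ, H⟩ := StackDigits.exists_digitMachine hS
  let F : FreeGroup (MachineGroup.Gen Q K) →* FreeGroup (Killing.Gen (MachineGroup.Gen Q K)) :=
    FreeGroup.map Killing.Gen.fst
  have hin : ∀ {Γ : Type} [Group Γ] (φ : FreeGroup (Killing.Gen (MachineGroup.Gen Q K)) →* Γ) z,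
      φ (F (MachineGroup.inputRel i₀ q₀ (ρ z))) =
      φ (.of (.fst (.x i₀))) ^ ρ z * φ (.of (.fst (.t q₀))) *
        (φ (.of (.fst (.x i₀))) ^ ρ z)⁻¹ * (φ (.of (.fst .T)))⁻¹ := fun φ z => by
    simp [MachineGroup.inputRel, F]
  refine ⟨Killing.Gen (MachineGroup.Gen Q K), inferInstance,
    F '' MachineGroup.rels M h ∪ Killing.rels MachineGroup.omega,
    .fst (.x i₀), .fst (.t q₀), .fst .T, .fst .k, ρ,
    ((MachineGroup.finite_rels M h).image _).union (Killing.finite_rels _), hρ, fun z => ⟨?_, ?_⟩⟩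
  · intro Γ _ φ hφ hz
    have h1 : ∀ r ∈ MachineGroup.rels M h, φ.comp F r = 1 := fun r hr =>
      hφ _ (.inl ⟨r, hr, rfl⟩)
    have h2 : ∀ r ∈ Killing.rels MachineGroup.omega, φ r = 1 := fun r hr => hφ _ (.inr hr)
    rw [← hin] at hz
    refine ⟨?_, fun hk => Killing.eq_one_of_fst φ h2 ?_, fun hSz => Killing.eq_one_of_fst φ h2 ?_⟩
    · simpa [F] using ((MachineGroup.rel_iff M h _).1 h1).k_sq
    · exact MachineGroup.omega_eq_one_of_k (φ.comp F) (by simpa [F] using hk)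
    · exact MachineGroup.omega_eq_one ((H z).1 hSz) (φ.comp F) h1 hz
  · intro hSz
    obtain ⟨C, hC, hh, hq⟩ := (H z).2 hSz
    obtain ⟨G, _, φ, hφ, hz, hω⟩ := MachineGroup.exists_model hC hh hq
    obtain ⟨Γ, _, ι, ψ, hι, hψ, hr⟩ := Killing.exists_model φ hω
    refine ⟨Γ, inferInstance, ψ, ?_, ?_, ?_⟩
    · rintro _ (⟨r, hr', rfl⟩ | hr')
      · rw [hψ, hφ r hr', map_one]
      · exact hr _ hr'
    · rw [← hin, hψ, hz, map_one]
    · intro hk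
      refine hω 0 ?_
      rw [MachineGroup.omega_eq_one_of_k φ, one_pow]
      refine hι ?_
      rw [← hψ, map_one]
      simpa using hk

/-- The value of a word in the letters `0, 1, 2, …` under an assignment of the letters. -/
def evalWord {Γ : Type*} [Group Γ] (f : ℕ → Γ) (w : List (ℕ × Bool)) : Γ :=
  (w.map fun p => cond p.2 (f p.1) (f p.1)⁻¹).prod

theorem evalWord_append {Γ : Type*} [Group Γ] (f : ℕ → Γ) (u v : List (ℕ × Bool)) :
    evalWord f (u ++ v) = evalWord f u * evalWord f v := by
  simp [evalWord]

theorem exists_computable_family {S : ℕ → Prop} (hS : REPred S) :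
    ∃ (N k : ℕ) (rel : ℕ → List (List (ℕ × Bool))), k < N ∧ Primrec rel ∧
      (∀ z, ∀ w ∈ rel z, ∀ p ∈ w, p.1 < N) ∧ ∀ z,
      (∀ (Γ : Type) [Group Γ] (f : ℕ → Γ), (∀ w ∈ rel z, evalWord f w = 1) →
        f k * f k = 1 ∧ (f k = 1 → ∀ i < N, f i = 1) ∧ (S z → ∀ i < N, f i = 1)) ∧
      (¬ S z → ∃ (Γ : Type) (_ : Group Γ) (f : ℕ → Γ), (∀ w ∈ rel z, evalWord f w = 1) ∧
        f k ≠ 1) := by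
  obtain ⟨X, _, R, x, t, T, k, ρ, hR, hρ, H⟩ := exists_collapsing_family hS
  obtain ⟨N, ⟨e⟩⟩ := Finite.exists_equiv_fin X
  classical
  let toRaw : FreeGroup X → List (ℕ × Bool) := fun g => g.toWord.map fun p => ((e p.1 : ℕ), p.2)
  let inp : ℕ → List (ℕ × Bool) := fun z =>
    ((List.range (ρ z)).map fun _ => ((e x : ℕ), true)) ++ (((e t : ℕ), true) ::
    (((List.range (ρ z)).map fun _ => ((e x : ℕ), false)) ++ [((e T : ℕ), false)]))
  have hraw : ∀ {Γ : Type} [Group Γ] (f : ℕ → Γ) (g : FreeGroup X),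
      evalWord f (toRaw g) = FreeGroup.lift (fun y => f (e y)) g := fun f g => by
    conv_rhs => rw [← FreeGroup.mk_toWord (x := g), FreeGroup.lift_mk]
    simp [evalWord, toRaw, Function.comp_def]
  have hinp : ∀ {Γ : Type} [Group Γ] (f : ℕ → Γ) z, evalWord f (inp z) =
      f (e x) ^ ρ z * f (e t) * (f (e x) ^ ρ z)⁻¹ * (f (e T))⁻¹ := fun f z => by
    simp [evalWord, inp, mul_assoc]
  refine ⟨N, e k, fun z => hR.toFinset.toList.map toRaw ++ [inp z], (e k).2, ?_, ?_, fun z => ?_⟩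
  · have hm : ∀ b : Bool, Primrec fun z => (List.range (ρ z)).map fun _ => ((e x : ℕ), b) :=
      fun b => Primrec.list_map (Primrec.list_range.comp hρ) (Primrec.const _).to₂
    refine Primrec.list_append.comp (Primrec.const _)
      (Primrec.list_cons.comp ?_ (Primrec.const []))
    exact Primrec.list_append.comp (hm true) (Primrec.list_cons.comp (Primrec.const _)
      (Primrec.list_append.comp (hm false) (Primrec.const _)))
  · intro z w hw p hp
    simp only [List.mem_append, List.mem_map, List.mem_singleton] at hw
    obtain ⟨g, -, rfl⟩ | rfl := hw
    · simp only [toRaw, List.mem_map] at hp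
      obtain ⟨y, -, rfl⟩ := hp
      exact (e _).2
    · simp only [inp, List.mem_append, List.mem_map, List.mem_cons, List.not_mem_nil, or_false]
        at hp
      obtain ⟨_, -, rfl⟩ | rfl | ⟨_, -, rfl⟩ | rfl := hp <;> exact (e _).2
  have hrel : ∀ {Γ : Type} [Group Γ] (f : ℕ → Γ),
      (∀ w ∈ hR.toFinset.toList.map toRaw ++ [inp z], evalWord f w = 1) ↔
      (∀ r ∈ R, FreeGroup.lift (fun y => f (e y)) r = 1) ∧
        f (e x) ^ ρ z * f (e t) * (f (e x) ^ ρ z)⁻¹ * (f (e T))⁻¹ = 1 := fun f => by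
    simp only [List.mem_append, List.mem_map, Finset.mem_toList, Set.Finite.mem_toFinset,
      List.mem_singleton, or_imp, forall_and, forall_exists_index, and_imp,
      forall_apply_eq_imp_iff₂, hraw, forall_eq, hinp]
  refine ⟨fun Γ _ f hf => ?_, fun hSz => ?_⟩
  · rw [hrel] at hf
    have := (H z).1 Γ (FreeGroup.lift fun y => f (e y)) hf.1 (by simpa using hf.2)
    simp only [FreeGroup.lift_apply_of] at this
    have hi : (∀ g, FreeGroup.lift (fun y => f (e y)) g = 1) → ∀ i < N, f i = 1 := fun h i hi => by
      simpa using h (.of (e.symm ⟨i, hi⟩))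
    exact ⟨this.1, fun hk => hi (this.2.1 hk), fun hz => hi (this.2.2 hz)⟩
  · obtain ⟨Γ, _, φ, h1, h2, h3⟩ := (H z).2 hSz
    have hφ : FreeGroup.lift (fun y => φ (.of y)) = φ := by
      ext y
      simp
    refine ⟨Γ, inferInstance, fun i => if h : i < N then φ (.of (e.symm ⟨i, h⟩)) else 1, ?_, ?_⟩
    · rw [hrel]
      simp only [Fin.is_lt, dif_pos, Fin.eta, Equiv.symm_apply_apply, hφ]
      exact ⟨h1, h2⟩
    · simpa using h3

namespace FinPres

open Encodable

/-- A word with its letters regarded as natural numbers. -/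
def rawWord {m : ℕ} (w : Word m) : List (ℕ × Bool) := w.map fun p => ((p.1 : ℕ), p.2)

/-- A finite presentation with its letters regarded as natural numbers. -/
def raw (P : FinPres) : ℕ × List (List (ℕ × Bool)) := (P.1, P.2.map rawWord)

theorem encode_list_map {α β : Type} [Encodable α] [Encodable β] (f : α → β)
    (h : ∀ a, encode (f a) = encode a) (l : List α) : encode (l.map f) = encode l := by
  induction l with
  | nil => rfl
  | cons a l ih => rw [List.map_cons, encode_list_cons, encode_list_cons, h, ih]

theorem encode_raw (P : FinPres) : encode P.raw = encode P := by
  obtain ⟨m, L⟩ := P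
  rw [raw, encode_prod_val, encode_sigma_val]
  congr 1
  refine encode_list_map _ (fun w => ?_) L
  exact encode_list_map (fun p : Fin m × Bool => ((p.1 : ℕ), p.2)) (fun p => rfl) w

theorem exists_raw_eq {m : ℕ} {L : List (List (ℕ × Bool))} (hL : ∀ w ∈ L, ∀ p ∈ w, p.1 < m) :
    ∃ P : FinPres, P.raw = (m, L) := by
  have hw : ∀ w : List (ℕ × Bool), (∀ p ∈ w, p.1 < m) → ∃ w' : Word m, rawWord w' = w := by
    intro w hw
    induction w with
    | nil => exact ⟨[], rfl⟩
    | cons p w ih =>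
      obtain ⟨w', rfl⟩ := ih fun q hq => hw q (.tail _ hq)
      exact ⟨(⟨p.1, hw p (.head _)⟩, p.2) :: w', rfl⟩
  have : ∃ L' : List (Word m), L'.map rawWord = L := by
    induction L with
    | nil => exact ⟨[], rfl⟩
    | cons w L ih =>
      obtain ⟨L', rfl⟩ := ih fun q hq => hL q (.tail _ hq)
      obtain ⟨w', rfl⟩ := hw w (hL w (.head _))
      exact ⟨w' :: L', rfl⟩
  obtain ⟨L', rfl⟩ := this
  exact ⟨⟨m, L'⟩, rfl⟩

theorem evalWord_rawWord {Γ : Type*} [Group Γ] (f : ℕ → Γ) {m : ℕ} (w : Word m) :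
    evalWord f (rawWord w) = FreeGroup.lift (fun i : Fin m => f i) (FreeGroup.mk w) := by
  simp [evalWord, rawWord, FreeGroup.lift_mk, Function.comp_def]

theorem evalWord_eq_lift {Γ : Type*} [Group Γ] (f : ℕ → Γ) (w : List (ℕ × Bool)) :
    evalWord f w = FreeGroup.lift f (FreeGroup.mk w) := by
  simp [evalWord, FreeGroup.lift_mk]

theorem mk_rawWord {m : ℕ} (w : Word m) :
    FreeGroup.mk (rawWord w) = FreeGroup.map (fun i : Fin m => (i : ℕ)) (FreeGroup.mk w) := by
  simp [rawWord]

theorem proj_surjective (P : FinPres) : Function.Surjective P.proj :=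
  PresentedGroup.mk_surjective _

theorem proj_eq_one_iff (P : FinPres) {x : FreeGroup (Fin P.1)} :
    P.proj x = 1 ↔ x ∈ Subgroup.normalClosure P.rels :=
  QuotientGroup.eq_one_iff x

theorem proj_mk (P : FinPres) {w : Word P.1} (hw : w ∈ P.2) : P.proj (FreeGroup.mk w) = 1 :=
  P.proj_eq_one_iff.2 (Subgroup.subset_normalClosure ⟨w, hw, rfl⟩)

/-- A homomorphism out of a finitely presented group. -/
def lift (P : FinPres) {Γ : Type*} [Group Γ] (φ : FreeGroup (Fin P.1) →* Γ)
    (hφ : ∀ w ∈ P.2, φ (FreeGroup.mk w) = 1) : P.Grp →* Γ :=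
  QuotientGroup.lift _ φ (Subgroup.normalClosure_le_normal (N := φ.ker) (by
    rintro _ ⟨w, hw, rfl⟩
    exact hφ w hw))

@[simp]
theorem lift_proj (P : FinPres) {Γ : Type*} [Group Γ] (φ : FreeGroup (Fin P.1) →* Γ)
    (hφ : ∀ w ∈ P.2, φ (FreeGroup.mk w) = 1) (x : FreeGroup (Fin P.1)) :
    P.lift φ hφ (P.proj x) = φ x :=
  rfl

theorem hom_ext {P : FinPres} {Γ : Type*} [Group Γ] {φ ψ : P.Grp →* Γ}
    (h : φ.comp P.proj = ψ.comp P.proj) : φ = ψ :=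
  (MonoidHom.cancel_right P.proj_surjective).1 h

/-- Disjoint union of two finite presentations. -/
def add (P Q : FinPres) : FinPres :=
  ⟨P.1 + Q.1, P.2.map (List.map fun p => (Fin.castAdd Q.1 p.1, p.2)) ++
    Q.2.map (List.map fun p => (Fin.natAdd P.1 p.1, p.2))⟩

/-- Disjoint union of presentations with letters in `ℕ`. -/
def rawAdd (P Q : ℕ × List (List (ℕ × Bool))) : ℕ × List (List (ℕ × Bool)) :=
  (P.1 + Q.1, P.2 ++ Q.2.map (List.map fun p => (P.1 + p.1, p.2)))

theorem raw_add (P Q : FinPres) : (P.add Q).raw = rawAdd P.raw Q.raw := by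
  simp [raw, add, rawAdd, rawWord, Function.comp_def]

theorem nonempty_add_equiv (P Q : FinPres) :
    Nonempty ((P.add Q).Grp ≃* Monoid.Coprod P.Grp Q.Grp) := by
  obtain ⟨l, hl⟩ : ∃ l : Fin P.1 → Fin (P.add Q).1, l = Fin.castAdd Q.1 := ⟨_, rfl⟩
  obtain ⟨r, hr⟩ : ∃ r : Fin Q.1 → Fin (P.add Q).1, r = Fin.natAdd P.1 := ⟨_, rfl⟩
  have hlr : ∀ i, (∃ j, i = l j) ∨ ∃ j, i = r j := fun i => by
    subst hl hr
    exact Fin.addCases (motive := fun i => (∃ j, i = Fin.castAdd Q.1 j) ∨ ∃ j, i = Fin.natAdd P.1 j)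
      (fun j => .inl ⟨j, rfl⟩) (fun j => .inr ⟨j, rfl⟩) i
  have hadd : (P.add Q).2 = P.2.map (List.map fun p => (l p.1, p.2)) ++
      Q.2.map (List.map fun p => (r p.1, p.2)) := by
    subst hl hr
    rfl
  obtain ⟨d, hdl, hdr⟩ : ∃ d : Fin (P.add Q).1 → Monoid.Coprod P.Grp Q.Grp,
      (∀ i, d (l i) = .inl (P.proj (.of i))) ∧ ∀ i, d (r i) = .inr (Q.proj (.of i)) := by
    subst hl hr
    exact ⟨Fin.addCases (fun i => .inl (P.proj (.of i))) fun i => .inr (Q.proj (.of i)),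
      fun i => Fin.addCases_left i, fun i => Fin.addCases_right i⟩
  have hdl' : (FreeGroup.lift d).comp (FreeGroup.map l) = Monoid.Coprod.inl.comp P.proj :=
    FreeGroup.ext_hom _ _ fun i => by simp [hdl]
  have hdr' : (FreeGroup.lift d).comp (FreeGroup.map r) = Monoid.Coprod.inr.comp Q.proj :=
    FreeGroup.ext_hom _ _ fun i => by simp [hdr]
  let f : (P.add Q).Grp →* Monoid.Coprod P.Grp Q.Grp := (P.add Q).lift (FreeGroup.lift d) (by
    intro w hw
    rw [hadd, List.mem_append, List.mem_map, List.mem_map] at hw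
    obtain ⟨w, hw, rfl⟩ | ⟨w, hw, rfl⟩ := hw
    · rw [← FreeGroup.map.mk, ← MonoidHom.comp_apply, hdl', MonoidHom.comp_apply, P.proj_mk hw,
        map_one]
    · rw [← FreeGroup.map.mk, ← MonoidHom.comp_apply, hdr', MonoidHom.comp_apply, Q.proj_mk hw,
        map_one])
  let g : Monoid.Coprod P.Grp Q.Grp →* (P.add Q).Grp := Monoid.Coprod.lift
    (P.lift ((P.add Q).proj.comp (FreeGroup.map l)) (by
      intro w hw
      rw [MonoidHom.comp_apply, FreeGroup.map.mk]
      exact (P.add Q).proj_mk (hadd ▸ List.mem_append_left _ (List.mem_map_of_mem hw))))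
    (Q.lift ((P.add Q).proj.comp (FreeGroup.map r)) (by
      intro w hw
      rw [MonoidHom.comp_apply, FreeGroup.map.mk]
      exact (P.add Q).proj_mk (hadd ▸ List.mem_append_right _ (List.mem_map_of_mem hw))))
  refine ⟨f.toMulEquiv g ?_ ?_⟩
  · refine hom_ext (FreeGroup.ext_hom _ _ fun i => ?_)
    obtain ⟨i, rfl⟩ | ⟨i, rfl⟩ := hlr i <;> simp [f, g, hdl, hdr]
  · refine Monoid.Coprod.hom_ext (hom_ext (FreeGroup.ext_hom _ _ fun i => ?_))
      (hom_ext (FreeGroup.ext_hom _ _ fun i => ?_)) <;> simp [f, g, hdl, hdr]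

end FinPres

namespace Certificate

open FreeGroup (invRev reduce mk)

/-- A word in letters indexed by `ℕ`. -/
abbrev NatWord : Type := List (ℕ × Bool)

/-- The inverse of a word when `b` is `false`, the word itself otherwise. -/
def signed (w : NatWord) (b : Bool) : NatWord := bif b then w else invRev w

/-- Substitution of words for letters. -/
def subst (us : List NatWord) (w : NatWord) : NatWord :=
  w.flatMap fun p => signed (us.getD p.1 []) p.2

/-- The product of conjugates of elements of a list described by the second argument. -/
def concat (L : List NatWord) (c : List (NatWord × ℕ × Bool)) : NatWord :=
  c.flatMap fun t => t.1 ++ signed (L.getD t.2.1 []) t.2.2 ++ invRev t.1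

/-- The words which have to be consequences of the relators of `Q` in order that substitution of
`us` defines a homomorphism from the group presented by `P`, with `vs` preimages of the
generators. -/
def goals (P Q : ℕ × List NatWord) (us vs : List NatWord) : List NatWord :=
  P.2.map (subst us) ++
    (List.range Q.1).map fun i => (i, true) :: invRev (subst us (vs.getD i []))

/-- A certificate, consisting of images of generators, preimages of generators, and proofs of
relations, describes an epimorphism between presented groups. -/
def Passes (P Q : ℕ × List NatWord)
    (c : List NatWord × List NatWord × List (List (NatWord × ℕ × Bool))) : Prop :=
  c.1.length = P.1 ∧ (goals P Q c.1 c.2.1).map reduce = c.2.2.map fun t => reduce (concat Q.2 t)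

theorem primrec_invRev : Primrec (invRev : NatWord → NatWord) :=
  Primrec.list_reverse.comp (Primrec.list_map .id
    (Primrec.pair (Primrec.fst.comp .snd) (Primrec.not.comp (Primrec.snd.comp .snd))))

theorem primrec_signed : Primrec₂ signed :=
  Primrec.cond .snd .fst (primrec_invRev.comp .fst)

theorem primrec_subst : Primrec₂ subst := by
  refine Primrec.list_flatMap .snd ?_
  exact primrec_signed.comp ((Primrec.list_getD ([] : NatWord)).comp (Primrec.fst.comp .fst)
    (Primrec.fst.comp .snd)) (Primrec.snd.comp .snd)

theorem primrec_concat : Primrec₂ concat := by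
  refine Primrec.list_flatMap .snd ?_
  refine Primrec.list_append.comp (Primrec.list_append.comp (Primrec.fst.comp .snd) ?_)
    (primrec_invRev.comp (Primrec.fst.comp .snd))
  exact primrec_signed.comp ((Primrec.list_getD ([] : NatWord)).comp (Primrec.fst.comp .fst)
    (Primrec.fst.comp (Primrec.snd.comp .snd))) (Primrec.snd.comp (Primrec.snd.comp .snd))

theorem primrec_reduce : Primrec (reduce : NatWord → NatWord) := by
  let s : (ℕ × Bool) × NatWord → NatWord := fun p => List.casesOn p.2 [p.1] fun b l =>
    if p.1.1 = b.1 ∧ p.1.2 = !b.2 then l else p.1 :: b :: l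
  have hs : Primrec s := by
    refine Primrec.list_casesOn (f := fun p : (ℕ × Bool) × NatWord => p.2) (g := fun p => [p.1])
      (h := fun p q => if p.1.1 = q.1.1 ∧ p.1.2 = !q.1.2 then q.2 else p.1 :: q.1 :: q.2)
      .snd (Primrec.list_cons.comp .fst (.const [])) ?_
    refine Primrec.ite (PrimrecPred.and ?_ ?_) (Primrec.snd.comp .snd)
      (Primrec.list_cons.comp (Primrec.fst.comp .fst)
        (Primrec.list_cons.comp (Primrec.fst.comp .snd) (Primrec.snd.comp .snd)))
    · exact Primrec.eq.comp (Primrec.fst.comp (Primrec.fst.comp .fst))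
        (Primrec.fst.comp (Primrec.fst.comp .snd))
    · exact Primrec.eq.comp (Primrec.snd.comp (Primrec.fst.comp .fst))
        (Primrec.not.comp (Primrec.snd.comp (Primrec.fst.comp .snd)))
  refine (Primrec.list_foldr (h := fun _ p => s p) .id (.const ([] : NatWord))
    (hs.comp .snd)).of_eq fun w => ?_
  induction w with
  | nil => rfl
  | cons a w ih =>
    rw [FreeGroup.reduce.cons, ← ih]
    rfl

theorem primrec_goals : Primrec fun x : ((ℕ × List NatWord) × (ℕ × List NatWord)) ×
    List NatWord × List NatWord => goals x.1.1 x.1.2 x.2.1 x.2.2 := by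
  refine Primrec.list_append.comp (Primrec.list_map (Primrec.snd.comp (Primrec.fst.comp .fst))
    (primrec_subst.comp (Primrec.fst.comp (Primrec.snd.comp .fst)) .snd))
    (Primrec.list_map (Primrec.list_range.comp (Primrec.fst.comp (Primrec.snd.comp .fst))) ?_)
  refine Primrec.list_cons.comp (Primrec.pair .snd (.const true)) (primrec_invRev.comp
    (primrec_subst.comp (Primrec.fst.comp (Primrec.snd.comp .fst)) ?_))
  exact (Primrec.list_getD ([] : NatWord)).comp (Primrec.snd.comp (Primrec.snd.comp .fst)) .snd

theorem primrecPred_passes : PrimrecPred fun x : ((ℕ × List NatWord) × (ℕ × List NatWord)) ×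
    List NatWord × List NatWord × List (List (NatWord × ℕ × Bool)) =>
      Passes x.1.1 x.1.2 x.2 := by
  refine PrimrecPred.and ?_ ?_
  · exact Primrec.eq.comp (Primrec.list_length.comp (Primrec.fst.comp .snd))
      (Primrec.fst.comp (Primrec.fst.comp .fst))
  · refine Primrec.eq.comp (Primrec.list_map ?_ (primrec_reduce.comp .snd))
      (Primrec.list_map (Primrec.snd.comp (Primrec.snd.comp .snd)) (primrec_reduce.comp
        (primrec_concat.comp (Primrec.snd.comp (Primrec.snd.comp (Primrec.fst.comp .fst))) .snd)))
    exact primrec_goals.comp (Primrec.pair .fst (Primrec.pair (Primrec.fst.comp .snd)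
      (Primrec.fst.comp (Primrec.snd.comp .snd))))

section Eval

variable {Γ : Type*} [Group Γ] (f : ℕ → Γ)

theorem evalWord_invRev (w : NatWord) : evalWord f (invRev w) = (evalWord f w)⁻¹ := by
  rw [FinPres.evalWord_eq_lift, FinPres.evalWord_eq_lift, ← FreeGroup.inv_mk, map_inv]

theorem evalWord_reduce (w : NatWord) : evalWord f (reduce w) = evalWord f w := by
  rw [FinPres.evalWord_eq_lift, FinPres.evalWord_eq_lift, FreeGroup.reduce.self]

theorem evalWord_signed (w : NatWord) (b : Bool) :
    evalWord f (signed w b) = cond b (evalWord f w) (evalWord f w)⁻¹ := by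
  cases b
  · exact evalWord_invRev f w
  · rfl

theorem evalWord_cons (p : ℕ × Bool) (w : NatWord) :
    evalWord f (p :: w) = cond p.2 (f p.1) (f p.1)⁻¹ * evalWord f w := by
  simp [evalWord]

theorem evalWord_subst (us : List NatWord) (w : NatWord) :
    evalWord f (subst us w) = evalWord (fun i => evalWord f (us.getD i [])) w := by
  induction w with
  | nil => rfl
  | cons p w ih =>
    rw [evalWord_cons, ← ih, ← evalWord_signed, ← evalWord_append]
    rfl

theorem evalWord_concat {L : List NatWord} (hL : ∀ w ∈ L, evalWord f w = 1)
    (c : List (NatWord × ℕ × Bool)) : evalWord f (concat L c) = 1 := by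
  induction c with
  | nil => rfl
  | cons t c ih =>
    have h1 : evalWord f (L.getD t.2.1 []) = 1 := by
      rcases lt_or_ge t.2.1 L.length with h | h
      · rw [List.getD_eq_getElem _ _ h]
        exact hL _ (List.getElem_mem h)
      · rw [List.getD_eq_default _ _ h]
        rfl
    change evalWord f (_ ++ signed _ _ ++ _ ++ concat L c) = 1
    rw [evalWord_append, ih, evalWord_append, evalWord_append, evalWord_signed, h1,
      evalWord_invRev]
    cases t.2.2 <;> simp

/-- Soundness of certificates. -/
theorem Passes.sound {P Q : ℕ × List NatWord}
    {c : List NatWord × List NatWord × List (List (NatWord × ℕ × Bool))} (h : Passes P Q c)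
    (hf : ∀ w ∈ Q.2, evalWord f w = 1) :
    (∀ w ∈ P.2, evalWord (fun i => evalWord f (c.1.getD i [])) w = 1) ∧
      ∀ i < Q.1, f i = evalWord (fun i => evalWord f (c.1.getD i [])) (c.2.1.getD i []) := by
  have hg : ∀ w ∈ goals P Q c.1 c.2.1, evalWord f w = 1 := fun w hw => by
    have : reduce w ∈ c.2.2.map fun t => reduce (concat Q.2 t) :=
      h.2 ▸ List.mem_map_of_mem hw
    obtain ⟨t, -, ht⟩ := List.mem_map.1 this
    rw [← evalWord_reduce, ← ht, evalWord_reduce, evalWord_concat f hf]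
  constructor
  · intro w hw
    rw [← evalWord_subst]
    exact hg _ (List.mem_append_left _ (List.mem_map_of_mem hw))
  · intro i hi
    have := hg _ (List.mem_append_right _ (List.mem_map_of_mem (List.mem_range.2 hi)))
    rw [evalWord_cons, evalWord_invRev, mul_inv_eq_one] at this
    rw [← evalWord_subst]
    exact this

end Eval

theorem exists_concat (P : FinPres) {x : FreeGroup (Fin P.1)}
    (hx : x ∈ Subgroup.normalClosure P.rels) :
    ∃ c, mk (concat P.raw.2 c) = FreeGroup.map (fun i : Fin P.1 => (i : ℕ)) x := by
  have hstep : ∀ r ∈ Group.conjugatesOfSet P.rels, ∃ (u : NatWord) (i : ℕ),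
      mk u * mk (P.raw.2.getD i []) * (mk u)⁻¹ =
        FreeGroup.map (fun i : Fin P.1 => (i : ℕ)) r := by
    intro r hr
    obtain ⟨_, ⟨w, hw, rfl⟩, hr⟩ := Group.mem_conjugatesOfSet_iff.1 hr
    obtain ⟨g, rfl⟩ := isConj_iff.1 hr
    obtain ⟨i, hi, hiw⟩ := List.getElem_of_mem (List.mem_map_of_mem (f := FinPres.rawWord) hw)
    refine ⟨FinPres.rawWord g.toWord, i, ?_⟩
    rw [FinPres.raw, List.getD_eq_getElem _ _ hi, hiw, FinPres.mk_rawWord, FinPres.mk_rawWord,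
      FreeGroup.mk_toWord]
    simp only [map_mul, map_inv]
  refine Subgroup.closure_induction_left (p := fun x _ => ∃ c, mk (concat P.raw.2 c) =
    FreeGroup.map (fun i : Fin P.1 => (i : ℕ)) x) ⟨[], by rw [map_one]; rfl⟩ ?_ ?_ hx
  · rintro r hr y - ⟨c, hc⟩
    obtain ⟨u, i, hu⟩ := hstep r hr
    refine ⟨(u, i, true) :: c, ?_⟩
    rw [map_mul, ← hu, ← hc, FreeGroup.inv_mk, FreeGroup.mul_mk, FreeGroup.mul_mk,
      FreeGroup.mul_mk]
    rfl
  · rintro r hr y - ⟨c, hc⟩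
    obtain ⟨u, i, hu⟩ := hstep r hr
    refine ⟨(u, i, false) :: c, ?_⟩
    rw [map_mul, map_inv, ← hu, ← hc, conj_inv, FreeGroup.inv_mk, FreeGroup.inv_mk,
      FreeGroup.mul_mk, FreeGroup.mul_mk, FreeGroup.mul_mk]
    rfl

theorem reduce_eq_of_proj_eq_one (P : FinPres) {w : Word P.1} (hw : P.proj (mk w) = 1) :
    ∃ c, reduce (FinPres.rawWord w) = reduce (concat P.raw.2 c) := by
  obtain ⟨c, hc⟩ := exists_concat P (P.proj_eq_one_iff.1 hw)
  exact ⟨c, FreeGroup.reduce.sound (by rw [hc, FinPres.mk_rawWord])⟩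

/-- Completeness of certificates. -/
theorem exists_passes {P Q : FinPres} (φ : P.Grp →* Q.Grp) (hφ : Function.Surjective φ) :
    ∃ c, Passes P.raw Q.raw c := by
  have hu : ∀ i : Fin P.1, ∃ u : Word Q.1, Q.proj (mk u) = φ (P.proj (.of i)) := fun i => by
    obtain ⟨x, hx⟩ := Q.proj_surjective (φ (P.proj (.of i)))
    exact ⟨x.toWord, by rw [FreeGroup.mk_toWord, hx]⟩
  have hv : ∀ i : Fin Q.1, ∃ v : Word P.1, φ (P.proj (mk v)) = Q.proj (.of i) := fun i => by
    obtain ⟨x, hx⟩ := (hφ.comp P.proj_surjective) (Q.proj (.of i))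
    exact ⟨x.toWord, by rw [FreeGroup.mk_toWord]; exact hx⟩
  choose u hu using hu
  choose v hv using hv
  let us := List.ofFn fun i => FinPres.rawWord (u i)
  let vs := List.ofFn fun i => FinPres.rawWord (v i)
  have hsub : ∀ w : Word P.1, ∃ w' : Word Q.1, FinPres.rawWord w' = subst us (FinPres.rawWord w) ∧
      Q.proj (mk w') = φ (P.proj (mk w)) := by
    intro w
    induction w with
    | nil => exact ⟨[], rfl, by simp [← FreeGroup.one_eq_mk]⟩
    | cons p w ih =>
      obtain ⟨w', hw', hw⟩ := ih
      obtain ⟨i, b⟩ := p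
      have hus : us.getD i [] = FinPres.rawWord (u i) := by
        rw [List.getD_eq_getElem _ _ (by simp [us])]
        simp [us]
      refine ⟨(bif b then u i else invRev (u i)) ++ w', ?_, ?_⟩
      · change _ = signed (us.getD i []) b ++ subst us (FinPres.rawWord w)
        rw [← hw', hus]
        cases b <;> simp [FinPres.rawWord, signed, invRev, Function.comp_def]
      · have : mk ((i, b) :: w) = (bif b then .of i else (.of i)⁻¹) * mk w := by
          cases b <;> simp [FreeGroup.of, FreeGroup.inv_mk, FreeGroup.mul_mk, invRev]
        rw [this, ← FreeGroup.mul_mk, map_mul, map_mul, map_mul, hw]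
        cases b
        · rw [cond_false, cond_false, ← FreeGroup.inv_mk, map_inv, map_inv, map_inv, hu]
        · rw [cond_true, cond_true, hu]
  have hgoals : ∀ g ∈ goals P.raw Q.raw us vs, ∃ w : Word Q.1, FinPres.rawWord w = g ∧
      Q.proj (mk w) = 1 := by
    intro g hg
    rw [goals, List.mem_append, List.mem_map, List.mem_map] at hg
    obtain ⟨r, hr, rfl⟩ | ⟨i, hi, rfl⟩ := hg
    · obtain ⟨r, hr', rfl⟩ := List.mem_map.1 hr
      obtain ⟨w, hw, hw'⟩ := hsub r
      exact ⟨w, hw, by rw [hw', P.proj_mk hr', map_one]⟩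
    · have hi : i < Q.1 := List.mem_range.1 hi
      have hvs : vs.getD i [] = FinPres.rawWord (v ⟨i, hi⟩) := by
        rw [List.getD_eq_getElem _ _ (by simpa [vs] using hi)]
        simp [vs]
      obtain ⟨w, hw, hw'⟩ := hsub (v ⟨i, hi⟩)
      refine ⟨(⟨i, hi⟩, true) :: invRev w, ?_, ?_⟩
      · rw [hvs, ← hw]
        simp [FinPres.rawWord, invRev, Function.comp_def]
      · have : mk ((⟨i, hi⟩, true) :: invRev w) = .of ⟨i, hi⟩ * (mk w)⁻¹ := by
          simp [FreeGroup.of, FreeGroup.inv_mk, FreeGroup.mul_mk]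
        rw [this, map_mul, map_inv, hw', hv, mul_inv_cancel]
  have hcs : ∀ L : List NatWord, (∀ g ∈ L, ∃ w : Word Q.1, FinPres.rawWord w = g ∧
      Q.proj (mk w) = 1) → ∃ cs : List (List (NatWord × ℕ × Bool)),
        L.map reduce = cs.map fun t => reduce (concat Q.raw.2 t) := by
    intro L
    induction L with
    | nil => exact fun _ => ⟨[], rfl⟩
    | cons g L ih =>
      intro hL
      obtain ⟨cs, hcs⟩ := ih fun g hg => hL g (.tail _ hg)
      obtain ⟨w, rfl, hw⟩ := hL g (.head _)
      obtain ⟨c, hc⟩ := reduce_eq_of_proj_eq_one Q hw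
      exact ⟨c :: cs, by rw [List.map_cons, List.map_cons, hcs, hc]⟩
  obtain ⟨cs, hcs⟩ := hcs _ hgoals
  exact ⟨(us, vs, cs), by simp [us, FinPres.raw], hcs⟩

end Certificate

theorem map_evalWord {Γ Δ : Type*} [Group Γ] [Group Δ] (φ : Γ →* Δ) (f : ℕ → Γ)
    (w : List (ℕ × Bool)) : φ (evalWord f w) = evalWord (fun i => φ (f i)) w := by
  rw [evalWord, map_list_prod, List.map_map, evalWord]
  congr 1
  refine List.map_congr_left fun p _ => ?_
  cases h : p.2 <;> simp [h]

namespace FinPres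

/-- The generators of a presented group, extended by `1`. -/
def gen (P : FinPres) (i : ℕ) : P.Grp := if h : i < P.1 then P.proj (.of ⟨i, h⟩) else 1

theorem gen_val (P : FinPres) (i : Fin P.1) : P.gen i = P.proj (.of i) := dif_pos i.2

theorem evalWord_gen (P : FinPres) {w : List (ℕ × Bool)} (hw : w ∈ P.raw.2) :
    evalWord P.gen w = 1 := by
  obtain ⟨w, hw', rfl⟩ := List.mem_map.1 hw
  have : FreeGroup.lift (fun i : Fin P.1 => P.gen i) = P.proj :=
    FreeGroup.ext_hom _ _ fun i => by simp [gen_val]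
  rw [evalWord_rawWord, this, P.proj_mk hw']

theorem eq_one_of_gen {P : FinPres} {Γ : Type*} [Group Γ] {φ : P.Grp →* Γ}
    (h : ∀ i < P.1, φ (P.gen i) = 1) : φ = 1 :=
  hom_ext (FreeGroup.ext_hom _ _ fun i => by simpa [gen_val] using h i i.2)

theorem subsingleton_of_gen {P : FinPres} (h : ∀ i < P.1, P.gen i = 1) : Subsingleton P.Grp := by
  have : MonoidHom.id P.Grp = 1 := eq_one_of_gen h
  exact subsingleton_of_forall_eq 1 fun x => DFunLike.congr_fun this x

theorem nontrivial_of_evalWord {P : FinPres} {Γ : Type*} [Group Γ] (f : ℕ → Γ)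
    (hf : ∀ w ∈ P.raw.2, evalWord f w = 1) {k : ℕ} (hk : k < P.1) (hfk : f k ≠ 1) :
    Nontrivial P.Grp := by
  refine ⟨P.proj (.of ⟨k, hk⟩), 1, fun h => hfk ?_⟩
  have := congrArg (P.lift (FreeGroup.lift fun i : Fin P.1 => f i) fun w hw => by
    rw [← evalWord_rawWord]
    exact hf _ (List.mem_map_of_mem hw)) h
  simpa using this

end FinPres

theorem exists_diagonal {h : ℕ →. ℕ} (hh : Partrec h) :
    ∃ n, ∀ j, Nat.pair n j ∈ W n ↔ j ∈ h n := by
  let D : ℕ →. ℕ := fun z => (h z.unpair.1).bind fun j =>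
    ((if j = z.unpair.2 then some 0 else none : Option ℕ) : Part ℕ)
  have hD : Partrec D := by
    refine (hh.comp (Primrec.fst.comp Primrec.unpair).to_comp).bind (Computable.ofOption ?_)
    exact (Primrec.ite (Primrec.eq.comp .snd (Primrec.snd.comp (Primrec.unpair.comp .fst)))
      (.const (some 0)) (.const none)).to_comp
  obtain ⟨c, hc⟩ := Nat.Partrec.Code.exists_code.1 (Partrec.nat_iff.1 hD)
  refine ⟨Encodable.encode c, fun j => ?_⟩
  rw [W, Set.mem_ofPred_eq, Denumerable.ofNat_encode, hc, Part.dom_iff_mem]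
  constructor
  · rintro ⟨y, hy⟩
    obtain ⟨i, hi, hy⟩ := Part.mem_bind_iff.1 hy
    rw [Nat.unpair_pair] at hi hy
    split_ifs at hy with hij
    · subst hij
      exact hi
    · simp at hy
  · intro hj
    refine ⟨0, Part.mem_bind_iff.2 ⟨j, ?_, ?_⟩⟩ <;> simp [Nat.unpair_pair, hj]

theorem rePred_diagonal : REPred fun z : ℕ => z ∈ W z.unpair.1 :=
  Partrec.dom_re (Nat.Partrec.Code.eval_part.comp
    ((Primrec.ofNat Nat.Partrec.Code).comp (Primrec.fst.comp Primrec.unpair)).to_comp .id)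

namespace Monoid.Coprod

instance nontrivial_left {A B : Type*} [Group A] [Group B] [Nontrivial A] :
    Nontrivial (Coprod A B) :=
  (inl_injective (M := A) (N := B)).nontrivial

instance nontrivial_right {A B : Type*} [Group A] [Group B] [Nontrivial B] :
    Nontrivial (Coprod A B) :=
  (inr_injective (M := A) (N := B)).nontrivial

/-- A homomorphism onto a group from a free product of three groups is onto when restricted
to one factor, provided that it kills the other two. -/
theorem exists_surjective (A : ℕ → Type) [∀ j, Group (A j)] {G : Type} [Group G]
    (ψ : Coprod (A 0) (Coprod (A 1) (A 2)) →* G) (hψ : Function.Surjective ψ)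
    (h : (ψ.comp inl = 1 ∧ (ψ.comp inr).comp inl = 1) ∨
      (ψ.comp inl = 1 ∧ (ψ.comp inr).comp inr = 1) ∨
      ((ψ.comp inr).comp inl = 1 ∧ (ψ.comp inr).comp inr = 1)) :
    ∃ j, ∃ θ : A j →* G, Function.Surjective θ := by
  have hr : ψ.range = (ψ.comp inl).range ⊔
      (((ψ.comp inr).comp inl).range ⊔ ((ψ.comp inr).comp inr).range) := by
    rw [range_eq, range_eq (ψ.comp inr)]
  rw [MonoidHom.range_eq_top.2 hψ] at hr
  obtain ⟨h1, h2⟩ | ⟨h1, h2⟩ | ⟨h1, h2⟩ := h <;>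
    rw [h1, h2] at hr <;> simp only [MonoidHom.range_one, bot_sup_eq, sup_bot_eq] at hr
  · exact ⟨2, _, MonoidHom.range_eq_top.1 hr.symm⟩
  · exact ⟨1, _, MonoidHom.range_eq_top.1 hr.symm⟩
  · exact ⟨0, _, MonoidHom.range_eq_top.1 hr.symm⟩

end Monoid.Coprod

namespace FinPres

open Monoid

/-- A free product of three finitely presented groups, no two of which are both trivial,
is a proper free product. -/
theorem exists_splitting {A B C : FinPres} (hAB : Nontrivial A.Grp ∨ Nontrivial B.Grp)
    (hAC : Nontrivial A.Grp ∨ Nontrivial C.Grp) (hBC : Nontrivial B.Grp ∨ Nontrivial C.Grp) :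
    ∃ Q₁ Q₂ : FinPres, Nontrivial Q₁.Grp ∧ Nontrivial Q₂.Grp ∧
      Nonempty ((A.add (B.add C)).Grp ≃* Coprod Q₁.Grp Q₂.Grp) := by
  obtain ⟨e₁⟩ := nonempty_add_equiv A (B.add C)
  obtain ⟨e₂⟩ := nonempty_add_equiv B C
  by_cases hA : Nontrivial A.Grp
  · refine ⟨A, B.add C, hA, ?_, ⟨e₁⟩⟩
    have : Nontrivial (Coprod B.Grp C.Grp) := by
      obtain h | h := hBC <;> infer_instance
    exact e₂.toEquiv.nontrivial
  · refine ⟨B, C, hAB.resolve_left hA, hAC.resolve_left hA, ?_⟩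
    have : Subsingleton A.Grp := not_nontrivial_iff_subsingleton.1 hA
    have e₃ : Coprod A.Grp (B.add C).Grp ≃* (B.add C).Grp :=
      MonoidHom.toMulEquiv Coprod.snd Coprod.inr (Coprod.hom_ext (MonoidHom.ext fun a => by
        rw [Subsingleton.elim a 1, map_one, map_one]) (MonoidHom.ext fun b => by simp))
        (MonoidHom.ext fun b => by simp)
    exact ⟨(e₁.trans e₃).trans e₂⟩

/-- If each of three groups is collapsed by killing an involution, then in any splitting of their
free product some factor is a quotient of one of the groups. -/
theorem exists_surjective_of_splitting (A : ℕ → FinPres)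
    (hA : ∀ j, ∃ k : (A j).Grp, k * k = 1 ∧
      ∀ (Γ : Type) [Group Γ] (φ : (A j).Grp →* Γ), φ k = 1 → φ = 1)
    {G₁ G₂ : Type} [Group G₁] [Group G₂]
    (e : Coprod G₁ G₂ ≃* ((A 0).add ((A 1).add (A 2))).Grp) :
    (∃ j, ∃ θ : (A j).Grp →* G₁, Function.Surjective θ) ∨
      ∃ j, ∃ θ : (A j).Grp →* G₂, Function.Surjective θ := by
  obtain ⟨e₁⟩ := nonempty_add_equiv (A 0) ((A 1).add (A 2))
  obtain ⟨e₂⟩ := nonempty_add_equiv (A 1) (A 2)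
  let ψ : Coprod (A 0).Grp (Coprod (A 1).Grp (A 2).Grp) →* Coprod G₁ G₂ :=
    (e.symm.toMonoidHom.comp e₁.symm.toMonoidHom).comp
      ((MulEquiv.refl _).coprodCongr e₂.symm).toMonoidHom
  have hψ : Function.Surjective ψ :=
    (e.symm.surjective.comp e₁.symm.surjective).comp (MulEquiv.surjective _)
  have hkill : ∀ j (θ : (A j).Grp →* Coprod G₁ G₂),
      Coprod.fst.comp θ = 1 ∨ Coprod.snd.comp θ = 1 := by
    intro j θ
    obtain ⟨k, hk, hφ⟩ := hA j
    refine (Coprod.fst_eq_one_or_snd_eq_one (a := θ k) (n := 1) ?_).imp (hφ _ _) (hφ _ _)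
    rw [← map_pow, pow_two, hk, map_one]
  have h₀ := hkill 0 (ψ.comp Coprod.inl)
  have h₁ := hkill 1 ((ψ.comp Coprod.inr).comp Coprod.inl)
  have h₂ := hkill 2 ((ψ.comp Coprod.inr).comp Coprod.inr)
  have H₁ := Coprod.exists_surjective (fun j => (A j).Grp) (Coprod.fst.comp ψ)
    (Coprod.fst_surjective.comp hψ)
  have H₂ := Coprod.exists_surjective (fun j => (A j).Grp) (Coprod.snd.comp ψ)
    (Coprod.snd_surjective.comp hψ)
  simp only [MonoidHom.comp_assoc] at h₀ h₁ h₂ H₁ H₂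
  obtain h₀ | h₀ := h₀ <;> obtain h₁ | h₁ := h₁
  · exact .inl (H₁ (.inl ⟨h₀, h₁⟩))
  · exact h₂.imp (fun h₂ => H₁ (.inr (.inl ⟨h₀, h₂⟩))) fun h₂ => H₂ (.inr (.inr ⟨h₁, h₂⟩))
  · exact h₂.imp (fun h₂ => H₁ (.inr (.inr ⟨h₁, h₂⟩))) fun h₂ => H₂ (.inr (.inl ⟨h₀, h₂⟩))
  · exact .inr (H₂ (.inl ⟨h₀, h₁⟩))

end FinPres

open Certificate in
/-- Search through certificates of epimorphisms from members of a family of groups. -/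
theorem computable_search (N : ℕ) {rel : ℕ → List NatWord} (hrel : Primrec rel) :
    ∃ F : ℕ × ℕ → ℕ → Option ℕ, Computable₂ F ∧
      ∀ n (o : (ℕ × List NatWord) × (ℕ × List NatWord)) j,
        (∃ c, j ∈ F (n, Encodable.encode o) c) ↔
          (∃ c, Passes (N, rel (Nat.pair n j)) o.1 c) ∨
            ∃ c, Passes (N, rel (Nat.pair n j)) o.2 c := by
  classical
  let Cert := List NatWord × List NatWord × List (List (NatWord × ℕ × Bool))
  let T : (ℕ × ((ℕ × List NatWord) × (ℕ × List NatWord))) × ((ℕ × Bool) × Cert) → Option ℕ :=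
    fun x => if Passes (N, rel (Nat.pair x.1.1 x.2.1.1)) (bif x.2.1.2 then x.1.2.1 else x.1.2.2)
      x.2.2 then some x.2.1.1 else none
  have hT : Primrec T := by
    refine Primrec.ite ?_ (Primrec.option_some.comp (Primrec.fst.comp (Primrec.fst.comp .snd)))
      (.const none)
    refine primrecPred_passes.comp (Primrec.pair (Primrec.pair (Primrec.pair (.const N)
      (hrel.comp (Primrec₂.natPair.comp (Primrec.fst.comp .fst)
        (Primrec.fst.comp (Primrec.fst.comp .snd))))) ?_) (Primrec.snd.comp .snd))
    exact Primrec.cond (Primrec.snd.comp (Primrec.fst.comp .snd))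
      (Primrec.fst.comp (Primrec.snd.comp .fst)) (Primrec.snd.comp (Primrec.snd.comp .fst))
  let F : ℕ × ℕ → ℕ → Option ℕ := fun x c =>
    (Encodable.decode (α := (ℕ × List NatWord) × (ℕ × List NatWord)) x.2).bind fun o =>
      (Encodable.decode (α := (ℕ × Bool) × Cert) c).bind fun d => T ((x.1, o), d)
  refine ⟨F, Primrec.to_comp ?_, fun n o j => ?_⟩
  · refine Primrec.option_bind (Primrec.decode.comp (Primrec.snd.comp .fst))
      (Primrec.option_bind (Primrec.decode.comp (Primrec.snd.comp .fst)) (hT.comp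
        (Primrec.pair (Primrec.pair (Primrec.fst.comp (Primrec.fst.comp (Primrec.fst.comp .fst)))
          (Primrec.snd.comp .fst)) .snd)))
  · have hF : ∀ c, F (n, Encodable.encode o) c =
        (Encodable.decode (α := (ℕ × Bool) × Cert) c).bind fun d => T ((n, o), d) := fun c => by
      simp only [F, Encodable.encodek, Option.bind_some]
    simp only [hF]
    constructor
    · rintro ⟨c, hc⟩
      obtain ⟨⟨⟨i, b⟩, d⟩, -, hd⟩ := Option.bind_eq_some_iff.1 hc
      simp only [T] at hd
      split_ifs at hd with hp
      cases hd
      cases b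
      · exact .inr ⟨d, hp⟩
      · exact .inl ⟨d, hp⟩
    · rintro (⟨d, hd⟩ | ⟨d, hd⟩)
      · refine ⟨Encodable.encode (((j, true), d) : (ℕ × Bool) × Cert), ?_⟩
        rw [Encodable.encodek, Option.bind_some]
        exact if_pos hd
      · refine ⟨Encodable.encode (((j, false), d) : (ℕ × Bool) × Cert), ?_⟩
        rw [Encodable.encodek, Option.bind_some]
        exact if_pos hd

theorem FinPres.primrec_rawAdd : Primrec₂ FinPres.rawAdd := by
  refine Primrec.pair (Primrec.nat_add.comp (Primrec.fst.comp .fst) (Primrec.fst.comp .snd))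
    (Primrec.list_append.comp (Primrec.snd.comp .fst)
      (Primrec.list_map (Primrec.snd.comp .snd) (Primrec.list_map .snd ?_)))
  exact Primrec.pair (Primrec.nat_add.comp
    (Primrec.fst.comp (Primrec.fst.comp (Primrec.fst.comp .fst))) (Primrec.fst.comp .snd))
    (Primrec.snd.comp .snd)

/-- Theorem C (Chiodo): there is no algorithm that, on input of a finite presentation
of a group which is a free product of two nontrivial finitely presented groups, halts
and outputs two finite presentations of nontrivial groups whose free product is
isomorphic to the presented group. -/
theorem no_algorithm_free_product_splitting :
    ¬ ∃ g : ℕ →. ℕ, Nat.Partrec g ∧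
      ∀ P : FinPres,
        (∃ Q₁ Q₂ : FinPres, Nontrivial Q₁.Grp ∧ Nontrivial Q₂.Grp ∧
          Nonempty (P.Grp ≃* Monoid.Coprod Q₁.Grp Q₂.Grp)) →
        ∃ P₁ P₂ : FinPres,
          Encodable.encode (P₁, P₂) ∈ g (Encodable.encode P) ∧
          Nontrivial P₁.Grp ∧ Nontrivial P₂.Grp ∧
          Nonempty (Monoid.Coprod P₁.Grp P₂.Grp ≃* P.Grp) := by
  rintro ⟨g, hg, H⟩
  obtain ⟨N, k, rel, hkN, hrel, hlt, hfam⟩ := exists_computable_family rePred_diagonal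
  have hA : ∀ z, ∃ P : FinPres, P.raw = (N, rel z) := fun z => FinPres.exists_raw_eq (hlt z)
  choose A hA using hA
  obtain ⟨F, hF, hFspec⟩ := computable_search N hrel
  let B (n j : ℕ) : FinPres := A (Nat.pair n j)
  let P (n : ℕ) : FinPres := (B n 0).add ((B n 1).add (B n 2))
  have hP : Primrec fun n => Encodable.encode (P n) := by
    have h1 (j : ℕ) : Primrec fun n => (N, rel (Nat.pair n j)) :=
      Primrec.pair (.const N) (hrel.comp (Primrec₂.natPair.comp .id (.const j)))
    refine (Primrec.encode.comp (FinPres.primrec_rawAdd.comp (h1 0)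
      (FinPres.primrec_rawAdd.comp (h1 1) (h1 2)))).of_eq fun n => ?_
    rw [← FinPres.encode_raw, FinPres.raw_add, FinPres.raw_add]
    simp only [B, hA]
  obtain ⟨n, hn⟩ := exists_diagonal (h := fun n =>
    (g (Encodable.encode (P n))).bind fun out => Nat.rfindOpt (F (n, out)))
    (((Partrec.nat_iff.2 hg).comp hP.to_comp).bind (Partrec.rfindOpt hF))
  have hmem : ∀ j, Nat.pair n j ∈ W (Nat.pair n j).unpair.1 ↔
      j ∈ (g (Encodable.encode (P n))).bind fun out => Nat.rfindOpt (F (n, out)) := fun j => by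
    rw [Nat.unpair_pair]
    exact hn j
  have hN (j : ℕ) : (B n j).1 = N := congrArg Prod.fst (hA (Nat.pair n j))
  have hgen (j : ℕ) : ∀ w ∈ rel (Nat.pair n j), evalWord (B n j).gen w = 1 := fun w hw =>
    (B n j).evalWord_gen (by simpa only [B, hA] using hw)
  have hcollapse (j : ℕ) : ∃ k : (B n j).Grp, k * k = 1 ∧
      ∀ (Γ : Type) [Group Γ] (φ : (B n j).Grp →* Γ), φ k = 1 → φ = 1 := by
    refine ⟨(B n j).gen k, ((hfam _).1 _ _ (hgen j)).1, fun Γ _ φ hk => ?_⟩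
    refine FinPres.eq_one_of_gen fun i hi => ((hfam (Nat.pair n j)).1 Γ
      (fun i => φ ((B n j).gen i)) fun w hw => ?_).2.1 hk i (hN j ▸ hi)
    rw [← map_evalWord, hgen j w hw, map_one]
  have hnontriv (j : ℕ) (hj : ¬ Nat.pair n j ∈ W (Nat.pair n j).unpair.1) :
      Nontrivial (B n j).Grp := by
    obtain ⟨Γ, _, f, hf, hfk⟩ := (hfam _).2 hj
    exact FinPres.nontrivial_of_evalWord f (by simpa only [B, hA] using hf) (hN j ▸ hkN) hfk
  have hpair (i j : ℕ) (hij : i ≠ j) : Nontrivial (B n i).Grp ∨ Nontrivial (B n j).Grp := by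
    by_contra! h
    refine hij (Part.mem_unique ((hmem i).1 ?_) ((hmem j).1 ?_))
    · by_contra hi
      exact not_nontrivial_iff_subsingleton.2 h.1 (hnontriv i hi)
    · by_contra hj
      exact not_nontrivial_iff_subsingleton.2 h.2 (hnontriv j hj)
  obtain ⟨P₁, P₂, hout, hP₁, hP₂, ⟨e⟩⟩ := H (P n) (FinPres.exists_splitting
    (hpair 0 1 (by decide)) (hpair 0 2 (by decide)) (hpair 1 2 (by decide)))
  have henc : Encodable.encode (P₁, P₂) = Encodable.encode (P₁.raw, P₂.raw) := by
    rw [Encodable.encode_prod_val, Encodable.encode_prod_val, FinPres.encode_raw,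
      FinPres.encode_raw]
  rw [henc] at hout
  obtain ⟨j, hj⟩ : ∃ j, j ∈ Nat.rfindOpt (F (n, Encodable.encode (P₁.raw, P₂.raw))) := by
    refine Part.dom_iff_mem.1 (Nat.rfindOpt_dom.2 ?_)
    suffices ∃ j, ∃ c, j ∈ F (n, Encodable.encode (P₁.raw, P₂.raw)) c from
      let ⟨j, c, h⟩ := this
      ⟨c, j, h⟩
    simp only [hFspec]
    obtain ⟨j, θ, hθ⟩ | ⟨j, θ, hθ⟩ := FinPres.exists_surjective_of_splitting (B n) hcollapse e
    · exact ⟨j, .inl (by simpa only [B, hA] using Certificate.exists_passes θ hθ)⟩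
    · exact ⟨j, .inr (by simpa only [B, hA] using Certificate.exists_passes θ hθ)⟩
  have hW := (hmem j).2 (Part.mem_bind_iff.2 ⟨_, hout, hj⟩)
  have hsub : ∀ Q : FinPres, (∃ c, Certificate.Passes (N, rel (Nat.pair n j)) Q.raw c) →
      ¬ Nontrivial Q.Grp := by
    rintro Q ⟨c, hc⟩
    rw [not_nontrivial_iff_subsingleton]
    obtain ⟨h1, h2⟩ := hc.sound Q.gen fun w hw => Q.evalWord_gen hw
    have h3 : (fun i => evalWord Q.gen (c.1.getD i [])) = fun _ => 1 := funext fun i => by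
      rcases lt_or_ge i N with hi | hi
      · exact ((hfam _).1 _ _ h1).2.2 hW i hi
      · rw [List.getD_eq_default _ _ (hc.1.trans_le hi)]
        rfl
    refine FinPres.subsingleton_of_gen fun i hi => ?_
    rw [h2 i hi, h3]
    simp [evalWord]
  obtain ⟨c, hc⟩ := Nat.rfindOpt_spec hj
  obtain h | h := (hFspec n _ j).1 ⟨c, hc⟩
  · exact hsub P₁ h hP₁
  · exact hsub P₂ h hP₂
end
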